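/- arXiv:2301.00791 — 3 statements merged into one kernel-verified Lean document; each statement's English description precedes it below -/
import Mathlib

section
/- Let p be a prime and let r, k be integers with 1 ≤ r ≤ k. Let H be a finite abelian p-group with p^{k−1} H = 0. For a 2g × 2g matrix A over ℤ/p^kℤ, let ker(A − I) = {v ∈ (ℤ/p^kℤ)^{2g} : Av = v}, an abelian group. Then the limit as g → ∞ of the average, over A in the finite group Sp^{(r)}_{2g}(ℤ/p^kℤ), of the number of surjective group homomorphisms from ker(A − I) to H, exists and equals |(⋀²H)[p^r]|, the cardinality of the p^r-torsion subgroup of the second exterior power of H over ℤ. -/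
open scoped BigOperators
open Matrix

/-- A matrix `A` over `ℤ/p^kℤ` lies in `Sp^{(r)}_{2g}(ℤ/p^kℤ)` iff it is invertible and its
reduction modulo `p^r` is symplectic (`Mᵀ J M = J`). -/
def IsSpCong (p r k : ℕ) (hrk : r ≤ k) {g : ℕ}
    (A : Matrix (Fin g ⊕ Fin g) (Fin g ⊕ Fin g) (ZMod (p ^ k))) : Prop :=
  IsUnit A ∧
    (A.map (ZMod.castHom (pow_dvd_pow p hrk) (ZMod (p ^ r))))ᵀ *
        Matrix.J (Fin g) (ZMod (p ^ r)) *
        (A.map (ZMod.castHom (pow_dvd_pow p hrk) (ZMod (p ^ r))))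
      = Matrix.J (Fin g) (ZMod (p ^ r))

/-- `ker(A - I) = {v | A v = v}`, as a submodule of `(ℤ/p^kℤ)^{2g}`. -/
noncomputable def kerAminusI (p k : ℕ) {g : ℕ}
    (A : Matrix (Fin g ⊕ Fin g) (Fin g ⊕ Fin g) (ZMod (p ^ k))) :
    Submodule (ZMod (p ^ k)) ((Fin g ⊕ Fin g) → ZMod (p ^ k)) :=
  LinearMap.ker (A.mulVecLin - LinearMap.id)

namespace S13

section Orb
variable {R R' H Q ι : Type} [CommRing R] [CommRing R'] (ρ : R →+* R')
  [AddCommGroup H] [Module R H] [AddCommGroup Q] [Module R Q] [Fintype ι] [DecidableEq ι]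

/-- Membership in the generalized congruence group. -/
def IsG (A : Matrix (ι ⊕ ι) (ι ⊕ ι) R) : Prop :=
  IsUnit A ∧ (A.map ρ)ᵀ * Matrix.J ι R' * (A.map ρ) = Matrix.J ι R'

def act {n : Type} [Fintype n] (A : Matrix n n R) (x : n → H) : n → H :=
  fun j => ∑ i, A i j • x i

lemma act_mul {n : Type} [Fintype n] (A B : Matrix n n R) (x : n → H) :
    act (A * B) x = act B (act A x) := by
  funext j
  simp only [act, Matrix.mul_apply, Finset.sum_smul, Finset.smul_sum]
  rw [Finset.sum_comm]
  refine Finset.sum_congr rfl fun i _ => Finset.sum_congr rfl fun l _ => ?_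
  rw [smul_smul, mul_comm]

lemma act_one {n : Type} [Fintype n] [DecidableEq n] (x : n → H) :
    act (1 : Matrix n n R) x = x := by
  funext j
  simp [act, Matrix.one_apply]

variable {ρ} in
lemma IsG.mul {A B : Matrix (ι ⊕ ι) (ι ⊕ ι) R} (hA : IsG ρ A) (hB : IsG ρ B) : IsG ρ (A * B) := by
  refine ⟨hA.1.mul hB.1, ?_⟩
  rw [Matrix.map_mul, Matrix.transpose_mul]
  calc _ = (B.map ρ)ᵀ * ((A.map ρ)ᵀ * Matrix.J ι R' * (A.map ρ)) * (B.map ρ) := by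
        simp only [Matrix.mul_assoc]
    _ = _ := by rw [hA.2, hB.2]

lemma IsG.one : IsG ρ (1 : Matrix (ι ⊕ ι) (ι ⊕ ι) R) := by
  refine ⟨isUnit_one, ?_⟩
  simp [Matrix.map_one]

variable {ρ} in
lemma IsG.inv {A B : Matrix (ι ⊕ ι) (ι ⊕ ι) R} (hA : IsG ρ A) (h1 : A * B = 1) (h2 : B * A = 1) :
    IsG ρ B := by
  refine ⟨⟨⟨B, A, h2, h1⟩, rfl⟩, ?_⟩
  have h3 : A.map ρ * B.map ρ = 1 := by
    rw [← Matrix.map_mul, h1]; simp [Matrix.map_one]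
  calc _ = (B.map ρ)ᵀ * ((A.map ρ)ᵀ * Matrix.J ι R' * (A.map ρ)) * (B.map ρ) := by rw [hA.2]
    _ = (A.map ρ * B.map ρ)ᵀ * Matrix.J ι R' * (A.map ρ * B.map ρ) := by
        simp only [Matrix.mul_assoc, Matrix.transpose_mul]
    _ = _ := by rw [h3]; simp

/-- Same orbit. -/
def Eqv (x y : ι ⊕ ι → H) : Prop := ∃ A : Matrix (ι ⊕ ι) (ι ⊕ ι) R, IsG ρ A ∧ act A x = y

variable {ρ} in
lemma Eqv.trans {x y z : ι ⊕ ι → H} (h : Eqv ρ x y) (h' : Eqv ρ y z) : Eqv ρ x z := by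
  obtain ⟨A, hA, rfl⟩ := h
  obtain ⟨B, hB, rfl⟩ := h'
  exact ⟨A * B, hA.mul hB, act_mul _ _ _⟩

lemma Eqv.refl (x : ι ⊕ ι → H) : Eqv ρ x x := ⟨1, IsG.one ρ, act_one x⟩

variable {ρ} in
lemma Eqv.symm {x y : ι ⊕ ι → H} (h : Eqv ρ x y) : Eqv ρ y x := by
  obtain ⟨A, hA, rfl⟩ := h
  obtain ⟨⟨A, B, h1, h2⟩, rfl⟩ := hA.1
  refine ⟨B, hA.inv h1 h2, ?_⟩
  rw [← act_mul]
  show act (A * B) x = x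
  rw [h1, act_one]

/-- upper unipotent move -/
lemma move1 (S : Matrix ι ι R) (hS : (S.map ρ)ᵀ = S.map ρ) (a b b' : ι → H)
    (h : ∀ t, b' t = b t + ∑ i, S i t • a i) :
    Eqv ρ (Sum.elim a b) (Sum.elim a b') := by
  refine ⟨Matrix.fromBlocks 1 S 0 1, ⟨⟨⟨Matrix.fromBlocks 1 S 0 1, Matrix.fromBlocks 1 (-S) 0 1, ?_, ?_⟩, rfl⟩, ?_⟩, ?_⟩
  · simp [Matrix.fromBlocks_multiply]
  · simp [Matrix.fromBlocks_multiply]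
  · rw [Matrix.fromBlocks_map, Matrix.fromBlocks_transpose, Matrix.J, Matrix.fromBlocks_multiply,
      Matrix.fromBlocks_multiply]
    simp [Matrix.map_one, hS]
  · funext j
    rcases j with t | t
    · simp [act, Matrix.one_apply]
    · simp [act, Matrix.one_apply, h, add_comm]

/-- lower unipotent move -/
lemma move2 (S : Matrix ι ι R) (hS : (S.map ρ)ᵀ = S.map ρ) (a b a' : ι → H)
    (h : ∀ t, a' t = a t + ∑ i, S i t • b i) :
    Eqv ρ (Sum.elim a b) (Sum.elim a' b) := by
  refine ⟨Matrix.fromBlocks 1 0 S 1, ⟨⟨⟨Matrix.fromBlocks 1 0 S 1, Matrix.fromBlocks 1 0 (-S) 1, ?_, ?_⟩, rfl⟩, ?_⟩, ?_⟩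
  · simp [Matrix.fromBlocks_multiply]
  · simp [Matrix.fromBlocks_multiply]
  · rw [Matrix.fromBlocks_map, Matrix.fromBlocks_transpose, Matrix.J, Matrix.fromBlocks_multiply,
      Matrix.fromBlocks_multiply]
    simp [Matrix.map_one, hS]
  · funext j
    rcases j with t | t
    · simp [act, Matrix.one_apply, h]
    · simp [act, Matrix.one_apply]

/-- Levi move -/
lemma move3 (U W : Matrix ι ι R) (hUW : Uᵀ * W = 1) (a b a' b' : ι → H)
    (ha : ∀ t, a' t = ∑ i, U i t • a i) (hb : ∀ t, b' t = ∑ i, W i t • b i) :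
    Eqv ρ (Sum.elim a b) (Sum.elim a' b') := by
  have hWU : Wᵀ * U = 1 := by
    have := congrArg Matrix.transpose hUW
    simpa [Matrix.transpose_mul] using this
  have h1 : U * Wᵀ = 1 := mul_eq_one_comm.mp hWU
  have h2 : W * Uᵀ = 1 := mul_eq_one_comm.mp hUW
  have h3 : (U.map ρ)ᵀ * W.map ρ = 1 := by
    rw [← Matrix.transpose_map, ← Matrix.map_mul, hUW]; simp [Matrix.map_one]
  have h4 : (W.map ρ)ᵀ * U.map ρ = 1 := by
    rw [← Matrix.transpose_map, ← Matrix.map_mul, hWU]; simp [Matrix.map_one]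
  refine ⟨Matrix.fromBlocks U 0 0 W, ⟨⟨⟨Matrix.fromBlocks U 0 0 W, Matrix.fromBlocks Wᵀ 0 0 Uᵀ, ?_, ?_⟩, rfl⟩, ?_⟩, ?_⟩
  · simp [Matrix.fromBlocks_multiply, h1, h2]
  · simp [Matrix.fromBlocks_multiply, hWU, hUW]
  · rw [Matrix.fromBlocks_map, Matrix.fromBlocks_transpose, Matrix.J, Matrix.fromBlocks_multiply,
      Matrix.fromBlocks_multiply]
    simp [h3, h4]
  · funext j
    rcases j with t | t
    · simp [act, ha]
    · simp [act, hb]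

lemma move3' (E : Matrix ι ι R) (hE : ∀ i j t, E i j * E j t = 0) (a b a' b' : ι → H)
    (ha : ∀ t, a' t = a t + ∑ i, E i t • a i) (hb : ∀ t, b' t = b t - ∑ i, E t i • b i) :
    Eqv ρ (Sum.elim a b) (Sum.elim a' b') := by
  refine move3 ρ (1 + E) (1 - Eᵀ) ?_ a b a' b' ?_ ?_
  · have : Eᵀ * Eᵀ = 0 := by
      rw [← Matrix.transpose_mul]
      have : E * E = 0 := by
        ext i t; simp [Matrix.mul_apply, hE]
      simp [this]
    simp [add_mul, mul_sub, this]
  · intro t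
    simp [ha, add_smul, Finset.sum_add_distrib, Matrix.one_apply]
  · intro t
    simp [hb, sub_smul, Finset.sum_sub_distrib, Matrix.one_apply]

lemma movePerm (π : Equiv.Perm ι) (a b : ι → H) :
    Eqv ρ (Sum.elim a b) (Sum.elim (a ∘ π) (b ∘ π)) := by
  refine move3 ρ (Matrix.of fun i t => if i = π t then 1 else 0)
    (Matrix.of fun i t => if i = π t then 1 else 0) ?_
    a b _ _ ?_ ?_
  · ext i t
    simp [Matrix.mul_apply, Matrix.one_apply, eq_comm]
  · intro t; simp
  · intro t; simp

end Orb
end S13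

namespace S13

section Norm
variable {R R' H ι : Type} [CommRing R] [CommRing R'] (ρ : R →+* R')
  [AddCommGroup H] [Module R H] [Fintype ι] [DecidableEq ι]

/-- idempotent choice of representatives for the fibres of a function -/
lemma exists_rep {X : Type} [Fintype X] (f : ι → X) : ∃ rep : ι → ι, (∀ t, f (rep t) = f t) ∧
    (∀ t, rep (rep t) = rep t) ∧
    (Finset.univ.filter fun t => rep t = t).card ≤ Fintype.card X := by
  classical
  rcases isEmpty_or_nonempty ι with h | h
  · exact ⟨id, fun _ => rfl, fun _ => rfl, by simp⟩
  · have h1 : ∀ t, f (Function.invFun f (f t)) = f t := fun t =>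
      Function.invFun_eq ⟨t, rfl⟩
    refine ⟨fun t => Function.invFun f (f t), h1, fun t => by simp [h1], ?_⟩
    refine (Finset.card_le_card (t := Finset.univ.image (Function.invFun f)) ?_).trans
      Finset.card_image_le
    intro t ht
    simp only [Finset.mem_filter, Finset.mem_univ, true_and] at ht
    simp only [Finset.mem_image, Finset.mem_univ, true_and]
    exact ⟨_, ht⟩

variable (R) in
lemma clear1 [Fintype H] (a b : ι → H) : ∃ a' b' : ι → H,
    Eqv ρ (Sum.elim a b) (Sum.elim a' b') ∧
    ∃ T : Finset ι, T.card ≤ Fintype.card H ∧ ∀ t ∉ T, a' t = 0 := by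
  classical
  obtain ⟨rep, h1, h2, h3⟩ := exists_rep a
  let E : Matrix ι ι R := fun i t => if i = rep t ∧ rep t ≠ t then -1 else 0
  refine ⟨fun t => a t + ∑ i, E i t • a i, fun t => b t - ∑ i, E t i • b i,
    move3' ρ E ?_ _ _ _ _ (fun _ => rfl) (fun _ => rfl), _, h3, ?_⟩
  · intro i j t
    simp only [E]
    by_cases hj : j = rep t
    · have : rep j = j := by rw [hj, h2]
      simp [this]
    · simp [hj]
  · intro t ht
    simp only [Finset.mem_filter, Finset.mem_univ, true_and] at ht
    simp [E, ht, ite_smul, h1]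

variable (R) in
lemma clear2 [Fintype H] (a b : ι → H) : ∃ a' b' : ι → H,
    Eqv ρ (Sum.elim a b) (Sum.elim a' b') ∧
    ∃ T : Finset ι, T.card ≤ Fintype.card H + Fintype.card (H × H) ∧
      ∀ t ∉ T, a' t = 0 ∧ b' t = 0 := by
  classical
  obtain ⟨a', b', h, T, hT, hT0⟩ := clear1 R ρ a b
  obtain ⟨rep, h1, h2, h3⟩ := exists_rep (fun t => (a' t, b' t))
  have h1a : ∀ t, a' (rep t) = a' t := fun t => congrArg Prod.fst (h1 t)
  have h1b : ∀ t, b' (rep t) = b' t := fun t => congrArg Prod.snd (h1 t)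
  let E : Matrix ι ι R := fun t i => if i = rep t ∧ rep t ≠ t ∧ a' t = 0 then 1 else 0
  refine ⟨a', fun t => b' t - ∑ i, E t i • b' i,
    h.trans (move3' ρ E ?_ _ _ _ _ ?_ (fun _ => rfl)), T ∪ _,
      (Finset.card_union_le _ _).trans (add_le_add hT h3), ?_⟩
  · intro i j t
    simp only [E]
    by_cases hj : j = rep i
    · have : rep j = j := by rw [hj, h2]
      simp [this]
    · simp [hj]
  · intro t
    have : ∑ i, E i t • a' i = 0 := by
      refine Finset.sum_eq_zero fun i _ => ?_
      simp only [E]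
      split_ifs with hh
      · rw [hh.2.2, smul_zero]
      · simp
    rw [this, add_zero]
  · intro t ht
    simp only [Finset.mem_union, Finset.mem_filter, Finset.mem_univ, true_and, not_or] at ht
    refine ⟨hT0 t ht.1, ?_⟩
    simp [E, ht.2, hT0 t ht.1, ite_smul, h1b]

/-- Generating tuple. -/
def Gen (R : Type) [CommRing R] [Module R H] (x : ι ⊕ ι → H) : Prop :=
  Submodule.span R (Set.range x) = ⊤

lemma act_mem_span {n : Type} [Fintype n] (A : Matrix n n R) (x : n → H) :
    Submodule.span R (Set.range (act A x)) ≤ Submodule.span R (Set.range x) := by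
  rw [Submodule.span_le]
  rintro _ ⟨j, rfl⟩
  exact Submodule.sum_mem _ fun i _ => Submodule.smul_mem _ _ (Submodule.subset_span ⟨i, rfl⟩)

variable {ρ} in
lemma Eqv.gen {x y : ι ⊕ ι → H} (h : Eqv ρ x y) (hx : Gen R x) : Gen R y := by
  obtain ⟨A, -, rfl⟩ := h.symm
  exact top_le_iff.mp (hx ▸ act_mem_span A y)

variable (R) in
lemma place [Fintype H] (hι : 2 * Fintype.card H + Fintype.card (H × H) ≤ Fintype.card ι)
    (σ : H → ι) (hσ : Function.Injective σ) (a b : ι → H) :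
    ∃ a' b' : ι → H, Eqv ρ (Sum.elim a b) (Sum.elim a' b') ∧
      ∀ h, a' (σ h) = 0 ∧ b' (σ h) = 0 := by
  classical
  obtain ⟨a', b', h, T, hT, hT0⟩ := clear2 R ρ a b
  have hc : Fintype.card H ≤ (Tᶜ).card := by
    rw [Finset.card_compl]; omega
  obtain ⟨e⟩ : Nonempty (H ↪ (Tᶜ : Finset ι)) :=
    Function.Embedding.nonempty_of_card_le (by rw [Fintype.card_coe]; exact hc)
  obtain ⟨π, hπ⟩ := Equiv.Perm.exists_extending_pair σ (fun x => (e x : ι)) hσ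
    (Subtype.val_injective.comp e.injective)
  refine ⟨a' ∘ π, b' ∘ π, h.trans (movePerm ρ π a' b'), fun x => ?_⟩
  have hx := hπ x
  have := hT0 (e x) (Finset.mem_compl.mp (e x).2)
  simp only [Function.comp] at hx ⊢
  rw [hx]; exact this

/-- The normal form. -/
noncomputable def N (σ : H → ι) (β : H → H) : ι ⊕ ι → H :=
  Sum.elim (Function.extend σ id 0) (Function.extend σ β 0)

lemma fill [Fintype H] (σ : H → ι) (hσ : Function.Injective σ) (a b : ι → H)
    (hg : Gen R (Sum.elim a b)) (h0 : ∀ h, a (σ h) = 0 ∧ b (σ h) = 0) :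
    ∃ a' : ι → H, Eqv ρ (Sum.elim a b) (Sum.elim a' b) ∧ ∀ h, a' (σ h) = h := by
  classical
  let τ : ι → H := Function.extend σ id 0
  have hτ : ∀ h, τ (σ h) = h := fun h => hσ.extend_apply _ _ _
  have hcd : ∀ t, ∃ c : ι ⊕ ι → R, ∑ i, c i • (Sum.elim a b) i = τ t := by
    intro t
    have : τ t ∈ Submodule.span R (Set.range (Sum.elim a b)) := by
      rw [show Submodule.span R (Set.range (Sum.elim a b)) = ⊤ from hg]; trivial
    exact (Submodule.mem_span_range_iff_exists_fun R).mp this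
  choose c hc using hcd
  simp only [Fintype.sum_sum_type, Sum.elim_inl, Sum.elim_inr] at hc
  have ha0 : ∀ t ∈ Set.range σ, a t = 0 := by rintro _ ⟨h, rfl⟩; exact (h0 h).1
  have hb0 : ∀ t ∈ Set.range σ, b t = 0 := by rintro _ ⟨h, rfl⟩; exact (h0 h).2
  let E : Matrix ι ι R := fun i t =>
    if t ∈ Set.range σ ∧ i ∉ Set.range σ then c t (Sum.inl i) else 0
  let D : Matrix ι ι R := fun i t =>
    if t ∈ Set.range σ ∧ i ∉ Set.range σ then c t (Sum.inr i) else 0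
  have hE : ∀ h, ∑ i, E i (σ h) • a i = ∑ i, c (σ h) (Sum.inl i) • a i := by
    intro h
    refine Finset.sum_congr rfl fun i _ => ?_
    by_cases hi : i ∈ Set.range σ
    · simp [ha0 i hi]
    · simp only [E, Set.mem_range_self, hi, not_false_eq_true, and_self, if_true]
  have hD : ∀ h, ∑ i, D i (σ h) • b i = ∑ i, c (σ h) (Sum.inr i) • b i := by
    intro h
    refine Finset.sum_congr rfl fun i _ => ?_
    by_cases hi : i ∈ Set.range σ
    · simp [hb0 i hi]
    · simp only [D, Set.mem_range_self, hi, not_false_eq_true, and_self, if_true]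
  have hEb : ∀ t, ∑ i, E t i • b i = 0 := by
    intro t
    refine Finset.sum_eq_zero fun i _ => ?_
    by_cases hi : i ∈ Set.range σ
    · simp [hb0 i hi]
    · simp only [E, hi, false_and, if_false, zero_smul]
  have hDb : ∀ t, ∑ i, D t i • b i = 0 := by
    intro t
    refine Finset.sum_eq_zero fun i _ => ?_
    by_cases hi : i ∈ Set.range σ
    · simp [hb0 i hi]
    · simp only [D, hi, false_and, if_false, zero_smul]
  let a1 : ι → H := fun t => a t + ∑ i, E i t • a i
  let a2 : ι → H := fun t => a1 t + ∑ i, (D + Dᵀ) i t • b i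
  refine ⟨a2, (move3' ρ E ?_ a b a1 b (fun _ => rfl) ?_).trans
    (move2 ρ (D + Dᵀ) ?_ a1 b a2 (fun _ => rfl)), ?_⟩
  · intro i j t
    by_cases hj : j ∈ Set.range σ
    · simp only [E, hj, not_true_eq_false, and_false, if_false, mul_zero]
    · simp only [E, hj, false_and, if_false, zero_mul]
  · intro t
    rw [hEb, sub_zero]
  · simp [Matrix.map_add, Matrix.transpose_map, add_comm]
  · intro h
    simp only [a2, a1, Matrix.add_apply, Matrix.transpose_apply, add_smul, Finset.sum_add_distrib,
      hE, hD, hDb, (h0 h).1, zero_add, add_zero, hc, hτ]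

lemma finish [Fintype H] (σ : H → ι) (hσ : Function.Injective σ) (a b : ι → H)
    (h0 : ∀ h, a (σ h) = h) :
    ∃ β, Eqv ρ (Sum.elim a b) (N σ β) := by
  classical
  let E : Matrix ι ι R := fun i t => if t ∉ Set.range σ ∧ i = σ (a t) then -1 else 0
  let a1 : ι → H := fun t => a t + ∑ i, E i t • a i
  let b1 : ι → H := fun t => b t - ∑ i, E t i • b i
  have ha1 : a1 = Function.extend σ id 0 := by
    funext t
    by_cases ht : t ∈ Set.range σ
    · obtain ⟨h, rfl⟩ := ht
      rw [hσ.extend_apply]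
      simp only [a1, E, Set.mem_range_self, not_true_eq_false, false_and, if_false, zero_smul,
        Finset.sum_const_zero, add_zero, h0, id]
    · rw [Function.extend_apply' _ _ _ (by simpa using ht)]
      have ht' : ∀ x, ¬ σ x = t := by simpa using ht
      simp [a1, E, ht', ite_smul, h0]
  have e1 : Eqv ρ (Sum.elim a b) (Sum.elim a1 b1) := by
    refine move3' ρ E ?_ _ _ _ _ (fun _ => rfl) (fun _ => rfl)
    intro i j t
    by_cases hj : j ∈ Set.range σ
    · simp only [E, hj, not_true_eq_false, false_and, if_false, zero_mul]
    · have : j ≠ σ (a t) := fun h => hj ⟨_, h.symm⟩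
      simp only [E, this, and_false, if_false, mul_zero]
  let T : Matrix ι ι R := fun i t => if t ∉ Set.range σ ∧ i = σ (b1 t) then -1 else 0
  let b2 : ι → H := fun t => b1 t + ∑ i, (T + Tᵀ) i t • a1 i
  have e2 : Eqv ρ (Sum.elim a1 b1) (Sum.elim a1 b2) := by
    refine move1 ρ (T + Tᵀ) ?_ _ _ _ (fun _ => rfl)
    simp [Matrix.map_add, Matrix.transpose_map, add_comm]
  have hT2 : ∀ t, ∑ i, T t i • a1 i = 0 := by
    intro t
    refine Finset.sum_eq_zero fun i _ => ?_
    by_cases hi : i ∈ Set.range σ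
    · simp only [T, hi, not_true_eq_false, false_and, if_false, zero_smul]
    · rw [ha1, Function.extend_apply' _ _ _ (by simpa using hi)]
      simp
  have hb2 : b2 = Function.extend σ (fun h => b2 (σ h)) 0 := by
    funext t
    by_cases ht : t ∈ Set.range σ
    · obtain ⟨h, rfl⟩ := ht
      rw [hσ.extend_apply]
    · rw [Function.extend_apply' _ _ _ (by simpa using ht)]
      have ht' : ∀ x, ¬ σ x = t := by simpa using ht
      have : ∑ i, T i t • a1 i = - b1 t := by
        simp [T, ht', ite_smul, ha1, hσ.extend_apply]
      simp only [b2, Matrix.add_apply, Matrix.transpose_apply, add_smul, Finset.sum_add_distrib,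
        hT2, this]
      simp
  refine ⟨fun h => b2 (σ h), ?_⟩
  unfold N
  rw [← hb2, ← ha1]
  exact e1.trans e2

lemma normalize [Fintype H] (hι : 2 * Fintype.card H + Fintype.card (H × H) ≤ Fintype.card ι)
    (σ : H → ι) (hσ : Function.Injective σ) (x : ι ⊕ ι → H) (hx : Gen R x) :
    ∃ β, Eqv ρ x (N σ β) := by
  obtain ⟨a, b, rfl⟩ : ∃ a b, x = Sum.elim a b := ⟨x ∘ Sum.inl, x ∘ Sum.inr, by simp⟩
  obtain ⟨a1, b1, h1, h1'⟩ := place R ρ hι σ hσ a b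
  obtain ⟨a2, h2, h2'⟩ := fill ρ σ hσ a1 b1 (h1.gen hx) h1'
  obtain ⟨β, h3⟩ := finish ρ σ hσ a2 b1 h2'
  exact ⟨β, (h1.trans h2).trans h3⟩

lemma N_gen (σ : H → ι) (hσ : Function.Injective σ) (β : H → H) : Gen R (N σ β) := by
  refine top_le_iff.mp fun h _ => Submodule.subset_span ⟨Sum.inl (σ h), ?_⟩
  simp [N, hσ.extend_apply]

end Norm
end S13

namespace S13

section Inv
variable {R R' H Q ι : Type} [CommRing R] [CommRing R'] (ρ : R →+* R')
  [AddCommGroup H] [Module R H] [AddCommGroup Q] [Module R Q] [Fintype ι] [DecidableEq ι]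
  (φ : H →ₗ[R] H →ₗ[R] Q)

/-- The invariant. -/
def qinv (x : ι ⊕ ι → H) : Q := ∑ i, φ (x (Sum.inl i)) (x (Sum.inr i))

lemma alt_swap (hφ : ∀ x, φ x x = 0) (x y : H) : φ x y = - φ y x := by
  have := hφ (x + y)
  simp only [map_add, LinearMap.add_apply, hφ, zero_add, add_zero] at this
  rw [add_comm] at this
  exact eq_neg_of_add_eq_zero_left this

lemma sym_zero (hφ : ∀ x, φ x x = 0) (hρ : ∀ c : R, ρ c = 0 → ∀ q : Q, c • q = 0)
    {n : Type} [Fintype n] [DecidableEq n] (C : n → n → R) (hC : ∀ i j, ρ (C i j) = ρ (C j i))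
    (x : n → H) : ∑ i, ∑ j, C i j • φ (x i) (x j) = 0 := by
  rw [← Fintype.sum_prod_type' (f := fun i j => C i j • φ (x i) (x j))]
  refine Finset.sum_involution (fun ij _ => (ij.2, ij.1)) ?_ ?_ ?_ ?_
  · rintro ⟨i, j⟩ _
    have : (C i j - C j i) • φ (x i) (x j) = 0 := hρ _ (by rw [map_sub, hC, sub_self]) _
    rw [sub_smul, sub_eq_zero] at this
    simp only [this, alt_swap φ hφ (x j) (x i), smul_neg, add_neg_cancel]
  · rintro ⟨i, j⟩ _ h1 h2
    simp only [Prod.mk.injEq] at h2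
    apply h1
    simp only [h2.1, hφ, smul_zero]
  · intros; simp
  · intros; simp

lemma qinv_act (A : Matrix (ι ⊕ ι) (ι ⊕ ι) R) (x : ι ⊕ ι → H) :
    qinv φ (act A x) = ∑ i, ∑ i', (∑ j, A i (Sum.inl j) * A i' (Sum.inr j)) • φ (x i) (x i') := by
  have h : ∀ j, φ (act A x (Sum.inl j)) (act A x (Sum.inr j)) =
      ∑ i, ∑ i', (A i (Sum.inl j) * A i' (Sum.inr j)) • φ (x i) (x i') := by
    intro j
    simp only [act, map_sum, LinearMap.sum_apply, map_smul, LinearMap.smul_apply, Finset.smul_sum,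
      smul_smul]
    rw [Finset.sum_comm]
    refine Finset.sum_congr rfl fun i _ => Finset.sum_congr rfl fun i' _ => ?_
    rw [mul_comm]
  simp only [qinv, h, Finset.sum_smul]
  rw [Finset.sum_comm]
  refine Finset.sum_congr rfl fun i _ => ?_
  rw [Finset.sum_comm]

lemma IsG.mulJ {A : Matrix (ι ⊕ ι) (ι ⊕ ι) R} (hA : IsG ρ A) (i i' : ι ⊕ ι) :
    (∑ j, ρ (A i (Sum.inr j)) * ρ (A i' (Sum.inl j))) -
      ∑ j, ρ (A i (Sum.inl j)) * ρ (A i' (Sum.inr j)) = Matrix.J ι R' i i' := by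
  have h : A.map ρ ∈ Matrix.symplecticGroup ι R' := SymplecticGroup.mem_iff'.mpr hA.2
  rw [SymplecticGroup.mem_iff] at h
  have := congrFun (congrFun h i) i'
  rw [← this]
  simp [Matrix.J, Matrix.mul_apply, Matrix.one_apply, Finset.sum_neg_distrib, sub_eq_add_neg,
    Matrix.fromBlocks_apply₁₁]

lemma qinv_aux (hφ : ∀ x, φ x x = 0) (hρ : ∀ c : R, ρ c = 0 → ∀ q : Q, c • q = 0)
    (x : ι ⊕ ι → H) {A B : Matrix (ι ⊕ ι) (ι ⊕ ι) R} (hA : IsG ρ A) (hB : IsG ρ B) :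
    qinv φ (act B x) = qinv φ (act A x) := by
  rw [qinv_act, qinv_act, ← sub_eq_zero]
  simp only [← Finset.sum_sub_distrib, ← sub_smul]
  refine sym_zero ρ φ hφ hρ _ (fun i j => ?_) x
  simp only [map_sum, map_sub, map_mul]
  have h1 := IsG.mulJ ρ hA i j
  rw [← IsG.mulJ ρ hB i j] at h1
  have h2 : ∀ B : Matrix (ι ⊕ ι) (ι ⊕ ι) R,
      ∑ l, ρ (B j (Sum.inl l)) * ρ (B i (Sum.inr l)) =
      ∑ l, ρ (B i (Sum.inr l)) * ρ (B j (Sum.inl l)) := fun B =>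
    Finset.sum_congr rfl fun _ _ => mul_comm _ _
  simp only [Finset.sum_sub_distrib]
  rw [h2 A, h2 B]
  linear_combination h1

lemma qinv_eqv (hφ : ∀ x, φ x x = 0) (hρ : ∀ c : R, ρ c = 0 → ∀ q : Q, c • q = 0)
    {x y : ι ⊕ ι → H} (h : Eqv ρ x y) : qinv φ x = qinv φ y := by
  obtain ⟨A, hA, rfl⟩ := h
  rw [← qinv_aux ρ φ hφ hρ x hA (IsG.one ρ), act_one]

lemma N_move (σ : H → ι) (hσ : Function.Injective σ) [Fintype H] (T : H → H → R)
    (hT : ∀ i j, ρ (T i j) = ρ (T j i)) (β β' : H → H)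
    (hβ : ∀ h, β' h = β h + ∑ h', T h' h • h') : Eqv ρ (N σ β) (N σ β') := by
  classical
  let τ : ι → H := Function.extend σ id 0
  have hτ : ∀ h, τ (σ h) = h := fun h => hσ.extend_apply _ _ _
  let S : Matrix ι ι R := fun i t =>
    if i ∈ Set.range σ ∧ t ∈ Set.range σ then T (τ i) (τ t) else 0
  refine move1 ρ S ?_ _ _ _ ?_
  · ext i j
    show ρ (S j i) = ρ (S i j)
    by_cases hi : i ∈ Set.range σ <;> by_cases hj : j ∈ Set.range σ <;>
      simp only [S, hi, hj, and_self, and_true, and_false, if_true, if_false, hT (τ i)]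
  · intro t
    by_cases ht : t ∈ Set.range σ
    · obtain ⟨h, rfl⟩ := ht
      rw [hσ.extend_apply, hσ.extend_apply, hβ]
      congr 1
      refine Fintype.sum_of_injective σ hσ _ _ ?_ ?_
      · intro i hi
        simp only [S, hi, false_and, if_false, zero_smul]
      · intro h'
        simp only [S, Set.mem_range_self, and_self, if_true, hτ]
        rw [hσ.extend_apply, id]
    · rw [Function.extend_apply' _ _ _ (by simpa using ht),
        Function.extend_apply' _ _ _ (by simpa using ht)]
      simp only [S, ht, and_false, if_false, zero_smul]
      simp

lemma qinv_N (σ : H → ι) (hσ : Function.Injective σ) [Fintype H] (β : H → H) :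
    qinv φ (N σ β) = ∑ h, φ h (β h) := by
  symm
  refine Fintype.sum_of_injective σ hσ _ _ ?_ ?_
  · intro i hi
    simp only [N, Sum.elim_inl]
    rw [Function.extend_apply' _ _ _ (by simpa using hi)]
    simp
  · intro h
    simp [N, hσ.extend_apply]

/-- Periods of the normal form. -/
def Per (σ : H → ι) : AddSubgroup (H → H) where
  carrier := {κ | ∀ β, Eqv ρ (N σ β) (N σ (β + κ))}
  zero_mem' := fun β => by rw [add_zero]; exact Eqv.refl ρ _
  add_mem' := fun {κ κ'} h h' β => by
    rw [← add_assoc]; exact (h β).trans (h' _)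
  neg_mem' := fun {κ} h β => by
    have := (h (β + -κ)).symm
    rwa [neg_add_cancel_right] at this

lemma per_of (σ : H → ι) (hσ : Function.Injective σ) [Fintype H] (T : H → H → R)
    (hT : ∀ i j, ρ (T i j) = ρ (T j i)) (κ : H → H) (hκ : ∀ h, κ h = ∑ h', T h' h • h') :
    κ ∈ Per ρ σ := fun β => N_move ρ σ hσ T hT β _ fun h => by rw [Pi.add_apply, hκ]

open Classical in
lemma per_alt (σ : H → ι) (hσ : Function.Injective σ) [Fintype H] (a : H) :
    (Pi.single a a : H → H) ∈ Per ρ σ := by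
  refine per_of ρ σ hσ (fun i j => if i = a ∧ j = a then 1 else 0) ?_ _ ?_
  · intro i j; simp only [and_comm]
  · intro h
    by_cases hh : h = a
    · subst hh; simp [ite_smul]
    · simp [hh]

open Classical in
lemma per_n (σ : H → ι) (hσ : Function.Injective σ) [Fintype H] (n : ℕ) (hn : ρ n = 0) (a b : H) :
    n • (Pi.single a b : H → H) ∈ Per ρ σ := by
  refine per_of ρ σ hσ (fun i j => if i = b ∧ j = a then (n : R) else 0) ?_ _ ?_
  · intro i j
    split_ifs <;> simp [hn]
  · intro h
    by_cases hh : h = a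
    · subst hh; simp [ite_smul, Nat.cast_smul_eq_nsmul]
    · simp [hh]

open Classical in
lemma per_add (σ : H → ι) (hσ : Function.Injective σ) [Fintype H] (a a' b : H) :
    (Pi.single (a + a') b - Pi.single a b - Pi.single a' b : H → H) ∈ Per ρ σ := by
  let e : H → H → R := fun x y => if x = y then 1 else 0
  let D : H → H → R := fun i j => e i b * (e j (a + a') - e j a - e j a')
  refine per_of ρ σ hσ (fun i j => D i j + D j i) ?_ _ ?_
  · intro i j; rw [add_comm]
  · intro h
    have h1 : ∑ h', D h' h • h' = (e h (a + a') - e h a - e h a') • b := by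
      simp [D, e, ite_smul]
    have h2 : ∑ h', D h h' • h' = 0 := by
      simp only [D, mul_smul, ← Finset.smul_sum, sub_smul, Finset.sum_sub_distrib]
      simp [e, ite_smul]
    simp only [add_smul, Finset.sum_add_distrib, h1, h2, add_zero]
    simp only [e, Pi.sub_apply, Pi.single_apply, sub_smul, ite_smul, one_smul, zero_smul]

end Inv
end S13

namespace S13

section Burn
variable {R R' H Q ι : Type} [CommRing R] [CommRing R'] (ρ : R →+* R')
  [AddCommGroup H] [Module R H] [AddCommGroup Q] [Module R Q] [Fintype ι] [DecidableEq ι]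
  (φ : H →ₗ[R] H →ₗ[R] Q)

/-- The universal property required of the pair. -/
def Univ (n : ℕ) : Prop :=
  ∀ (D : Type) [AddCommGroup D] (ψ : H →+ H →+ D), (∀ x, ψ x x = 0) → (∀ d : D, n • d = 0) →
    ∃ f : Q →+ D, ∀ a b, f (φ a b) = ψ a b

lemma N_eqv_of_q [Fintype H] (n : ℕ) (hn : ρ n = 0) (hU : Univ φ n)
    (σ : H → ι) (hσ : Function.Injective σ) (β β' : H → H)
    (h : qinv φ (N σ β) = qinv φ (N σ β')) : Eqv ρ (N σ β) (N σ β') := by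
  classical
  let mk := QuotientAddGroup.mk' (Per ρ σ)
  have hmk : ∀ x, x ∈ Per ρ σ → mk x = 0 := fun x hx => (QuotientAddGroup.eq_zero_iff x).mpr hx
  let ψ0 : H → H →+ ((H → H) ⧸ Per ρ σ) := fun a => mk.comp (AddMonoidHom.single (fun _ => H) a)
  have hψ0 : ∀ a b, ψ0 a b = mk (Pi.single a b) := fun a b => rfl
  let ψ : H →+ H →+ ((H → H) ⧸ Per ρ σ) := AddMonoidHom.mk' ψ0 (by
    intro a a'
    ext b
    rw [AddMonoidHom.add_apply, hψ0, hψ0, hψ0, ← sub_eq_zero, ← sub_sub, ← map_sub, ← map_sub]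
    exact hmk _ (per_add ρ σ hσ a a' b))
  have hψ : ∀ a b, ψ a b = mk (Pi.single a b) := fun a b => rfl
  have hsum : ∀ κ : H → H, κ = ∑ a, Pi.single a (κ a) := fun κ =>
    (Finset.univ_sum_single κ).symm
  obtain ⟨f, hf⟩ := hU _ ψ (fun x => hmk _ (per_alt ρ σ hσ x)) (by
    intro d
    obtain ⟨κ, rfl⟩ := QuotientAddGroup.mk'_surjective _ d
    rw [← map_nsmul]
    apply hmk
    rw [hsum κ, Finset.smul_sum]
    exact sum_mem fun a _ => per_n ρ σ hσ n hn a _)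
  have key : ∀ β, f (qinv φ (N σ β)) = mk β := by
    intro β
    rw [qinv_N φ σ hσ, map_sum]
    simp only [hf, hψ, ← map_sum]
    rw [← hsum]
  have h2 : mk β = mk β' := by rw [← key, ← key, h]
  have h3 : -β + β' ∈ Per ρ σ := QuotientAddGroup.eq.mp h2
  have := h3 β
  rwa [add_neg_cancel_left] at this

/-- The group. -/
def GG (ι : Type) [Fintype ι] [DecidableEq ι] : Subgroup (Matrix (ι ⊕ ι) (ι ⊕ ι) R)ˣ where
  carrier := {u | IsG ρ (u : Matrix (ι ⊕ ι) (ι ⊕ ι) R)}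
  one_mem' := IsG.one ρ
  mul_mem' := fun {a b} ha hb => by
    show IsG ρ ((a * b : (Matrix (ι ⊕ ι) (ι ⊕ ι) R)ˣ) : Matrix (ι ⊕ ι) (ι ⊕ ι) R)
    rw [Units.val_mul]; exact IsG.mul ha hb
  inv_mem' := fun {a} ha => IsG.inv (A := a.val) ha a.mul_inv a.inv_mul

/-- The set of generating tuples. -/
abbrev XX (R H ι : Type) [CommRing R] [AddCommGroup H] [Module R H] := {x : ι ⊕ ι → H // Gen R x}

lemma act_gen (u : GG ρ ι) (x : XX R H ι) : Gen R (act (u⁻¹ : GG ρ ι).1.val x.1) :=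
  Eqv.gen (ρ := ρ) ⟨_, (u⁻¹).2, rfl⟩ x.2

instance : MulAction (GG ρ ι) (XX R H ι) where
  smul u x := ⟨act (u⁻¹ : GG ρ ι).1.val x.1, act_gen ρ u x⟩
  one_smul x := Subtype.ext (by
    show act (1⁻¹ : GG ρ ι).1.val x.1 = x.1
    rw [inv_one]; exact act_one _)
  mul_smul u v x := Subtype.ext (by
    show act ((u * v)⁻¹ : GG ρ ι).1.val x.1 = act (u⁻¹ : GG ρ ι).1.val (act (v⁻¹ : GG ρ ι).1.val x.1)
    rw [_root_.mul_inv_rev, ← act_mul]; rfl)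

lemma smul_val (u : GG ρ ι) (x : XX R H ι) : (u • x).1 = act (u⁻¹ : GG ρ ι).1.val x.1 := rfl

lemma orb_iff (x y : XX R H ι) : MulAction.orbitRel (GG ρ ι) (XX R H ι) x y ↔ Eqv ρ x.1 y.1 := by
  rw [MulAction.orbitRel_apply, MulAction.mem_orbit_iff]
  constructor
  · rintro ⟨u, rfl⟩
    exact Eqv.symm ⟨_, (u⁻¹).2, rfl⟩
  · intro h
    obtain ⟨A, hA, h⟩ := h.symm
    obtain ⟨u, rfl⟩ := hA.1
    refine ⟨(⟨u, hA⟩ : GG ρ ι)⁻¹, Subtype.ext ?_⟩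
    rw [smul_val, inv_inv]
    exact h

theorem card_orbits [Fintype H] (n : ℕ) (hn : ρ n = 0) (hU : Univ φ n)
    (hφ : ∀ x, φ x x = 0) (hρ : ∀ c : R, ρ c = 0 → ∀ q : Q, c • q = 0)
    (hs : ∀ q : Q, ∃ β : H → H, q = ∑ h, φ h (β h))
    (hι : 2 * Fintype.card H + Fintype.card (H × H) ≤ Fintype.card ι) :
    Nat.card (Quotient (MulAction.orbitRel (GG ρ ι) (XX R H ι))) = Nat.card Q := by
  classical
  obtain ⟨σ⟩ : Nonempty (H ↪ ι) := Function.Embedding.nonempty_of_card_le (by omega)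
  let F : Quotient (MulAction.orbitRel (GG ρ ι) (XX R H ι)) → Q :=
    Quotient.lift (fun x => qinv φ x.1) (fun x y h =>
      qinv_eqv ρ φ hφ hρ ((orb_iff ρ x y).mp h))
  refine Nat.card_congr (Equiv.ofBijective F ⟨?_, ?_⟩)
  · rintro ⟨x⟩ ⟨y⟩ h
    apply Quotient.sound
    refine (orb_iff ρ x y).mpr ?_
    have h : qinv φ x.1 = qinv φ y.1 := h
    obtain ⟨β, h1⟩ := normalize ρ hι σ σ.injective x.1 x.2
    obtain ⟨β', h2⟩ := normalize ρ hι σ σ.injective y.1 y.2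
    refine (h1.trans (N_eqv_of_q ρ φ n hn hU σ σ.injective β β' ?_)).trans h2.symm
    rw [← qinv_eqv ρ φ hφ hρ h1, ← qinv_eqv ρ φ hφ hρ h2, h]
  · intro q
    obtain ⟨β, rfl⟩ := hs q
    refine ⟨Quotient.mk _ ⟨N σ β, N_gen σ σ.injective β⟩, ?_⟩
    exact qinv_N φ σ σ.injective β

/-- equivalence between matrices and units -/
noncomputable def ggEquiv : GG ρ ι ≃ {A : Matrix (ι ⊕ ι) (ι ⊕ ι) R // IsG ρ A} where
  toFun u := ⟨u.1.val, u.2⟩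
  invFun A := ⟨A.2.1.unit, A.2⟩
  left_inv u := by ext; rfl
  right_inv A := rfl

theorem burnside [Finite R] [Fintype H] (n : ℕ) (hn : ρ n = 0) (hU : Univ φ n)
    (hφ : ∀ x, φ x x = 0) (hρ : ∀ c : R, ρ c = 0 → ∀ q : Q, c • q = 0)
    (hs : ∀ q : Q, ∃ β : H → H, q = ∑ h, φ h (β h))
    (hι : 2 * Fintype.card H + Fintype.card (H × H) ≤ Fintype.card ι)
    [Fintype {A : Matrix (ι ⊕ ι) (ι ⊕ ι) R // IsG ρ A}] :
    ∑ A : {A : Matrix (ι ⊕ ι) (ι ⊕ ι) R // IsG ρ A},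
      Nat.card {x : ι ⊕ ι → H // Gen R x ∧ act A.1 x = x} =
    Nat.card Q * Nat.card {A : Matrix (ι ⊕ ι) (ι ⊕ ι) R // IsG ρ A} := by
  classical
  have : Finite (XX R H ι) := Subtype.finite
  have : Fintype (XX R H ι) := Fintype.ofFinite _
  have : Fintype (GG ρ ι) := Fintype.ofEquiv _ (ggEquiv ρ).symm
  have : Fintype (Quotient (MulAction.orbitRel (GG ρ ι) (XX R H ι))) := Fintype.ofFinite _
  have hb := MulAction.sum_card_fixedBy_eq_card_orbits_mul_card_group (GG ρ ι) (XX R H ι)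
  rw [← Nat.card_eq_fintype_card, ← Nat.card_eq_fintype_card, card_orbits ρ φ n hn hU hφ hρ hs hι,
    Nat.card_congr (ggEquiv ρ)] at hb
  rw [← hb]
  symm
  refine Fintype.sum_equiv (ggEquiv ρ) _ _ fun u => ?_
  rw [← Nat.card_eq_fintype_card]
  refine Nat.card_congr ⟨fun x => ⟨x.1.1, x.1.2, ?_⟩, fun x => ⟨⟨x.1, x.2.1⟩, ?_⟩,
    fun _ => rfl, fun _ => rfl⟩
  · have h := congrArg Subtype.val ((MulAction.mem_fixedBy).mp x.2)
    rw [smul_val] at h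
    conv_lhs => rw [← h]
    show act u.1.val _ = _
    rw [← act_mul]
    have : (u⁻¹ : GG ρ ι).1.val * u.1.val = 1 := u.1.inv_mul
    rw [this, act_one]
  · rw [MulAction.mem_fixedBy]
    apply Subtype.ext
    rw [smul_val]
    have h : act u.1.val x.1 = x.1 := x.2.2
    conv_lhs => rw [← h]
    rw [← act_mul]
    have : u.1.val * (u⁻¹ : GG ρ ι).1.val = 1 := u.1.mul_inv
    rw [this, act_one]

end Burn
end S13

namespace S13

section Count

lemma card_zmod_hom (n m : ℕ) [NeZero m] :
    Nat.card (ZMod n →+ ZMod m) = m.gcd n := by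
  have h := IsAddCyclic.card_nsmulAddMonoidHom_ker (ZMod m) n
  rw [Nat.card_zmod] at h
  rw [← h]
  refine Nat.card_congr ((ZMod.lift n).symm.trans ⟨fun f => ⟨f.1 1, ?_⟩,
    fun y => ⟨zmultiplesHom _ y.1, ?_⟩, ?_, ?_⟩)
  · have := f.2
    rw [AddMonoidHom.mem_ker, nsmulAddMonoidHom_apply, ← map_nsmul]
    simpa using this
  · have := y.2
    rw [AddMonoidHom.mem_ker, nsmulAddMonoidHom_apply] at this
    simpa using this
  · intro f
    ext; simp
  · intro y
    ext; simp

lemma card_tors_zmod (n m : ℕ) [NeZero n] : Nat.card {y : ZMod n // m • y = 0} = n.gcd m := by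
  have h := IsAddCyclic.card_nsmulAddMonoidHom_ker (ZMod n) m
  rw [Nat.card_zmod] at h
  exact h

lemma card_hom_zmod (X : Type) [AddCommGroup X] [Finite X] (m : ℕ) [NeZero m] :
    Nat.card (X →+ ZMod m) = Nat.card {x : X // m • x = 0} := by
  classical
  obtain ⟨ι, _, n, hn, ⟨e⟩⟩ := AddCommGroup.equiv_directSum_zmod_of_finite' X
  have : ∀ i, NeZero (n i) := fun i => ⟨by have := hn i; omega⟩
  have e1 : (X →+ ZMod m) ≃ (∀ i, ZMod (n i) →+ ZMod m) :=
    (AddEquiv.addMonoidHomCongrLeftEquiv e).trans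
      (DFinsupp.liftAddHom (β := fun i => ZMod (n i)) (γ := ZMod m)).symm.toEquiv
  let e' := e.trans (DirectSum.addEquivProd _)
  have e2 : {x : X // m • x = 0} ≃ (∀ i, {y : ZMod (n i) // m • y = 0}) := 
    (Equiv.subtypeEquiv (q := fun f : (∀ i, ZMod (n i)) => ∀ i, m • f i = 0) e'.toEquiv (by
      intro a
      rw [← (map_eq_zero_iff e' e'.injective), map_nsmul, funext_iff]
      rfl)).trans
      (Equiv.subtypePiEquivPi (β := fun i => ZMod (n i)) (p := fun i y => m • y = 0))
  rw [Nat.card_congr e1, Nat.card_congr e2, Nat.card_pi, Nat.card_pi]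
  refine Finset.prod_congr rfl fun i _ => ?_
  rw [card_zmod_hom, card_tors_zmod, Nat.gcd_comm]

lemma card_hom_eq {X Y : Type} [AddCommGroup X] [AddCommGroup Y] [Finite X] [Finite Y]
    (p k : ℕ) (hp : p.Prime)
    (hXY : ∀ j ≤ k, Nat.card {x : X // p ^ j • x = 0} = Nat.card {x : Y // p ^ j • x = 0})
    (H : Type) [AddCommGroup H] [Finite H] (hH : ∀ x : H, p ^ k • x = 0) :
    Nat.card (X →+ H) = Nat.card (Y →+ H) := by
  classical
  obtain ⟨ι, _, n, hn, ⟨e⟩⟩ := AddCommGroup.equiv_directSum_zmod_of_finite' H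
  have : ∀ i, NeZero (n i) := fun i => ⟨by have := hn i; omega⟩
  let e' := e.trans (DirectSum.addEquivProd _)
  have hdvd : ∀ i, n i ∣ p ^ k := by
    intro i
    have h1 := hH (e'.symm (Pi.single i 1))
    rw [← map_nsmul, map_eq_zero_iff _ e'.symm.injective] at h1
    have h2 := congrFun h1 i
    simp only [Pi.smul_apply, Pi.single_eq_same, Pi.zero_apply] at h2
    rw [nsmul_one] at h2
    exact (ZMod.natCast_eq_zero_iff _ _).mp h2
  have main : ∀ (Z : Type) [AddCommGroup Z] [Finite Z],
      Nat.card (Z →+ H) = ∏ i, Nat.card {x : Z // n i • x = 0} := by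
    intro Z _ _
    have e1 : (Z →+ H) ≃ (∀ i, Z →+ ZMod (n i)) :=
      (AddEquiv.addMonoidHomCongrRightEquiv e').trans
        ⟨fun f i => (Pi.evalAddMonoidHom _ i).comp f, fun f => AddMonoidHom.pi f,
          fun f => rfl, fun f => rfl⟩
    rw [Nat.card_congr e1, Nat.card_pi]
    exact Finset.prod_congr rfl fun i _ => card_hom_zmod Z (n i)
  rw [main, main]
  refine Finset.prod_congr rfl fun i _ => ?_
  obtain ⟨j, hj, hj'⟩ := (Nat.dvd_prime_pow hp).mp (hdvd i)
  rw [hj']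
  exact hXY j hj

lemma card_hom_sum (X H : Type) [AddCommGroup X] [AddCommGroup H] [Finite X] [Finite H] :
    Nat.card (X →+ H) = ∑ᶠ K : AddSubgroup H, Nat.card {f : X →+ K // Function.Surjective f} := by
  classical
  have : Finite (X →+ H) := DFunLike.finite _
  have : Fintype (AddSubgroup H) := Fintype.ofFinite _
  rw [finsum_eq_sum_of_fintype]
  have hf : ∀ K : AddSubgroup H, Finite {f : X →+ K // Function.Surjective f} := fun K => by
    have : Finite (X →+ K) := DFunLike.finite _
    infer_instance
  rw [← Nat.card_sigma]
  symm
  refine Nat.card_congr (Equiv.ofBijective (fun s => s.1.subtype.comp s.2.1) ⟨?_, fun f =>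
    ⟨⟨f.range, f.rangeRestrict, f.rangeRestrict_surjective⟩, rfl⟩⟩)
  rintro ⟨K, f, hf⟩ ⟨K', f', hf'⟩ h
  have h : K.subtype.comp f = K'.subtype.comp f' := h
  have hK : ∀ (K : AddSubgroup H) (f : X →+ K), Function.Surjective f →
      (K.subtype.comp f).range = K := fun K f hf => by
    rw [AddMonoidHom.range_comp, AddMonoidHom.range_eq_top.mpr hf, ← AddMonoidHom.range_eq_map,
      AddSubgroup.range_subtype]
  obtain rfl : K = K' := by rw [← hK K f hf, h, hK K' f' hf']
  obtain rfl : f = f' := by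
    ext x
    exact DFunLike.congr_fun h x
  rfl

lemma card_surj_eq {X Y : Type} [AddCommGroup X] [AddCommGroup Y] [Finite X] [Finite Y]
    (p k : ℕ) (hp : p.Prime)
    (hXY : ∀ j ≤ k, Nat.card {x : X // p ^ j • x = 0} = Nat.card {x : Y // p ^ j • x = 0})
    (c : ℕ) : ∀ (H : Type) [AddCommGroup H] [Finite H] (_ : ∀ x : H, p ^ k • x = 0)
      (_ : Nat.card H = c),
    Nat.card {f : X →+ H // Function.Surjective f} =
      Nat.card {f : Y →+ H // Function.Surjective f} := by
  classical
  induction c using Nat.strong_induction_on with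
  | _ c ih =>
  intro H _ _ hH hc
  have h := card_hom_eq p k hp hXY H hH
  have : Fintype (AddSubgroup H) := Fintype.ofFinite _
  rw [card_hom_sum, card_hom_sum, finsum_eq_sum_of_fintype, finsum_eq_sum_of_fintype,
    ← Finset.add_sum_erase _ _ (Finset.mem_univ (⊤ : AddSubgroup H)),
    ← Finset.add_sum_erase (a := ⊤) _ (fun K : AddSubgroup H =>
      Nat.card {f : Y →+ K // Function.Surjective f}) (Finset.mem_univ _)] at h
  have h2 : ∑ K ∈ Finset.univ.erase (⊤ : AddSubgroup H),
      Nat.card {f : X →+ K // Function.Surjective f} =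
    ∑ K ∈ Finset.univ.erase (⊤ : AddSubgroup H),
      Nat.card {f : Y →+ K // Function.Surjective f} := by
    refine Finset.sum_congr rfl fun K hK => ?_
    refine ih (Nat.card K) ?_ K (fun x => Subtype.ext (by simpa using hH x)) rfl
    rw [← hc]
    refine lt_of_le_of_ne (AddSubgroup.card_le_card_addGroup K) fun hh => ?_
    exact (Finset.mem_erase.mp hK).1 (AddSubgroup.eq_top_of_card_eq K hh)
  rw [h2] at h
  have h3 := Nat.add_right_cancel h
  have top : ∀ (Z : Type) [AddCommGroup Z],
      Nat.card {f : Z →+ (⊤ : AddSubgroup H) // Function.Surjective f} =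
      Nat.card {f : Z →+ H // Function.Surjective f} := by
    intro Z _
    refine Nat.card_congr (Equiv.subtypeEquiv
      (AddEquiv.addMonoidHomCongrRightEquiv AddSubgroup.topEquiv) ?_)
    intro f
    exact (AddSubgroup.topEquiv (G := H)).toEquiv.comp_surjective f |>.symm
  rwa [top, top] at h3

lemma card_tors_ker_coker {V : Type} [AddCommGroup V] [Finite V] (m c : ℕ)
    (hm : ∀ v : V, m • v = 0 ↔ ∃ w : V, c • w = v) (hc : ∀ v : V, c • v = 0 ↔ ∃ w : V, m • w = v)
    (N : V →+ V) :
    Nat.card {x : N.ker // m • x = 0} = Nat.card {y : V ⧸ N.range // m • y = 0} := by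
  let K := (nsmulAddMonoidHom m : V →+ V).ker
  have hK : ∀ v, v ∈ K ↔ m • v = 0 := fun v => Iff.rfl
  let N' : K →+ K := (N.comp K.subtype).codRestrict K (fun v => by
    rw [hK]
    show m • N v.1 = 0
    rw [← map_nsmul, (hK _).mp v.2, map_zero])
  have hN' : ∀ v : K, (N' v).1 = N v.1 := fun v => rfl
  let C : V →+ K := (nsmulAddMonoidHom c : V →+ V).codRestrict K (fun v => by
    rw [hK]; exact (hm _).mpr ⟨v, rfl⟩)
  have hC : ∀ v : V, (C v).1 = c • v := fun v => rfl
  have hCs : Function.Surjective C := by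
    rintro ⟨v, hv⟩
    obtain ⟨w, rfl⟩ := (hm v).mp hv
    exact ⟨w, rfl⟩
  have h1 : Nat.card {x : N.ker // m • x = 0} = Nat.card N'.ker := by
    refine Nat.card_congr ⟨fun x => ⟨⟨x.1.1, ?_⟩, ?_⟩, fun x => ⟨⟨x.1.1, ?_⟩, ?_⟩,
      fun _ => rfl, fun _ => rfl⟩
    · rw [hK]; exact congrArg Subtype.val x.2
    · rw [AddMonoidHom.mem_ker]; exact Subtype.ext x.1.2
    · have := AddMonoidHom.mem_ker.mp x.2
      exact congrArg Subtype.val this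
    · exact Subtype.ext ((hK _).mp x.1.2)
  have h2 : Nat.card {y : V ⧸ N.range // m • y = 0} =
      Nat.card (nsmulAddMonoidHom m : V ⧸ N.range →+ V ⧸ N.range).ker := rfl
  rw [h1, h2, ← AddSubgroup.index_range, ← AddSubgroup.index_range,
    ← AddSubgroup.index_comap_of_surjective _ hCs,
    ← AddSubgroup.index_comap_of_surjective _ (QuotientAddGroup.mk'_surjective N.range)]
  congr 1
  ext v
  simp only [AddSubgroup.mem_comap, AddMonoidHom.mem_range]
  constructor
  · rintro ⟨u, hu⟩
    obtain ⟨u', hu'⟩ := (hm u.1).mp u.2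
    have h3 : c • (v - N u') = 0 := by
      have := congrArg Subtype.val hu
      rw [hN', hC, ← hu', map_nsmul] at this
      rw [smul_sub, this, sub_self]
    obtain ⟨w, hw⟩ := (hc _).mp h3
    refine ⟨QuotientAddGroup.mk' _ w, ?_⟩
    rw [nsmulAddMonoidHom_apply, ← map_nsmul, hw]
    rw [map_sub, sub_eq_self]
    exact (QuotientAddGroup.eq_zero_iff _).mpr ⟨u', rfl⟩
  · rintro ⟨y, hy⟩
    obtain ⟨w, rfl⟩ := QuotientAddGroup.mk'_surjective _ y
    rw [nsmulAddMonoidHom_apply, ← map_nsmul] at hy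
    obtain ⟨u, hu⟩ : -(m • w) + v ∈ N.range := QuotientAddGroup.eq.mp hy
    refine ⟨C u, Subtype.ext ?_⟩
    rw [hN', hC, hC, map_nsmul, hu, smul_add, smul_neg, (hc _).mpr ⟨w, rfl⟩]
    simp

end Count
end S13

namespace S13

section Fin

lemma zmod_tors (p k j : ℕ) (hp : p.Prime) (hj : j ≤ k) (n : Type) (v : n → ZMod (p ^ k)) :
    p ^ j • v = 0 ↔ ∃ w : n → ZMod (p ^ k), p ^ (k - j) • w = v := by
  have hk : p ^ k = p ^ j * p ^ (k - j) := by rw [← pow_add]; congr 1; omega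
  have : NeZero (p ^ k) := ⟨pow_ne_zero _ hp.ne_zero⟩
  constructor
  · intro h
    have h1 : ∀ i, ∃ y : ZMod (p ^ k), p ^ (k - j) • y = v i := by
      intro i
      have h2 := congrFun h i
      rw [Pi.smul_apply, Pi.zero_apply, nsmul_eq_mul, ← ZMod.natCast_zmod_val (v i),
        ← Nat.cast_mul, ZMod.natCast_eq_zero_iff] at h2
      have h3 : p ^ (k - j) ∣ (v i).val := by
        exact Nat.dvd_of_mul_dvd_mul_left (pow_pos hp.pos j) ((dvd_of_eq hk.symm).trans h2)
      obtain ⟨d, hd⟩ := h3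
      refine ⟨d, ?_⟩
      rw [nsmul_eq_mul, ← Nat.cast_mul, ← hd, ZMod.natCast_zmod_val]
    choose w hw using h1
    exact ⟨w, funext hw⟩
  · rintro ⟨w, rfl⟩
    rw [smul_smul, ← hk]
    funext i
    simp [nsmul_eq_mul]

/-- Surjections from the cokernel. -/
lemma card_surj_coker {p k : ℕ} {ι H : Type} [Fintype ι] [DecidableEq ι] [AddCommGroup H]
    [Module (ZMod (p ^ k)) H] (A : Matrix (ι ⊕ ι) (ι ⊕ ι) (ZMod (p ^ k)))
    (N : (ι ⊕ ι → ZMod (p ^ k)) →+ (ι ⊕ ι → ZMod (p ^ k)))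
    (hN : ∀ v, N v = A *ᵥ v - v) :
    Nat.card {f : ((ι ⊕ ι → ZMod (p ^ k)) ⧸ N.range) →+ H // Function.Surjective f} =
    Nat.card {x : ι ⊕ ι → H // Gen (ZMod (p ^ k)) x ∧ act A x = x} := by
  let lc : (ι ⊕ ι → H) → ((ι ⊕ ι → ZMod (p ^ k)) →ₗ[ZMod (p ^ k)] H) := fun x => Fintype.linearCombination (ZMod (p ^ k)) x
  have lc_single : ∀ x i, lc x (Pi.single i 1) = x i := fun x i => by
    simp [lc, Fintype.linearCombination_apply_single]
  have hact : ∀ x v, lc x (A *ᵥ v) = lc (act A x) v := by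
    intro x v
    simp only [lc, Fintype.linearCombination_apply, act, Matrix.mulVec, dotProduct,
      Finset.sum_smul, Finset.smul_sum, smul_smul]
    rw [Finset.sum_comm]
    simp only [mul_comm]
  have hle : ∀ x, act A x = x → N.range ≤ (lc x).toAddMonoidHom.ker := by
    rintro x hx _ ⟨v, rfl⟩
    rw [AddMonoidHom.mem_ker, hN]
    show lc x _ = 0
    rw [map_sub, hact, hx, sub_self]
  symm
  refine Nat.card_congr (Equiv.ofBijective (fun x =>
    ⟨QuotientAddGroup.lift N.range (lc x.1).toAddMonoidHom (hle x.1 x.2.2), ?_⟩) ⟨?_, ?_⟩)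
  · intro h
    have : h ∈ LinearMap.range (lc x.1) := by
      rw [Fintype.range_linearCombination, show Submodule.span (ZMod (p ^ k)) (Set.range x.1) = ⊤ from x.2.1]
      trivial
    obtain ⟨v, hv⟩ := this
    exact ⟨QuotientAddGroup.mk v, hv⟩
  · intro x y hxy
    have h1 := congrArg Subtype.val hxy
    apply Subtype.ext
    funext i
    have h2 := DFunLike.congr_fun h1 (QuotientAddGroup.mk (Pi.single i 1))
    have h3 : lc x.1 (Pi.single i 1) = lc y.1 (Pi.single i 1) := h2
    rwa [lc_single, lc_single] at h3
  · rintro ⟨f, hf⟩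
    let F : (ι ⊕ ι → ZMod (p ^ k)) →+ H := f.comp (QuotientAddGroup.mk' N.range)
    let Fl : (ι ⊕ ι → ZMod (p ^ k)) →ₗ[ZMod (p ^ k)] H := AddMonoidHom.toZModLinearMap (p ^ k) F
    have hFl : ∀ v, Fl v = f (QuotientAddGroup.mk v) := fun v => rfl
    let x : ι ⊕ ι → H := fun i => Fl (Pi.single i 1)
    have hx : lc x = Fl := by
      refine LinearMap.pi_ext' fun i => LinearMap.ext_ring ?_
      exact lc_single x i
    have hgen : Gen (ZMod (p ^ k)) x := by
      unfold Gen
      rw [← Fintype.range_linearCombination]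
      show LinearMap.range (lc x) = ⊤
      rw [hx, LinearMap.range_eq_top]
      intro h
      obtain ⟨y, rfl⟩ := hf h
      obtain ⟨v, rfl⟩ := QuotientAddGroup.mk'_surjective _ y
      exact ⟨v, rfl⟩
    have hinv : act A x = x := by
      funext i
      rw [← lc_single (act A x) i, ← hact, ← lc_single x i, hx, ← sub_eq_zero]
      rw [← map_sub, ← hN, hFl]
      rw [(QuotientAddGroup.eq_zero_iff _).mpr (AddMonoidHom.mem_range.mpr ⟨_, rfl⟩), map_zero]
    refine ⟨⟨x, hgen, hinv⟩, Subtype.ext ?_⟩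
    refine DFunLike.ext _ _ fun y => ?_
    obtain ⟨v, rfl⟩ := QuotientAddGroup.mk'_surjective _ y
    show lc x v = f (QuotientAddGroup.mk v)
    rw [hx, hFl]

end Fin
end S13

namespace S13

section Wedge

lemma wedge_data (H : Type) [AddCommGroup H] [Fintype H] :
    ∃ W : H →+ H →+ (⋀[ℤ]^2 H), (∀ x, W x x = 0) ∧
      (∀ (D : Type) [AddCommGroup D] (ψ : H →+ H →+ D), (∀ x, ψ x x = 0) →
        ∃ f : (⋀[ℤ]^2 H) →+ D, ∀ a b, f (W a b) = ψ a b) ∧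
      (∀ q, ∃ β : H → H, q = ∑ h, W h (β h)) := by
  classical
  have hadd1 : ∀ a a' b : H, exteriorPower.ιMulti ℤ 2 ![a + a', b] =
      exteriorPower.ιMulti ℤ 2 ![a, b] + exteriorPower.ιMulti ℤ 2 ![a', b] := fun a a' b =>
    AlternatingMap.map_vecCons_add _ _ _ _
  have hadd2 : ∀ a b b' : H, exteriorPower.ιMulti ℤ 2 ![a, b + b'] =
      exteriorPower.ιMulti ℤ 2 ![a, b] + exteriorPower.ιMulti ℤ 2 ![a, b'] := fun a b b' =>
    AlternatingMap.map_vecCons_add ((exteriorPower.ιMulti ℤ 2 (M := H)).curryLeft a) ![] b b'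
  let W : H →+ H →+ (⋀[ℤ]^2 H) := AddMonoidHom.mk' (fun a =>
    AddMonoidHom.mk' (fun b => exteriorPower.ιMulti ℤ 2 ![a, b]) (hadd2 a)) (fun a a' => by
      ext1 b
      exact hadd1 a a' b)
  have hW : ∀ a b, W a b = exteriorPower.ιMulti ℤ 2 ![a, b] := fun a b => rfl
  refine ⟨W, ?_, ?_, ?_⟩
  · intro x
    rw [hW]
    exact AlternatingMap.map_eq_zero_of_eq _ _ (i := 0) (j := 1) rfl (by decide)
  · intro D _ ψ hψ
    let P : H [⋀^Fin 2]→ₗ[ℤ] D :=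
      { toFun := fun v => ψ (v 0) (v 1)
        map_update_add' := by
          intro _ m i x y
          fin_cases i <;> simp [Function.update]
        map_update_smul' := by
          intro _ m i c x
          fin_cases i <;> simp [Function.update]
        map_eq_zero_of_eq' := by
          intro v i j hij hne
          fin_cases i <;> fin_cases j <;> simp at hij hne ⊢
          · rw [hij]; exact hψ _
          · rw [hij]; exact hψ _ }
    refine ⟨(exteriorPower.alternatingMapLinearEquiv P).toAddMonoidHom, fun a b => ?_⟩
    exact exteriorPower.alternatingMapLinearEquiv_apply_ιMulti P ![a, b]
  · let S : (H → H) →+ (⋀[ℤ]^2 H) := AddMonoidHom.mk' (fun β => ∑ h, W h (β h)) (by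
      intro β β'
      simp [Finset.sum_add_distrib])
    have h1 : Submodule.span ℤ (Set.range (exteriorPower.ιMulti ℤ 2 (M := H))) ≤
        AddSubgroup.toIntSubmodule S.range := by
      rw [Submodule.span_le]
      rintro _ ⟨v, rfl⟩
      refine AddMonoidHom.mem_range.mpr ⟨Pi.single (v 0) (v 1), ?_⟩
      show ∑ h, W h ((Pi.single (v 0) (v 1) : H → H) h) = _
      rw [Finset.sum_eq_single (v 0)]
      · rw [Pi.single_eq_same, hW]
        congr 1
        ext i
        fin_cases i <;> rfl
      · intro b _ hb
        rw [Pi.single_eq_of_ne hb, map_zero]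
      · intro h
        exact absurd (Finset.mem_univ _) h
    rw [exteriorPower.ιMulti_span] at h1
    intro q
    obtain ⟨β, hβ⟩ := AddMonoidHom.mem_range.mp (h1 (Submodule.mem_top (x := q)))
    exact ⟨β, hβ.symm⟩

lemma quot_data (M : Type) [AddCommGroup M] [Finite M] (n : ℕ) :
    ∃ (Q : Type) (_ : AddCommGroup Q) (π : M →+ Q), Function.Surjective π ∧
      (∀ q : Q, n • q = 0) ∧
      (∀ (D : Type) [AddCommGroup D] (f : M →+ D), (∀ d : D, n • d = 0) →
        ∃ f' : Q →+ D, ∀ m, f' (π m) = f m) ∧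
      Nat.card Q = Nat.card {m : M // n • m = 0} := by
  let μ : M →+ M := nsmulAddMonoidHom n
  have hμ : ∀ m, μ m = n • m := fun m => rfl
  refine ⟨M ⧸ μ.range, inferInstance, QuotientAddGroup.mk' μ.range,
    QuotientAddGroup.mk'_surjective _, ?_, ?_, ?_⟩
  · intro q
    obtain ⟨m, rfl⟩ := QuotientAddGroup.mk'_surjective _ q
    rw [← map_nsmul]
    exact (QuotientAddGroup.eq_zero_iff _).mpr (AddMonoidHom.mem_range.mpr ⟨m, rfl⟩)
  · intro D _ f hD
    refine ⟨QuotientAddGroup.lift μ.range f ?_, fun m => rfl⟩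
    rintro _ ⟨m, rfl⟩
    rw [AddMonoidHom.mem_ker, hμ, map_nsmul, hD]
  · have h1 : Nat.card (M ⧸ μ.range) = Nat.card μ.ker := AddSubgroup.index_range
    exact h1

lemma mk_phi {R H Q : Type} [CommRing R] [AddCommGroup H] [Module R H] [AddCommGroup Q]
    [Module R Q] (W : H →+ H →+ Q) (h1 : ∀ (c : R) a b, W (c • a) b = c • W a b)
    (h2 : ∀ (c : R) a b, W a (c • b) = c • W a b) :
    ∃ φ : H →ₗ[R] H →ₗ[R] Q, ∀ a b, φ a b = W a b :=
  ⟨LinearMap.mk₂ R (fun a b => W a b) (fun a a' b => by rw [map_add, AddMonoidHom.add_apply])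
    h1 (fun a b b' => by rw [map_add]) h2, fun a b => rfl⟩

lemma burnside_add {R R' ι H Q : Type} [CommRing R] [CommRing R'] [Fintype ι] [DecidableEq ι]
    [AddCommGroup H] [Module R H] [AddCommGroup Q] [Module R Q] (W : H →+ H →+ Q)
    (h1 : ∀ (c : R) a b, W (c • a) b = c • W a b)
    (h2 : ∀ (c : R) a b, W a (c • b) = c • W a b)
    (ρ : R →+* R') [Finite R] [Fintype H] (n : ℕ) (hn : ρ n = 0)
    (hU : ∀ (D : Type) [AddCommGroup D] (ψ : H →+ H →+ D), (∀ x, ψ x x = 0) →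
      (∀ d : D, n • d = 0) → ∃ f : Q →+ D, ∀ a b, f (W a b) = ψ a b)
    (hφ : ∀ x, W x x = 0) (hρ : ∀ c : R, ρ c = 0 → ∀ q : Q, c • q = 0)
    (hs : ∀ q : Q, ∃ β : H → H, q = ∑ h, W h (β h))
    (hι : 2 * Fintype.card H + Fintype.card (H × H) ≤ Fintype.card ι)
    [Fintype {A : Matrix (ι ⊕ ι) (ι ⊕ ι) R // IsG ρ A}] :
    ∑ A : {A : Matrix (ι ⊕ ι) (ι ⊕ ι) R // IsG ρ A},
      Nat.card {x : ι ⊕ ι → H // Gen R x ∧ act A.1 x = x} =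
    Nat.card Q * Nat.card {A : Matrix (ι ⊕ ι) (ι ⊕ ι) R // IsG ρ A} := by
  obtain ⟨φ, hφW⟩ := mk_phi W h1 h2
  refine burnside ρ φ n hn ?_ ?_ hρ ?_ hι
  · intro D _ ψ hψ hD
    obtain ⟨f, hf⟩ := hU D ψ hψ hD
    exact ⟨f, fun a b => by rw [hφW, hf]⟩
  · intro x
    rw [hφW, hφ]
  · intro q
    obtain ⟨β, hβ⟩ := hs q
    exact ⟨β, by rw [hβ]; exact Finset.sum_congr rfl fun h _ => (hφW _ _).symm⟩

/-- The eventual value of the sum for abstract data. -/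
lemma sum_eq (p r k : ℕ) (hp : p.Prime) (hrk : r ≤ k) (H : Type) [AddCommGroup H] [Fintype H]
    (hH : ∀ x : H, p ^ k • x = 0) [Module (ZMod (p ^ k)) H] (g : ℕ)
    (hg : 2 * Fintype.card H + Fintype.card (H × H) ≤ g)
    [instG : Fintype {A : Matrix (Fin g ⊕ Fin g) (Fin g ⊕ Fin g) (ZMod (p ^ k)) //
      IsG (ZMod.castHom (pow_dvd_pow p hrk) (ZMod (p ^ r))) A}] :
    ∑ A : {A : Matrix (Fin g ⊕ Fin g) (Fin g ⊕ Fin g) (ZMod (p ^ k)) //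
      IsG (ZMod.castHom (pow_dvd_pow p hrk) (ZMod (p ^ r))) A},
      Nat.card {x : Fin g ⊕ Fin g → H // Gen (ZMod (p ^ k)) x ∧ act A.1 x = x} =
    Nat.card (Submodule.torsionBy ℤ (⋀[ℤ]^2 H) ((p : ℤ) ^ r)) *
      Nat.card {A : Matrix (Fin g ⊕ Fin g) (Fin g ⊕ Fin g) (ZMod (p ^ k)) //
      IsG (ZMod.castHom (pow_dvd_pow p hrk) (ZMod (p ^ r))) A} := by
  obtain ⟨W, hW0, hWU, hWs⟩ := wedge_data H
  have : NeZero (p ^ k) := ⟨pow_ne_zero _ hp.ne_zero⟩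
  have hfin : Finite (⋀[ℤ]^2 H) :=
    Finite.of_surjective (fun β : H → H => ∑ h, W h (β h)) fun q => by
      obtain ⟨β, hβ⟩ := hWs q
      exact ⟨β, hβ.symm⟩
  obtain ⟨Q, _, π, hπ, hQr, hQU, hQc⟩ := quot_data (⋀[ℤ]^2 H) (p ^ r)
  have hQk : ∀ q : Q, p ^ k • q = 0 := by
    intro q
    rw [show p ^ k = p ^ (k - r) * p ^ r by rw [← pow_add]; congr 1; omega, mul_smul, hQr,
      smul_zero]
  let _ : Module (ZMod (p ^ k)) Q := AddCommGroup.zmodModule hQk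
  have key := burnside_add (ι := Fin g) (Q := Q) (W.compr₂ π)
    (fun c a b => ZMod.map_smul (π.comp (W.flip b)) c a)
    (fun c a b => ZMod.map_smul (π.comp (W a)) c b)
    (ZMod.castHom (pow_dvd_pow p hrk) (ZMod (p ^ r))) (p ^ r) ?_ ?_ ?_ ?_ ?_ ?_
  · rw [key, hQc]
    refine congrArg (· * _) ?_
    refine Nat.card_congr (Equiv.subtypeEquivRight fun x => ?_)
    rw [Submodule.mem_torsionBy_iff, ← natCast_zsmul]
    push_cast
    rfl
  · rw [map_natCast]
    exact (ZMod.natCast_eq_zero_iff _ _).mpr dvd_rfl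
  · intro D _ ψ hψ hD
    obtain ⟨f, hf⟩ := hWU D ψ hψ
    obtain ⟨f', hf'⟩ := hQU D f hD
    exact ⟨f', fun a b => (hf' _).trans (hf a b)⟩
  · intro x
    rw [AddMonoidHom.compr₂_apply, hW0, map_zero]
  · intro c hc q
    rw [← ZMod.natCast_zmod_val c, map_natCast, ZMod.natCast_eq_zero_iff] at hc
    obtain ⟨d, hd⟩ := hc
    rw [← ZMod.natCast_zmod_val c, Nat.cast_smul_eq_nsmul, hd, mul_comm, mul_smul, hQr, smul_zero]
  · intro q
    obtain ⟨m, rfl⟩ := hπ q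
    obtain ⟨β, hβ⟩ := hWs m
    refine ⟨β, ?_⟩
    rw [hβ, map_sum]
    rfl
  · rw [Fintype.card_fin]
    exact hg

end Wedge

end S13

/-- Let `p` be a prime, `1 ≤ r ≤ k`, and `H` a finite abelian `p`-group with
`p^{k-1} H = 0`.  Then the limit as `g → ∞` of the average over
`A ∈ Sp^{(r)}_{2g}(ℤ/p^kℤ)` of the number of surjective group homomorphisms
`ker(A - I) → H` exists and equals `|(⋀²H)[p^r]|`. -/
theorem stmt_13 (p : ℕ) (hp : p.Prime) (r k : ℕ) (hr : 1 ≤ r) (hrk : r ≤ k)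
    (H : Type) [AddCommGroup H] [Finite H] (hH : ∀ x : H, ((p : ℤ) ^ (k - 1)) • x = 0) :
    Filter.Tendsto
      (fun g : ℕ =>
        (∑' A : {A : Matrix (Fin g ⊕ Fin g) (Fin g ⊕ Fin g) (ZMod (p ^ k)) //
              IsSpCong p r k hrk A},
            (Nat.card {f : (kerAminusI p k A.1) →+ H // Function.Surjective f} : ℝ)) /
          (Nat.card {A : Matrix (Fin g ⊕ Fin g) (Fin g ⊕ Fin g) (ZMod (p ^ k)) //
              IsSpCong p r k hrk A} : ℝ))
      Filter.atTop
      (nhds (Nat.card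
        (Submodule.torsionBy ℤ (⋀[ℤ]^2 H) ((p : ℤ) ^ r)) : ℝ)) := by
  classical
  have := Fintype.ofFinite H
  have : NeZero (p ^ k) := ⟨pow_ne_zero _ hp.ne_zero⟩
  have hHk : ∀ x : H, p ^ k • x = 0 := by
    intro x
    have h1 : p ^ (k - 1) • x = 0 := by
      rw [← hH x, ← natCast_zsmul]
      push_cast
      rfl
    rw [show p ^ k = p * p ^ (k - 1) by rw [← pow_succ']; congr 1; omega, mul_smul, h1, smul_zero]
  let _ : Module (ZMod (p ^ k)) H := AddCommGroup.zmodModule hHk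
  refine tendsto_const_nhds.congr' ?_
  rw [Filter.EventuallyEq, Filter.eventually_atTop]
  refine ⟨2 * Fintype.card H + Fintype.card (H × H), fun g hg => ?_⟩
  have : Fintype {A : Matrix (Fin g ⊕ Fin g) (Fin g ⊕ Fin g) (ZMod (p ^ k)) //
      IsSpCong p r k hrk A} := Fintype.ofFinite _
  have hpos : (Nat.card {A : Matrix (Fin g ⊕ Fin g) (Fin g ⊕ Fin g) (ZMod (p ^ k)) //
      IsSpCong p r k hrk A} : ℝ) ≠ 0 := by
    have : Nonempty {A : Matrix (Fin g ⊕ Fin g) (Fin g ⊕ Fin g) (ZMod (p ^ k)) //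
      IsSpCong p r k hrk A} := ⟨⟨1, S13.IsG.one _⟩⟩
    exact Nat.cast_ne_zero.mpr Nat.card_pos.ne'
  rw [eq_div_iff hpos, tsum_fintype]
  have h2 := S13.sum_eq p r k hp hrk H hHk g hg
    (instG := this)
  rw [← Nat.cast_sum, ← Nat.cast_mul]
  refine congrArg Nat.cast (h2.symm.trans (Finset.sum_congr rfl fun A _ => ?_))
  let N : (Fin g ⊕ Fin g → ZMod (p ^ k)) →+ (Fin g ⊕ Fin g → ZMod (p ^ k)) :=
    (A.1.mulVecLin - LinearMap.id).toAddMonoidHom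
  rw [← S13.card_surj_coker (H := H) A.1 N (fun v => rfl)]
  symm
  exact S13.card_surj_eq (X := N.ker) p k hp (fun j hj => S13.card_tors_ker_coker (p ^ j)
    (p ^ (k - j)) (S13.zmod_tors p k j hp hj _) (fun v => by
      have h3 := S13.zmod_tors p k (k - j) hp (Nat.sub_le _ _) _ v
      rwa [Nat.sub_sub_self hj] at h3) N) _ H hHk rfl
end

section
/- Let p be a prime, let r, k be integers with 1 ≤ r ≤ k, and let G be a finite abelian p-group with p^{k−1} G = 0. For a 2g × 2g matrix A over ℤ/p^kℤ, let ker(A − I) = {v ∈ (ℤ/p^kℤ)^{2g} : Av = v}. Then the limit as g → ∞ of the proportion |{A ∈ Sp^{(r)}_{2g}(ℤ/p^kℤ) : ker(A − I) ≅ G as abelian groups}| / |Sp^{(r)}_{2g}(ℤ/p^kℤ)| exists. -/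
open scoped BigOperators
open Matrix

/-- the sieve coefficient -/
noncomputable def svC (p i : ℕ) : ℝ := (-1) ^ i / ∏ s ∈ Finset.range i, ((p : ℝ) ^ (s + 1) - 1)

lemma sv_den_pos {p : ℕ} (hp : 2 ≤ p) (s : ℕ) : (0 : ℝ) < (p : ℝ) ^ (s + 1) - 1 := by
  have h : (1 : ℝ) < (p : ℝ) ^ (s + 1) :=
    one_lt_pow₀ (by exact_mod_cast (by omega : 1 < p)) (by omega)
  linarith

lemma sv_partial {p : ℕ} (hp : 2 ≤ p) (x : ℝ) (m : ℕ) :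
    ∑ i ∈ Finset.range (m + 1), svC p i * ∏ l ∈ Finset.range i, (x - (p : ℝ) ^ l)
      = ∏ l ∈ Finset.range m, (((p : ℝ) ^ (l + 1) - x) / ((p : ℝ) ^ (l + 1) - 1)) := by
  induction m with
  | zero => simp [svC]
  | succ m ih =>
    rw [Finset.sum_range_succ, ih, Finset.prod_range_succ (fun l => ((p : ℝ) ^ (l + 1) - x) / _)]
    have h1 : svC p (m + 1) * ∏ l ∈ Finset.range (m + 1), (x - (p : ℝ) ^ l)
        = (∏ l ∈ Finset.range m, (((p : ℝ) ^ (l + 1) - x) / ((p : ℝ) ^ (l + 1) - 1))) *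
          ((1 - x) / ((p : ℝ) ^ (m + 1) - 1)) := by
      rw [svC, Finset.prod_range_succ' (fun l => x - (p : ℝ) ^ l), Finset.prod_range_succ,
        Finset.prod_div_distrib]
      have : ∏ k ∈ Finset.range m, (x - (p : ℝ) ^ (k + 1))
          = (-1) ^ m * ∏ k ∈ Finset.range m, ((p : ℝ) ^ (k + 1) - x) := by
        rw [← Finset.card_range m, ← Finset.prod_const, Finset.card_range,
          ← Finset.prod_mul_distrib]
        exact Finset.prod_congr rfl (fun k _ => by ring)
      rw [this]
      have h0 : ∏ s ∈ Finset.range m, ((p : ℝ) ^ (s + 1) - 1) ≠ 0 :=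
        Finset.prod_ne_zero_iff.2 fun s _ => (sv_den_pos hp s).ne'
      have h2 := (sv_den_pos hp m).ne'
      have h3 : ((-1 : ℝ) ^ m) * (-1) ^ m = 1 := by rw [← mul_pow]; simp
      field_simp
      rw [pow_succ]
      linear_combination (-1 + x) * (∏ k ∈ Finset.range m, ((p : ℝ) ^ (k + 1) - x)) * (-1) * h3
    rw [h1]
    have h2 := (sv_den_pos hp m).ne'
    field_simp
    ring

lemma sv_eval {p : ℕ} (hp : 2 ≤ p) (e m : ℕ) (hem : e ≤ m) :
    ∑ i ∈ Finset.range (m + 1), svC p i * ∏ l ∈ Finset.range i, ((p : ℝ) ^ e - (p : ℝ) ^ l)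
      = if e = 0 then 1 else 0 := by
  rw [sv_partial hp]
  split_ifs with h
  · subst h
    refine Finset.prod_eq_one fun l _ => ?_
    rw [pow_zero]
    exact div_self (sv_den_pos hp l).ne'
  · refine Finset.prod_eq_zero (i := e - 1) (by simp; omega) ?_
    rw [show e - 1 + 1 = e by omega]; simp

lemma sv_summable {p : ℕ} (hp : 2 ≤ p) :
    Summable fun i : ℕ => ∏ s ∈ Finset.range i, ((p : ℝ) ^ s / ((p : ℝ) ^ (s + 1) - 1)) := by
  have hp' : (2 : ℝ) ≤ p := by exact_mod_cast hp
  refine summable_of_ratio_norm_eventually_le (r := 2 / 3) (by norm_num) ?_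
  filter_upwards [Filter.eventually_ge_atTop 1] with n hn
  rw [Finset.prod_range_succ, norm_mul, mul_comm]
  gcongr
  rw [Real.norm_of_nonneg (div_nonneg (by positivity) (sv_den_pos hp n).le),
    div_le_iff₀ (sv_den_pos hp n), pow_succ]
  have : (2 : ℝ) ≤ (p : ℝ) ^ n := hp'.trans (le_self_pow₀ (by linarith) (by omega))
  nlinarith

lemma abs_svC {p : ℕ} (hp : 2 ≤ p) (i : ℕ) :
    |svC p i| * (∏ l ∈ Finset.range i, (p : ℝ) ^ l)
     = ∏ s ∈ Finset.range i, ((p : ℝ) ^ s / ((p : ℝ) ^ (s + 1) - 1)) := by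
  rw [svC, abs_div, abs_pow, abs_neg, abs_one, one_pow, Finset.prod_div_distrib,
    abs_of_pos (Finset.prod_pos fun s _ => sv_den_pos hp s)]
  ring

/-- the limiting number of orbits -/
def orbT (p r : ℕ) (lam : ℕ → ℕ) (n : ℕ) : ℕ := ∏ j ∈ Finset.range n, (p ^ min (lam j) r) ^ j

lemma orbT_add (p r : ℕ) (hr : 1 ≤ r) (lam : ℕ → ℕ) (d : ℕ) (h : ∀ j, d ≤ j → lam j = 1) (i : ℕ) :
    orbT p r lam (d + i) = orbT p r lam d * p ^ (d * i) * ∏ l ∈ Finset.range i, p ^ l := by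
  rw [orbT, Finset.prod_range_add, mul_assoc]
  congr 1
  have : p ^ (d * i) = ∏ l ∈ Finset.range i, p ^ d := by simp [pow_mul]
  rw [this, ← Finset.prod_mul_distrib]
  refine Finset.prod_congr rfl fun l _ => ?_
  rw [h _ (by omega), min_eq_left hr, pow_one, pow_add]

lemma main_limit (p r : ℕ) (hp : 2 ≤ p) (hr : 1 ≤ r) (lam : ℕ → ℕ) (d : ℕ)
    (h : ∀ j, d ≤ j → lam j = 1) (O : ℕ → ℕ → ℕ)
    (hO : ∀ g n, O g n ≤ orbT p r lam n) (hO' : ∀ g n, n ≤ g → O g n = orbT p r lam n)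
    (hO0 : ∀ g n, 2 * g < n → O g n = 0) :
    ∃ L : ℝ, Filter.Tendsto (fun g : ℕ => ∑ i ∈ Finset.range (2 * g + 1),
      svC p i / (p : ℝ) ^ (d * i) * O g (d + i)) Filter.atTop (nhds L) := by
  have hp0 : (0 : ℝ) < p := by exact_mod_cast (by omega : 0 < p)
  refine ⟨∑' i, svC p i / (p : ℝ) ^ (d * i) * orbT p r lam (d + i), ?_⟩
  have key : (fun g : ℕ => ∑ i ∈ Finset.range (2 * g + 1),
      svC p i / (p : ℝ) ^ (d * i) * O g (d + i)) =
      fun g => ∑' i, svC p i / (p : ℝ) ^ (d * i) * O g (d + i) := by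
    funext g
    symm
    refine tsum_eq_sum fun i hi => ?_
    rw [hO0 g _ (by simp at hi; omega)]; simp
  rw [key]
  refine tendsto_tsum_of_dominated_convergence
    (bound := fun i => (orbT p r lam d : ℝ) *
      ∏ s ∈ Finset.range i, ((p : ℝ) ^ s / ((p : ℝ) ^ (s + 1) - 1)))
    ((sv_summable hp).mul_left _) ?_ ?_
  · intro i
    refine tendsto_const_nhds.congr' ?_
    filter_upwards [Filter.eventually_ge_atTop (d + i)] with g hg
    rw [hO' g _ hg]
  · refine Filter.Eventually.of_forall fun g i => ?_
    rw [norm_mul, norm_div, Real.norm_eq_abs, Real.norm_of_nonneg (by positivity),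
      Real.norm_of_nonneg (by positivity), ← abs_svC hp]
    have : (O g (d + i) : ℝ) ≤ orbT p r lam d * p ^ (d * i) * ∏ l ∈ Finset.range i, (p : ℝ) ^ l := by
      have := hO g (d + i)
      rw [orbT_add p r hr lam d h] at this
      exact_mod_cast this
    calc _ ≤ |svC p i| / (p : ℝ) ^ (d * i) * (orbT p r lam d * p ^ (d * i) *
            ∏ l ∈ Finset.range i, (p : ℝ) ^ l) := by gcongr
      _ = _ := by field_simp

/-- good tuples: `m j` has order `p ^ lam j`, and the tuple generates a direct sum. -/
def Good (p : ℕ) (lam : ℕ → ℕ) (n : ℕ) {K : Type*} [AddCommGroup K] (m : Fin n → K) : Prop :=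
  (∀ j : Fin n, (p ^ lam j) • m j = 0) ∧
    ∀ c : Fin n → ℤ, ∑ j, c j • (p ^ (lam j - 1)) • m j = 0 → ∀ j, (p : ℤ) ∣ c j

/-- number of good tuples -/
noncomputable def cnt (p : ℕ) (lam : ℕ → ℕ) (n : ℕ) (K : Type*) [AddCommGroup K] : ℕ :=
  Nat.card {m : Fin n → K // Good p lam n m}

/-- number of elements killed by `p` -/
noncomputable def tor (p : ℕ) (K : Type*) [AddCommGroup K] : ℕ :=
  Nat.card {x : K // p • x = 0}

section grp
variable {p : ℕ} {lam : ℕ → ℕ} {n : ℕ} {K K' : Type*} [AddCommGroup K] [AddCommGroup K']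

lemma Good.map {m : Fin n → K} (h : Good p lam n m) (f : K →+ K') (hf : Function.Injective f) :
    Good p lam n (fun j => f (m j)) := by
  refine ⟨fun j => by rw [← map_nsmul, h.1 j, map_zero], fun c hc => h.2 c (hf ?_)⟩
  rw [map_zero, ← hc, map_sum]
  simp [map_zsmul, map_nsmul]

lemma good_of_map {m : Fin n → K} (f : K →+ K') (hf : Function.Injective f)
    (h : Good p lam n (fun j => f (m j))) : Good p lam n m := by
  refine ⟨fun j => hf (by rw [map_nsmul, h.1 j, map_zero]), fun c hc => h.2 c ?_⟩
  have := congrArg f hc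
  rw [map_zero, map_sum] at this
  simpa [map_zsmul, map_nsmul] using this

lemma cnt_congr (e : K ≃+ K') : cnt p lam n K = cnt p lam n K' := by
  refine Nat.card_congr ⟨fun m => ⟨fun j => e (m.1 j), m.2.map e.toAddMonoidHom e.injective⟩,
    fun m => ⟨fun j => e.symm (m.1 j), m.2.map e.symm.toAddMonoidHom e.symm.injective⟩, ?_, ?_⟩
  · intro m; ext j; simp
  · intro m; ext j; simp

lemma tor_congr (e : K ≃+ K') : tor p K = tor p K' := by
  refine Nat.card_congr (e.toEquiv.subtypeEquiv fun x => ?_)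
  simp only [AddEquiv.toEquiv_eq_coe, AddEquiv.coe_toEquiv]
  rw [← map_nsmul, map_eq_zero_iff e e.injective]

/-- linear combination map -/
def lcmap (p : ℕ) (lam : ℕ → ℕ) {n : ℕ} (m : Fin n → K) (c : Fin n → ZMod p) : K :=
  ∑ j, (c j).val • (p ^ (lam j - 1)) • m j

lemma good_ptor (hlam : ∀ j, 1 ≤ lam j) {m : Fin n → K} (h : Good p lam n m) (j : Fin n) :
    p • (p ^ (lam j - 1)) • m j = 0 := by
  rw [smul_smul, ← pow_succ', Nat.sub_add_cancel (hlam j), h.1 j]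

lemma lcmap_inj [NeZero p] {m : Fin n → K} (h : Good p lam n m) :
    Function.Injective (lcmap p lam m) := by
  intro c c' hc
  have h1 : ∑ j, (((c j).val : ℤ) - ((c' j).val : ℤ)) • (p ^ (lam j - 1)) • m j = 0 := by
    simp only [sub_smul, Finset.sum_sub_distrib, natCast_zsmul]
    exact sub_eq_zero.2 hc
  funext j
  have h2 := h.2 _ h1 j
  have h3 : (((c j).val : ℤ) : ZMod p) = (((c' j).val : ℤ) : ZMod p) :=
    ((ZMod.intCast_eq_intCast_iff_dvd_sub _ _ _).2 (by rw [← dvd_neg]; simpa using h2))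
  simpa using h3

lemma lcmap_tor (hlam : ∀ j, 1 ≤ lam j) {m : Fin n → K} (h : Good p lam n m) (c : Fin n → ZMod p) :
    p • lcmap p lam m c = 0 := by
  rw [lcmap, Finset.smul_sum]
  refine Finset.sum_eq_zero fun j _ => ?_
  rw [smul_comm, good_ptor hlam h, smul_zero]

lemma pow_le_tor [Fact p.Prime] [Finite K] (hlam : ∀ j, 1 ≤ lam j) {m : Fin n → K}
    (h : Good p lam n m) : p ^ n ≤ tor p K := by
  have : Function.Injective
      (fun c : Fin n → ZMod p => (⟨lcmap p lam m c, lcmap_tor hlam h c⟩ : {x : K // p • x = 0})) :=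
    fun c c' hc => lcmap_inj h (Subtype.ext_iff.1 hc)
  simpa [tor] using Nat.card_le_card_of_injective _ this

lemma int_sum_mem_range [Fact p.Prime] (hlam : ∀ j, 1 ≤ lam j) {m : Fin n → K}
    (h : Good p lam n m) (c : Fin n → ℤ) :
    ∑ j, c j • (p ^ (lam j - 1)) • m j ∈ Set.range (lcmap p lam m) := by
  refine ⟨fun j => (c j : ZMod p), Finset.sum_congr rfl fun j _ => ?_⟩
  rw [← natCast_zsmul, ← sub_eq_zero, ← sub_smul]
  have : (p : ℤ) ∣ (((c j : ZMod p).val : ℤ) - c j) := by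
    rw [← ZMod.intCast_eq_intCast_iff_dvd_sub]; simp
  obtain ⟨t, ht⟩ := this
  rw [ht, mul_comm, mul_smul, natCast_zsmul, good_ptor hlam h, smul_zero]

lemma good_snoc_iff [Fact p.Prime] (hlam : ∀ j, 1 ≤ lam j) (hn : lam n = 1) (m : Fin n → K)
    (x : K) : Good p lam (n + 1) (Fin.snoc m x : Fin (n + 1) → K) ↔
      Good p lam n m ∧ (p • x = 0 ∧ x ∉ Set.range (lcmap p lam m)) := by
  have hp := (Fact.out : p.Prime)
  constructor
  · intro h
    have h1 : Good p lam n m := by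
      refine ⟨fun j => by simpa using h.1 j.castSucc, fun c hc j => ?_⟩
      have := h.2 (Fin.snoc c 0 : Fin (n + 1) → ℤ) (by simp [Fin.sum_univ_castSucc, hc]) j.castSucc
      simpa using this
    refine ⟨h1, by simpa [hn] using h.1 (Fin.last n), ?_⟩
    rintro ⟨c, hc⟩
    have := h.2 (Fin.snoc (fun j => ((c j).val : ℤ)) (-1) : Fin (n + 1) → ℤ) (by
      simp only [Fin.sum_univ_castSucc, Fin.snoc_castSucc, Fin.snoc_last, Fin.val_castSucc,
        Fin.val_last, hn, natCast_zsmul]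
      rw [← hc, lcmap]; simp) (Fin.last n)
    simp only [Fin.snoc_last] at this
    have h2 := Int.natAbs_dvd_natAbs.2 this
    simp at h2
    exact hp.one_lt.ne' h2
  · rintro ⟨h, hx, hxr⟩
    refine ⟨fun j => ?_, fun c hc => ?_⟩
    · refine Fin.lastCases ?_ (fun j => ?_) j
      · simpa [hn] using hx
      · simpa using h.1 j
    · simp only [Fin.sum_univ_castSucc, Fin.snoc_castSucc, Fin.snoc_last, Fin.val_castSucc,
        Fin.val_last, hn, Nat.sub_self, pow_zero, one_smul] at hc
      have hl : (p : ℤ) ∣ c (Fin.last n) := by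
        by_contra hcon
        have hcop : IsCoprime (p : ℤ) (c (Fin.last n)) :=
          ((Nat.prime_iff_prime_int.1 hp).coprime_iff_not_dvd).2 hcon
        obtain ⟨a, b, hab⟩ := hcop
        apply hxr
        have : x = ∑ j : Fin n, (-b * c j.castSucc) • (p ^ (lam j - 1)) • m j := by
          calc x = (a * p + b * c (Fin.last n)) • x := by rw [hab, one_smul]
            _ = b • (c (Fin.last n) • x) := by
              rw [add_smul, mul_smul, mul_smul, natCast_zsmul, hx, smul_zero, zero_add]
            _ = _ := by
              rw [eq_neg_of_add_eq_zero_right hc]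
              simp only [mul_smul, Finset.smul_sum, neg_smul, smul_neg, Finset.sum_neg_distrib]
        rw [this]
        exact int_sum_mem_range hlam h _
      have hz : c (Fin.last n) • x = 0 := by
        obtain ⟨t, ht⟩ := hl
        rw [ht, mul_comm, mul_smul, natCast_zsmul, hx, smul_zero]
      rw [hz, add_zero] at hc
      intro j
      refine Fin.lastCases hl (fun j => ?_) j
      exact h.2 (fun j => c j.castSucc) hc j

lemma cnt_succ [Fact p.Prime] [Finite K] (hlam : ∀ j, 1 ≤ lam j) (hn : lam n = 1) :
    (cnt p lam (n + 1) K : ℝ) = cnt p lam n K * ((tor p K : ℝ) - (p : ℝ) ^ n) := by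
  classical
  have := Fintype.ofFinite K
  let E : {m : Fin (n + 1) → K // Good p lam (n + 1) m} ≃
      Σ m : {m : Fin n → K // Good p lam n m},
        {x : K // p • x = 0 ∧ x ∉ Set.range (lcmap p lam m.1)} :=
    { toFun := fun m =>
        have h := (good_snoc_iff hlam hn (Fin.init m.1) (m.1 (Fin.last n))).1
          (by rw [Fin.snoc_init_self]; exact m.2)
        ⟨⟨Fin.init m.1, h.1⟩, ⟨m.1 (Fin.last n), h.2⟩⟩
      invFun := fun s => ⟨Fin.snoc s.1.1 s.2.1, (good_snoc_iff hlam hn _ _).2 ⟨s.1.2, s.2.2⟩⟩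
      left_inv := fun m => by ext1; simp
      right_inv := fun s => by
        rcases s with ⟨⟨m, hm⟩, ⟨x, hx⟩⟩
        refine Sigma.ext ?_ ?_
        · simp
        · simp only
          rw! [Fin.init_snoc]
          simp
         }
  have hfib : ∀ m : {m : Fin n → K // Good p lam n m},
      (Nat.card {x : K // p • x = 0 ∧ x ∉ Set.range (lcmap p lam m.1)} : ℝ)
        = (tor p K : ℝ) - (p : ℝ) ^ n := by
    intro m
    have h1 : Nat.card (Set.range (lcmap p lam m.1)) = p ^ n := by
      rw [Nat.card_congr (Equiv.ofInjective _ (lcmap_inj m.2)).symm]; simp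
    have h2 : ({x : K | p • x = 0 ∧ x ∉ Set.range (lcmap p lam m.1)})
        = {x : K | p • x = 0} \ Set.range (lcmap p lam m.1) := rfl
    have h3 : Set.range (lcmap p lam m.1) ⊆ {x : K | p • x = 0} := by
      rintro _ ⟨c, rfl⟩; exact lcmap_tor hlam m.2 c
    have h4 := Set.ncard_sdiff_add_ncard_of_subset h3 (Set.toFinite _)
    rw [← h2] at h4
    change Set.ncard (Set.range (lcmap p lam m.1)) = p ^ n at h1
    rw [h1] at h4
    change Set.ncard {x : K | p • x = 0 ∧ x ∉ Set.range (lcmap p lam m.1)} + p ^ n = tor p K at h4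
    change (Set.ncard {x : K | p • x = 0 ∧ x ∉ Set.range (lcmap p lam m.1)} : ℝ) = _
    rw [← h4]; push_cast; ring
  rw [cnt, Nat.card_congr E, Nat.card_sigma]
  push_cast
  rw [Finset.sum_congr rfl (fun m _ => hfib m), Finset.sum_const, cnt, Nat.card_eq_fintype_card,
    nsmul_eq_mul, Finset.card_univ]

lemma cnt_add [Fact p.Prime] [Finite K] (hlam : ∀ j, 1 ≤ lam j) {d : ℕ}
    (hd : ∀ j, d ≤ j → lam j = 1) (i : ℕ) :
    (cnt p lam (d + i) K : ℝ)
      = cnt p lam d K * ∏ l ∈ Finset.range i, ((tor p K : ℝ) - (p : ℝ) ^ (d + l)) := by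
  induction i with
  | zero => simp
  | succ i ih =>
    rw [← add_assoc, cnt_succ hlam (hd _ (by omega)), ih, Finset.prod_range_succ, mul_assoc]

lemma cnt_eq_zero [Fact p.Prime] [Finite K] (hlam : ∀ j, 1 ≤ lam j) (h : tor p K < p ^ n) :
    cnt p lam n K = 0 := by
  rw [cnt, Nat.card_eq_zero]
  left
  refine ⟨fun m => ?_⟩
  exact absurd (pow_le_tor hlam m.2) (by omega)

lemma sieve_K [Fact p.Prime] [Finite K] (hlam : ∀ j, 1 ≤ lam j) {d D M : ℕ}
    (hd : ∀ j, d ≤ j → lam j = 1) (hD : tor p K = p ^ D) (hM : D ≤ M) :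
    ∑ i ∈ Finset.range (M + 1), svC p i / (p : ℝ) ^ (d * i) * cnt p lam (d + i) K
      = if tor p K = p ^ d then (cnt p lam d K : ℝ) else 0 := by
  have hp := (Fact.out : p.Prime)
  have hp0 : (0 : ℝ) < p := by exact_mod_cast hp.pos
  rcases lt_or_ge D d with h | h
  · have h0 : cnt p lam d K = 0 :=
      cnt_eq_zero hlam (by rw [hD]; exact Nat.pow_lt_pow_right hp.one_lt h)
    simp [cnt_add hlam hd, h0]
  · have key := sv_eval hp.two_le (D - d) M (by omega)
    have : ∀ i, svC p i / (p : ℝ) ^ (d * i) * cnt p lam (d + i) K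
        = cnt p lam d K *
          (svC p i * ∏ l ∈ Finset.range i, ((p : ℝ) ^ (D - d) - (p : ℝ) ^ l)) := by
      intro i
      have h1 : ∏ l ∈ Finset.range i, ((tor p K : ℝ) - (p : ℝ) ^ (d + l))
          = (p : ℝ) ^ (d * i) * ∏ l ∈ Finset.range i, ((p : ℝ) ^ (D - d) - (p : ℝ) ^ l) := by
        have : (p : ℝ) ^ (d * i) = ∏ l ∈ Finset.range i, (p : ℝ) ^ d := by simp [pow_mul]
        rw [this, ← Finset.prod_mul_distrib]
        refine Finset.prod_congr rfl fun l _ => ?_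
        rw [hD, mul_sub, ← pow_add, ← pow_add, Nat.add_sub_cancel' h]; push_cast; rfl
      rw [cnt_add hlam hd, h1]
      field_simp
    simp_rw [this]
    rw [← Finset.mul_sum, key, hD]
    have : (D - d = 0) ↔ p ^ D = p ^ d := by
      rw [Nat.pow_right_inj hp.one_lt]; omega
    simp [this]

lemma exists_tor [hp : Fact p.Prime] [Finite K] : ∃ D, tor p K = p ^ D := by
  let S : AddSubgroup K := (nsmulAddMonoidHom p : K →+ K).ker
  have hS : ∀ x : S, p • x = 0 := fun x => Subtype.ext (by
    have := AddMonoidHom.mem_ker.1 x.2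
    simpa using this)
  let _ : Module (ZMod p) S := AddCommGroup.zmodModule hS
  let _ : Fintype S := Fintype.ofFinite S
  refine ⟨Module.finrank (ZMod p) S, ?_⟩
  have hcard : Nat.card S = tor p K := Nat.card_congr (Equiv.subtypeEquivRight fun x => by
    simp [S, AddMonoidHom.mem_ker])
  rw [← hcard, Nat.card_eq_fintype_card, Module.card_eq_pow_finrank (K := ZMod p) (V := S),
    ZMod.card]

end grp

section str
variable {p : ℕ} {lam : ℕ → ℕ} {n : ℕ} {K : Type*} [AddCommGroup K]

lemma exists_ptor_ne {k : ℕ} {x : K} (hx : x ≠ 0) (hk : (p ^ k) • x = 0) :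
    ∃ s, (p ^ s) • x ≠ 0 ∧ p • (p ^ s) • x = 0 := by
  induction k with
  | zero => simp at hk; exact absurd hk hx
  | succ k ih =>
    by_cases h : (p ^ k) • x = 0
    · exact ih h
    · exact ⟨k, h, by rw [smul_smul, ← pow_succ', hk]⟩

lemma good_std (hp : p.Prime) (hlam : ∀ j, 1 ≤ lam j) :
    Good p lam n (fun j => (Pi.single j 1 : (j : Fin n) → ZMod (p ^ lam j))) := by
  classical
  refine ⟨fun j => ?_, fun c hc j => ?_⟩
  · rw [← Pi.single_smul]
    simp
  · have h1 := congrFun hc j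
    simp only [Finset.sum_apply, Pi.smul_apply, Pi.zero_apply] at h1
    rw [Finset.sum_eq_single j (by
      intro b _ hb
      rw [Pi.single_eq_of_ne (Ne.symm hb)]; simp) (by simp)] at h1
    rw [Pi.single_eq_same] at h1
    have h2 : ((c j * (p ^ (lam j - 1) : ℕ) : ℤ) : ZMod (p ^ lam j)) = 0 := by
      rw [← h1]; simp
    rw [ZMod.intCast_zmod_eq_zero_iff_dvd] at h2
    have h3 : p ^ lam j = p * p ^ (lam j - 1) := by
      rw [← pow_succ', Nat.sub_add_cancel (hlam j)]
    rw [h3] at h2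
    push_cast at h2
    exact (mul_dvd_mul_iff_right (by
      have := hp.pos
      positivity)).1 h2

lemma exists_inj_of_good (hp : p.Prime) (hlam : ∀ j, 1 ≤ lam j) {m : Fin n → K}
    (h : Good p lam n m) :
    ∃ f : ((j : Fin n) → ZMod (p ^ lam j)) →+ K, Function.Injective f := by
  classical
  let φ : (j : Fin n) → ZMod (p ^ lam j) →+ K := fun j =>
    ZMod.lift (p ^ lam j) ⟨zmultiplesHom K (m j), by
      rw [zmultiplesHom_apply, natCast_zsmul]; exact h.1 j⟩
  have hφ : ∀ j (a : ℤ), φ j (a : ZMod (p ^ lam j)) = a • m j := by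
    intro j a; simp [φ]
  let f : ((j : Fin n) → ZMod (p ^ lam j)) →+ K :=
    ∑ j, (φ j).comp (Pi.evalAddMonoidHom _ j)
  have hf : ∀ x, f x = ∑ j, φ j (x j) := by intro x; simp [f]
  have hNZ : ∀ j : Fin n, NeZero (p ^ lam j) := fun j => ⟨pow_ne_zero _ hp.ne_zero⟩
  refine ⟨f, (injective_iff_map_eq_zero f).2 fun x hx => ?_⟩
  by_contra hx0
  have hk : (p ^ (∑ j : Fin n, lam j)) • x = 0 := by
    funext j
    rw [Pi.smul_apply, Pi.zero_apply, nsmul_eq_mul]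
    have : p ^ lam j ∣ p ^ (∑ j : Fin n, lam j) :=
      pow_dvd_pow _ (Finset.single_le_sum (f := fun j : Fin n => lam j)
        (fun _ _ => Nat.zero_le _) (Finset.mem_univ j))
    rw [(ZMod.natCast_eq_zero_iff _ _).2 this, zero_mul]
  obtain ⟨s, hs, hs'⟩ := exists_ptor_ne hx0 hk
  set y := (p ^ s) • x with hy
  have hfy : f y = 0 := by rw [hy, map_nsmul, hx, smul_zero]
  have hc : ∀ j, ∃ c : ℤ, y j = ((c * (p ^ (lam j - 1) : ℕ) : ℤ) : ZMod (p ^ lam j)) := by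
    intro j
    have h1 : ((p * (y j).val : ℕ) : ZMod (p ^ lam j)) = 0 := by
      have := congrFun hs' j
      simpa using this
    rw [ZMod.natCast_eq_zero_iff] at h1
    have h3 : p ^ lam j = p * p ^ (lam j - 1) := by
      rw [← pow_succ', Nat.sub_add_cancel (hlam j)]
    have h1' : p * p ^ (lam j - 1) ∣ p * (y j).val := by
      obtain ⟨t, ht⟩ := h1
      exact ⟨t, by rw [ht, ← h3]⟩
    obtain ⟨t, ht⟩ := (Nat.mul_dvd_mul_iff_left hp.pos).1 h1'
    refine ⟨t, ?_⟩
    rw [← ZMod.natCast_zmod_val (y j), ht]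
    push_cast; ring
  choose c hc using hc
  have h4 : ∑ j, c j • (p ^ (lam j - 1)) • m j = 0 := by
    rw [← hfy, hf]
    refine Finset.sum_congr rfl fun j _ => ?_
    rw [hc, hφ, mul_smul, natCast_zsmul]
  have h5 := h.2 c h4
  apply hs
  funext j
  rw [hc, Pi.zero_apply, ZMod.intCast_zmod_eq_zero_iff_dvd]
  have h3 : p ^ lam j = p * p ^ (lam j - 1) := by
    rw [← pow_succ', Nat.sub_add_cancel (hlam j)]
  rw [h3]; push_cast
  exact mul_dvd_mul_right (h5 j) _

lemma tor_zmod (hp : p.Prime) {e : ℕ} (he : 1 ≤ e) : tor p (ZMod (p ^ e)) = p := by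
  have : NeZero (p ^ e) := ⟨pow_ne_zero _ hp.ne_zero⟩
  have : NeZero p := ⟨hp.ne_zero⟩
  have h3 : p ^ e = p * p ^ (e - 1) := by rw [← pow_succ', Nat.sub_add_cancel he]
  have hpos : 0 < p ^ (e - 1) := pow_pos hp.pos _
  have hlt : ∀ a : Fin p, a.1 * p ^ (e - 1) < p ^ e := fun a => by
    rw [h3]; exact (Nat.mul_lt_mul_right hpos).2 a.2
  have : Nat.card (Fin p) = tor p (ZMod (p ^ e)) := by
    refine Nat.card_eq_of_bijective
      (fun a => ⟨((a.1 * p ^ (e - 1) : ℕ) : ZMod (p ^ e)), ?_⟩) ⟨?_, ?_⟩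
    · rw [nsmul_eq_mul, ← Nat.cast_mul, ZMod.natCast_eq_zero_iff]
      exact ⟨a.1, by rw [h3]; ring⟩
    · intro a b hab
      have := congrArg ZMod.val (Subtype.ext_iff.1 hab)
      simp only [ZMod.val_cast_of_lt (hlt _)] at this
      exact Fin.ext (Nat.eq_of_mul_eq_mul_right hpos this)
    · rintro ⟨x, hx⟩
      have h1 : ((p * x.val : ℕ) : ZMod (p ^ e)) = 0 := by simpa using hx
      rw [ZMod.natCast_eq_zero_iff] at h1
      have h1' : p * p ^ (e - 1) ∣ p * x.val := by
        obtain ⟨t, ht⟩ := h1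
        exact ⟨t, by rw [ht, ← h3]⟩
      obtain ⟨t, ht⟩ := (Nat.mul_dvd_mul_iff_left hp.pos).1 h1'
      have hlt' : t < p := by
        have := x.val_lt
        rw [ht] at this
        have h5 : p ^ (e - 1) * t < p ^ (e - 1) * p := by
          calc _ < p ^ e := this
            _ = _ := by rw [h3, mul_comm]
        exact (Nat.mul_lt_mul_left hpos).1 h5
      refine ⟨⟨t, hlt'⟩, Subtype.ext ?_⟩
      simp only
      rw [mul_comm, ← ht, ZMod.natCast_zmod_val]
  rw [← this, Nat.card_fin]

lemma tor_pi {ι : Type*} [Fintype ι] (K : ι → Type*) [∀ i, AddCommGroup (K i)] :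
    tor p ((i : ι) → K i) = ∏ i, tor p (K i) := by
  unfold tor
  rw [← Nat.card_pi]
  refine Nat.card_congr ((Equiv.subtypeEquivRight fun x => ?_).trans
    (Equiv.subtypePiEquivPi (p := fun i x => p • x = 0)))
  exact ⟨fun h i => congrFun h i, fun h => funext h⟩

/-- rank `d` group -/
abbrev Hgp (p : ℕ) {d k : ℕ} (e : Fin d → Fin k) : Type := (j : Fin d) → ZMod (p ^ ((e j : ℕ) + 1))

lemma tor_Hgp (hp : p.Prime) {d k : ℕ} (e : Fin d → Fin k) : tor p (Hgp p e) = p ^ d := by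
  rw [tor_pi]
  simp [tor_zmod hp]

lemma structure_K [Finite K] (hp : p.Prime) (k : ℕ) (hk : ∀ x : K, (p ^ k) • x = 0) :
    ∃ d, ∃ e : Fin d → Fin k, Nonempty (K ≃+ Hgp p e) := by
  classical
  obtain ⟨ι, hι, n, hn, ⟨f⟩⟩ := AddCommGroup.equiv_directSum_zmod_of_finite' K
  let f' : K ≃+ ((i : ι) → ZMod (n i)) := f.trans (DirectSum.addEquivProd _)
  have h1 : ∀ i, ∃ e : Fin k, n i = p ^ ((e : ℕ) + 1) := by
    intro i
    have h2 : (p ^ k) • f'.symm (Pi.single i 1) = 0 := hk _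
    rw [← map_nsmul, map_eq_zero_iff _ f'.symm.injective] at h2
    have h3 := congrFun h2 i
    simp only [Pi.smul_apply, Pi.single_eq_same, Pi.zero_apply, nsmul_eq_mul, mul_one] at h3
    rw [ZMod.natCast_eq_zero_iff, Nat.dvd_prime_pow hp] at h3
    obtain ⟨e, he, hne⟩ := h3
    have : e ≠ 0 := by rintro rfl; have := hn i; simp at hne; omega
    exact ⟨⟨e - 1, by omega⟩, by simp only; rw [hne, Nat.sub_add_cancel (by omega)]⟩
  choose e he using h1
  obtain rfl : n = fun i => p ^ ((e i : ℕ) + 1) := funext he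
  let σ : Fin (Fintype.card ι) ≃ ι := (Fintype.equivFin ι).symm
  refine ⟨_, fun j => e (σ j), ⟨f'.trans ?_⟩⟩
  exact
    { (Equiv.piCongrLeft (fun i => ZMod (p ^ ((e i : ℕ) + 1))) σ).symm with
      map_add' := fun x y => rfl }

lemma sorted_Hgp {d k : ℕ} (hk : 1 ≤ k) (e : Fin d → Fin k) :
    ∃ lam : ℕ → ℕ, Antitone lam ∧ (∀ j, 1 ≤ lam j) ∧ (∀ j, lam j ≤ k) ∧ (∀ j, d ≤ j → lam j = 1) ∧
      Nonempty (Hgp p e ≃+ ((j : Fin d) → ZMod (p ^ lam j))) := by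
  classical
  let σ : Fin d ≃ Fin d := Fin.revPerm.trans (Tuple.sort e)
  have hσ : Antitone (e ∘ σ) := by
    intro i j hij
    exact Tuple.monotone_sort e (Fin.rev_le_rev.2 hij)
  let lam : ℕ → ℕ := fun j => if h : j < d then (e (σ ⟨j, h⟩) : ℕ) + 1 else 1
  have hl : ∀ j : Fin d, lam j = (e (σ j) : ℕ) + 1 := fun j => by simp [lam]
  refine ⟨lam, ?_, ?_, ?_, ?_, ⟨?_⟩⟩
  · intro i j hij
    by_cases hj : j < d
    · have hi : i < d := by omega
      simp only [lam, hi, hj, dif_pos]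
      have := hσ (show (⟨i, hi⟩ : Fin d) ≤ ⟨j, hj⟩ from hij)
      simp only [Function.comp, Fin.le_def] at this
      omega
    · simp only [lam]
      rw [dif_neg hj]
      split_ifs <;> simp
  · intro j; simp only [lam]; split_ifs <;> simp
  · intro j; simp only [lam]; split_ifs with h
    · exact (e (σ ⟨j, h⟩)).2
    · exact hk
  · intro j hj; simp [lam, hj]
  · have : (fun j : Fin d => lam j) = fun j => (e (σ j) : ℕ) + 1 := funext hl
    change Hgp p e ≃+ ((j : Fin d) → ZMod (p ^ ((fun j : Fin d => lam j) j)))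
    rw [this]
    exact
    { (Equiv.piCongrLeft (fun i => ZMod (p ^ ((e i : ℕ) + 1))) σ).symm with
      map_add' := fun x y => rfl }

end str

section witt
variable {R V : Type*} [CommRing R] [AddCommGroup V] [Module R V]

/-- transvection lemma -/
lemma transv (ω : V →ₗ[R] V →ₗ[R] R) (hω : ∀ x, ω x x = 0) (z w : V) (c : R)
    (hc : c * ω z w = 1) :
    ∃ B : V ≃ₗ[R] V, (∀ x y, ω (B x) (B y) = ω x y) ∧ B z = z + w ∧
      ∀ y, ω y w = 0 → B y = y := by
  have hsk : ∀ x y, ω x y = - ω y x := fun x y => by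
    have := hω (x + y)
    simp only [map_add, LinearMap.add_apply, hω] at this
    linear_combination this
  let f : V →ₗ[R] R := c • ω.flip w
  have hf : ∀ x, f x = c * ω x w := fun x => by simp [f]
  let B : V ≃ₗ[R] V := LinearEquiv.ofLinearMap (LinearMap.id + f.smulRight w)
    (LinearMap.id - f.smulRight w)
    (by ext x; simp [hf, hω]) (by ext x; simp [hf, hω])
  have hB : ∀ x, B x = x + (c * ω x w) • w := fun x => by simp [B, hf]
  refine ⟨B, fun x y => ?_, by rw [hB, hc, one_smul], fun y hy => by rw [hB, hy]; simp⟩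
  rw [hB, hB]
  simp only [map_add, LinearMap.add_apply, map_smul, LinearMap.smul_apply, hω, smul_eq_mul]
  rw [hsk w y]
  ring

lemma witt_step [IsLocalRing R] (ω : V →ₗ[R] V →ₗ[R] R) (hω : ∀ x, ω x x = 0) {n : ℕ}
    (w : Fin n → V) (z z' : V) (hz : ∃ u, (∀ j, ω (w j) u = 0) ∧ ω z u = 1)
    (hz' : ∃ u, (∀ j, ω (w j) u = 0) ∧ ω z' u = 1) (hzz : ∀ j, ω (w j) z = ω (w j) z') :
    ∃ B : V ≃ₗ[R] V, (∀ x y, ω (B x) (B y) = ω x y) ∧ B z = z' ∧ ∀ j, B (w j) = w j := by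
  have hsk : ∀ x y, ω x y = - ω y x := fun x y => by
    have := hω (x + y)
    simp only [map_add, LinearMap.add_apply, hω] at this
    linear_combination this
  -- the easy case
  have easy : ∀ z z' : V, (∀ j, ω (w j) z = ω (w j) z') → IsUnit (ω z z') →
      ∃ B : V ≃ₗ[R] V, (∀ x y, ω (B x) (B y) = ω x y) ∧ B z = z' ∧ ∀ j, B (w j) = w j := by
    intro z z' h hu
    obtain ⟨c, hc⟩ := hu.exists_left_inv
    obtain ⟨B, h1, h2, h3⟩ := transv ω hω z (z' - z) c (by rw [map_sub, hω, sub_zero, hc])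
    exact ⟨B, h1, by rw [h2]; abel, fun j => h3 _ (by rw [map_sub, h, sub_self])⟩
  by_cases hu : IsUnit (ω z z')
  · exact easy z z' hzz hu
  obtain ⟨u₁, h11, h12⟩ := hz
  obtain ⟨u₂, h21, h22⟩ := hz'
  have unit_add : ∀ a b : R, IsUnit a → ¬ IsUnit b → IsUnit (a + b) := by
    intro a b ha hb
    by_contra hab
    have : a = (a + b) + (-b) := by ring
    rw [this] at ha
    exact (IsLocalRing.nonunits_add (a := a + b) (b := -b) hab
      (by simpa [mem_nonunits_iff] using hb)) ha
  obtain ⟨u, hu0, hu1, hu2⟩ : ∃ u, (∀ j, ω (w j) u = 0) ∧ IsUnit (ω z u) ∧ IsUnit (ω z' u) := by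
    by_cases ha : IsUnit (ω z' u₁)
    · exact ⟨u₁, h11, by rw [h12]; exact isUnit_one, ha⟩
    by_cases hb : IsUnit (ω z u₂)
    · exact ⟨u₂, h21, hb, by rw [h22]; exact isUnit_one⟩
    refine ⟨u₁ + u₂, fun j => by rw [map_add, h11, h21, add_zero], ?_, ?_⟩
    · rw [map_add, h12]; exact unit_add _ _ isUnit_one hb
    · rw [map_add, h22, add_comm]; exact unit_add _ _ isUnit_one ha
  obtain ⟨B₁, b1, b2, b3⟩ := easy z (z + u) (fun j => by rw [map_add, hu0, add_zero])
    (by rw [map_add, hω, zero_add]; exact hu1)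
  obtain ⟨B₂, c1, c2, c3⟩ := easy (z + u) z' (fun j => by rw [map_add, hu0, add_zero, hzz]) (by
    rw [hsk, map_add, add_comm, IsUnit.neg_iff]
    refine unit_add _ _ hu2 ?_
    rw [hsk, IsUnit.neg_iff]; exact hu)
  exact ⟨B₁.trans B₂, fun x y => by simp [b1, c1], by simp [b2, c2], fun j => by simp [b3, c3]⟩

/-- independence modulo `ϖ` -/
def Ind (ϖ : R) {n : ℕ} (v : Fin n → V) : Prop :=
  ∀ c : Fin n → R, (∃ y, ∑ j, c j • v j = ϖ • y) → ∀ j, ϖ ∣ c j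

lemma Ind.congr {ϖ : R} {n : ℕ} {v v' : Fin n → V} (h : Ind ϖ v)
    (hv : ∀ j, ∃ y, v' j = v j + ϖ • y) : Ind ϖ v' := by
  choose y hy using hv
  rintro c ⟨t, ht⟩
  refine h c ⟨t - ∑ j, c j • y j, ?_⟩
  rw [smul_sub, ← ht, Finset.smul_sum, ← Finset.sum_sub_distrib]
  refine Finset.sum_congr rfl fun j _ => ?_
  rw [hy, smul_add, smul_comm ϖ]; abel

lemma Ind.equiv {ϖ : R} {n : ℕ} {v : Fin n → V} (h : Ind ϖ v) (A : V ≃ₗ[R] V) :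
    Ind ϖ (fun j => A (v j)) := by
  rintro c ⟨t, ht⟩
  refine h c ⟨A.symm t, ?_⟩
  rw [← map_smul, ← ht, map_sum]
  simp

lemma Ind.init {ϖ : R} {n : ℕ} {v : Fin (n + 1) → V} (h : Ind ϖ v) :
    Ind ϖ (fun j : Fin n => v j.castSucc) := by
  rintro c ⟨t, ht⟩ j
  have := h (Fin.snoc c 0 : Fin (n + 1) → R) ⟨t, by simpa [Fin.sum_univ_castSucc] using ht⟩
    j.castSucc
  simpa using this

/-- the group preserving `ω` modulo `ϖ ^ r` -/
def Gam (ω : V →ₗ[R] V →ₗ[R] R) (q : R) : Subgroup (V ≃ₗ[R] V) where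
  carrier := {A | ∀ x y, q ∣ ω (A x) (A y) - ω x y}
  one_mem' := fun x y => by simp
  mul_mem' := fun {A B} hA hB x y => by
    have := dvd_add (hA (B x) (B y)) (hB x y)
    simpa using this
  inv_mem' := fun {A} hA x y => by
    have := hA (A⁻¹ x) (A⁻¹ y)
    rw [← dvd_neg]
    have e : ∀ x, A (A⁻¹ x) = x := fun x => A.apply_symm_apply x
    rw [e, e] at this
    simpa using this

lemma mem_Gam {ω : V →ₗ[R] V →ₗ[R] R} {q : R} {A : V ≃ₗ[R] V} :
    A ∈ Gam ω q ↔ ∀ x y, q ∣ ω (A x) (A y) - ω x y := Iff.rfl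

theorem witt_main [IsLocalRing R] (ω : V →ₗ[R] V →ₗ[R] R) (hω : ∀ x, ω x x = 0) (ϖ : R)
    (hϖ : IsNilpotent ϖ)
    (hdual : ∀ (n : ℕ) (v : Fin n → V), Ind ϖ v →
      ∃ u : Fin n → V, ∀ i j, ω (v j) (u i) = if i = j then 1 else 0)
    (r : ℕ) (hr : 1 ≤ r) (lam : ℕ → ℕ) (hanti : Antitone lam) (hlam : ∀ j, 1 ≤ lam j) :
    ∀ (n : ℕ) (v v' : Fin n → V), Ind ϖ v → Ind ϖ v' →
      (∀ i j : Fin n, i < j → ϖ ^ min (lam j) r ∣ ω (v i) (v j) - ω (v' i) (v' j)) →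
      ∃ A ∈ Gam ω (ϖ ^ r), ∀ j : Fin n, ∃ y, A (v j) = v' j + ϖ ^ lam j • y := by
  intro n
  induction n with
  | zero => intro v v' _ _ _; exact ⟨1, one_mem _, fun j => j.elim0⟩
  | succ n ih =>
    intro v v' hv hv' hg
    obtain ⟨A, hA, hAv⟩ := ih (fun j => v j.castSucc) (fun j => v' j.castSucc) hv.init hv'.init
      (fun i j hij => hg i.castSucc j.castSucc (by simpa using hij))
    choose y0 hy0 using hAv
    set w : Fin n → V := fun j => A (v j.castSucc) with hw
    set z := A (v (Fin.last n)) with hz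
    set z' := v' (Fin.last n) with hz'
    set m := min (lam n) r with hm
    have hm1 : 1 ≤ m := le_min (hlam n) hr
    have hs : ∀ j, ∃ s, ω (w j) z - ω (w j) z' = ϖ ^ m * s := by
      intro j
      have h1 : ϖ ^ m ∣ ω (w j) z - ω (v j.castSucc) (v (Fin.last n)) :=
        (pow_dvd_pow _ (min_le_right _ _)).trans (hA _ _)
      have h2 : ϖ ^ m ∣ ω (v j.castSucc) (v (Fin.last n)) - ω (v' j.castSucc) z' := by
        have := hg j.castSucc (Fin.last n) (Fin.castSucc_lt_last j)
        simpa using this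
      have h3 : ϖ ^ m ∣ ω (v' j.castSucc) z' - ω (w j) z' := by
        have e : w j = _ := hy0 j
        rw [e, map_add, LinearMap.add_apply, map_smul, LinearMap.smul_apply, smul_eq_mul]
        have : ϖ ^ m ∣ ϖ ^ lam j :=
          pow_dvd_pow _ ((min_le_left _ _).trans (hanti (by exact_mod_cast j.2.le)))
        rw [show ∀ a b : R, a - (a + b) = -b by intros; ring, dvd_neg]
        exact this.mul_right _
      have := (h1.add h2).add h3
      rwa [sub_add_sub_cancel, sub_add_sub_cancel] at this
    choose s hs using hs
    have pdvd : ∀ e, 1 ≤ e → ∀ y : V, ϖ ^ e • y = ϖ • (ϖ ^ (e - 1) • y) := fun e he y => by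
      rw [smul_smul, ← pow_succ', Nat.sub_add_cancel he]
    have hI : Ind ϖ (Fin.snoc w z' : Fin (n + 1) → V) := by
      refine hv'.congr fun j => ?_
      refine Fin.lastCases ⟨0, by simp [hz']⟩ (fun j => ?_) j
      refine ⟨ϖ ^ (lam j - 1) • y0 j, ?_⟩
      rw [← pdvd _ (hlam j)]
      simpa using hy0 j
    obtain ⟨u, hu⟩ := hdual _ _ hI
    set y := ∑ i : Fin n, s i • u i.castSucc with hy
    set z3 := z' + ϖ ^ m • y with hz3
    have hwy : ∀ j, ω (w j) y = s j := by
      intro j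
      have : ∀ i : Fin n, ω (w j) (u i.castSucc) = if i = j then 1 else 0 := fun i => by
        have := hu i.castSucc j.castSucc
        simpa using this
      simp [hy, this]
    have hI3 : Ind ϖ (Fin.snoc w z3 : Fin (n + 1) → V) := by
      refine hI.congr fun j => ?_
      refine Fin.lastCases ⟨ϖ ^ (m - 1) • y, ?_⟩ (fun j => ⟨0, by simp⟩) j
      rw [← pdvd _ hm1]; simp [hz3]
    have hIz : Ind ϖ (Fin.snoc w z : Fin (n + 1) → V) := by
      have e : (Fin.snoc w z : Fin (n + 1) → V) = fun j => A (v j) := by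
        funext j
        refine Fin.lastCases (by simp [hz]) (fun j => by simp [hw]) j
      rw [e]; exact hv.equiv A
    have hD : ∀ x, Ind ϖ (Fin.snoc w x : Fin (n + 1) → V) →
        ∃ u, (∀ j, ω (w j) u = 0) ∧ ω x u = 1 := by
      intro x hx
      obtain ⟨u, hu⟩ := hdual _ _ hx
      refine ⟨u (Fin.last n), fun j => ?_, ?_⟩
      · have := hu (Fin.last n) j.castSucc
        simpa [(Fin.castSucc_lt_last j).ne'] using this
      · have := hu (Fin.last n) (Fin.last n)
        simpa using this
    obtain ⟨B, hB1, hB2, hB3⟩ := witt_step ω hω w z z3 (hD _ hIz) (hD _ hI3) (fun j => by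
      rw [hz3, map_add, map_smul, hwy, smul_eq_mul, ← hs]; ring)
    have hBG : B ∈ Gam ω (ϖ ^ r) := fun x y => by rw [hB1, sub_self]; exact dvd_zero _
    -- final correction
    obtain ⟨C, hC, hCw, t, hCz⟩ : ∃ C ∈ Gam ω (ϖ ^ r), (∀ j, C (w j) = w j) ∧
        ∃ t, C z3 = z' + ϖ ^ lam n • t := by
      rcases le_total (lam n) r with hle | hle
      · exact ⟨1, one_mem _, fun j => rfl, y, by rw [hz3, hm, min_eq_left hle]; rfl⟩
      · obtain ⟨u', hu1, hu2⟩ := hD _ hI3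
        have hmr : m = r := min_eq_right hle
        let N : Module.End R V := (ω.flip u').smulRight y
        have hN : ∀ x, N x = ω x u' • y := fun x => by simp [N]
        have hnil : IsNilpotent (ϖ ^ r • N) := by
          obtain ⟨a, ha⟩ := hϖ
          refine ⟨a, ?_⟩
          rw [smul_pow, ← pow_mul, mul_comm, pow_mul, ha, zero_pow (by omega), zero_smul]
        have hbij := (Module.End.isUnit_iff _).1 hnil.isUnit_one_sub
        let C : V ≃ₗ[R] V := LinearEquiv.ofBijective _ hbij
        have hC : ∀ x, C x = x - ϖ ^ r • ω x u' • y := fun x => by simp [C, hN]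
        refine ⟨C, fun a b => ?_, fun j => by rw [hC, hu1]; simp, 0, ?_⟩
        · rw [hC, hC]
          simp only [map_sub, LinearMap.sub_apply, map_smul, LinearMap.smul_apply, smul_eq_mul]
          refine ⟨-(ω b u' * ω a y) - ω a u' * (ω y b - ϖ ^ r * (ω b u' * ω y y)), ?_⟩
          ring
        · rw [hC, hu2, hz3, hmr]; simp
    refine ⟨C * (B * A), mul_mem hC (mul_mem hBG hA), fun j => ?_⟩
    refine Fin.lastCases ?_ (fun j => ?_) j
    · refine ⟨t, ?_⟩
      change C (B z) = _
      rw [hB2, hCz]; simp [hz']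
    · refine ⟨y0 j, ?_⟩
      change C (B (w j)) = _
      rw [hB3, hCw]
      simpa using hy0 j

end witt

section zm
variable {p k : ℕ}

lemma zm_local (hp : p.Prime) (hk : 1 ≤ k) : IsLocalRing (ZMod (p ^ k)) := by
  have : Fact p.Prime := ⟨hp⟩
  have : Fact (1 < p ^ k) := ⟨Nat.one_lt_pow (by omega) hp.one_lt⟩
  exact IsLocalRing.of_surjective' (PadicInt.toZModPow k : ℤ_[p] →+* _)
    (ZMod.ringHom_surjective _)

lemma zm_cast_zero (hp : p.Prime) {a : ℕ} (ha : a ≤ k) (x : ZMod (p ^ k)) :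
    ZMod.castHom (pow_dvd_pow p ha) (ZMod (p ^ a)) x = 0 ↔ (p : ZMod (p ^ k)) ^ a ∣ x := by
  have : NeZero (p ^ k) := ⟨pow_ne_zero _ hp.ne_zero⟩
  constructor
  · intro h
    rw [← ZMod.natCast_zmod_val x, map_natCast, ZMod.natCast_eq_zero_iff] at h
    obtain ⟨t, ht⟩ := h
    exact ⟨t, by rw [← ZMod.natCast_zmod_val x, ht]; push_cast; rfl⟩
  · rintro ⟨t, rfl⟩
    rw [map_mul, map_pow, map_natCast, ← Nat.cast_pow, ZMod.natCast_self, zero_mul]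

lemma zm_cast_eq (hp : p.Prime) {a : ℕ} (ha : a ≤ k) (x y : ZMod (p ^ k)) :
    ZMod.castHom (pow_dvd_pow p ha) (ZMod (p ^ a)) x = ZMod.castHom (pow_dvd_pow p ha) _ y ↔
      (p : ZMod (p ^ k)) ^ a ∣ x - y := by
  rw [← zm_cast_zero hp ha, map_sub, sub_eq_zero]

lemma zm_mul_zero (hp : p.Prime) {a : ℕ} (ha : a ≤ k) (x : ZMod (p ^ k)) :
    (p : ZMod (p ^ k)) ^ a * x = 0 ↔ (p : ZMod (p ^ k)) ^ (k - a) ∣ x := by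
  have : NeZero (p ^ k) := ⟨pow_ne_zero _ hp.ne_zero⟩
  constructor
  · intro h
    have h1 : ((p ^ a * x.val : ℕ) : ZMod (p ^ k)) = 0 := by
      push_cast; rw [ZMod.natCast_zmod_val]; exact h
    rw [ZMod.natCast_eq_zero_iff] at h1
    have h1' : p ^ a * p ^ (k - a) ∣ p ^ a * x.val := by
      rw [← pow_add, Nat.add_sub_cancel' ha]; exact h1
    obtain ⟨t, ht⟩ := (Nat.mul_dvd_mul_iff_left (pow_pos hp.pos a)).1 h1'
    exact ⟨t, by rw [← ZMod.natCast_zmod_val x, ht]; push_cast; rfl⟩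
  · rintro ⟨t, rfl⟩
    rw [← mul_assoc, ← pow_add, Nat.add_sub_cancel' ha, ← Nat.cast_pow, ZMod.natCast_self,
      zero_mul]

lemma zv_mul_zero (hp : p.Prime) {ι : Type*} {a : ℕ} (ha : a ≤ k) (x : ι → ZMod (p ^ k)) :
    (p : ZMod (p ^ k)) ^ a • x = 0 ↔ ∃ y, x = (p : ZMod (p ^ k)) ^ (k - a) • y := by
  constructor
  · intro h
    have : ∀ i, ∃ t, x i = (p : ZMod (p ^ k)) ^ (k - a) * t := fun i =>
      (zm_mul_zero hp ha (x i)).1 (congrFun h i)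
    choose y hy using this
    exact ⟨y, funext hy⟩
  · rintro ⟨y, rfl⟩
    funext i
    exact (zm_mul_zero hp ha _).2 ⟨y i, rfl⟩

lemma zm_unit (hp : p.Prime) (hk : 1 ≤ k) (x : ZMod (p ^ k))
    (hx : ZMod.castHom (dvd_pow_self p (by omega : k ≠ 0)) (ZMod p) x ≠ 0) : IsUnit x := by
  have : NeZero (p ^ k) := ⟨pow_ne_zero _ hp.ne_zero⟩
  rw [← ZMod.natCast_zmod_val x] at hx ⊢
  rw [map_natCast, Ne, ZMod.natCast_eq_zero_iff] at hx
  rw [ZMod.isUnit_iff_coprime]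
  exact Nat.Coprime.pow_right _ ((Nat.Prime.coprime_iff_not_dvd hp).2 hx).symm

lemma zm_cast_p (hp : p.Prime) (hk : 1 ≤ k) (x : ZMod (p ^ k)) :
    ZMod.castHom (dvd_pow_self p (by omega : k ≠ 0)) (ZMod p) x = 0 ↔ (p : ZMod (p ^ k)) ∣ x := by
  have : NeZero (p ^ k) := ⟨pow_ne_zero _ hp.ne_zero⟩
  constructor
  · intro h
    rw [← ZMod.natCast_zmod_val x, map_natCast, ZMod.natCast_eq_zero_iff] at h
    obtain ⟨t, ht⟩ := h
    exact ⟨t, by rw [← ZMod.natCast_zmod_val x, ht]; push_cast; rfl⟩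
  · rintro ⟨t, rfl⟩
    rw [map_mul, map_natCast, ZMod.natCast_self, zero_mul]

lemma zm_int_dvd (hp : p.Prime) (hk : 1 ≤ k) (c : ℤ) :
    (p : ZMod (p ^ k)) ∣ (c : ZMod (p ^ k)) ↔ (p : ℤ) ∣ c := by
  rw [← zm_cast_p hp hk, map_intCast, ZMod.intCast_zmod_eq_zero_iff_dvd]

lemma exists_dot_dual (hp : p.Prime) (hk : 1 ≤ k) {ι : Type*} [Fintype ι] {n : ℕ}
    (v : Fin n → ι → ZMod (p ^ k)) (hv : Ind (p : ZMod (p ^ k)) v) :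
    ∃ b : Fin n → ι → ZMod (p ^ k), ∀ i j, v j ⬝ᵥ b i = if i = j then 1 else 0 := by
  classical
  have : Fact p.Prime := ⟨hp⟩
  let π := ZMod.castHom (dvd_pow_self p (by omega : k ≠ 0)) (ZMod p)
  have hπ : Function.Surjective π := ZMod.ringHom_surjective _
  let M : Matrix (Fin n) ι (ZMod (p ^ k)) := Matrix.of v
  let M' : Matrix (Fin n) ι (ZMod p) := M.map π
  have hinj : Function.Injective M'.vecMulLinear := by
    rw [← LinearMap.ker_eq_bot, LinearMap.ker_eq_bot']
    intro c' hc'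
    choose c hc using fun j => hπ (c' j)
    have h1 : ∀ l, (p : ZMod (p ^ k)) ∣ (∑ j, c j • v j) l := by
      intro l
      rw [← zm_cast_p hp hk]
      have := congrFun hc' l
      simp only [Matrix.vecMulLinear_apply, Matrix.vecMul, dotProduct, Pi.zero_apply] at this
      rw [← this, Finset.sum_apply, map_sum]
      refine Finset.sum_congr rfl fun j _ => ?_
      rw [← hc]; exact map_mul π _ _
    choose y hy using h1
    have h2 := hv c ⟨y, funext hy⟩
    funext j
    rw [← hc]
    exact (zm_cast_p hp hk _).2 (h2 j)
  obtain ⟨g, hg⟩ := LinearMap.exists_leftInverse_of_injective _ (LinearMap.ker_eq_bot.2 hinj)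
  let N' : Matrix ι (Fin n) (ZMod p) := Matrix.of fun l i => g (Pi.single l 1) i
  have hMN' : M' * N' = 1 := by
    ext j i
    have h1 := congrArg (fun f => f (Pi.single j 1) i) hg
    simp only [LinearMap.comp_apply, LinearMap.id_apply] at h1
    rw [LinearMap.pi_apply_eq_sum_univ g] at h1
    rw [Matrix.mul_apply, Matrix.one_apply]
    simp only [Finset.sum_apply, Pi.smul_apply, smul_eq_mul, Matrix.vecMulLinear_apply,
      Matrix.single_one_vecMul, Pi.single_apply] at h1
    rw [show (if j = i then (1 : ZMod p) else 0) = if i = j then 1 else 0 by simp [eq_comm], ← h1]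
    refine Finset.sum_congr rfl fun l _ => ?_
    have hs : (Pi.single l 1 : ι → ZMod p) = fun j => if l = j then 1 else 0 := by
      funext x; simp [Pi.single_apply, eq_comm]
    simp only [N', Matrix.of_apply, hs]
    rfl
  choose N hN using fun l => fun i => hπ (N' l i)
  let P := M * Matrix.of N
  have hP : P.map π = 1 := by
    rw [← hMN', Matrix.map_mul]
    congr 1
    ext l i; simp [hN]
  have hdet : IsUnit P.det := by
    refine zm_unit hp hk _ ?_
    have : π P.det = 1 := by rw [RingHom.map_det, RingHom.mapMatrix_apply, hP, Matrix.det_one]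
    change π P.det ≠ 0
    rw [this]; exact one_ne_zero
  let Bm := Matrix.of N * P⁻¹
  have hB : M * Bm = 1 := by
    rw [← Matrix.mul_assoc]; exact Matrix.mul_nonsing_inv P hdet
  refine ⟨fun i l => Bm l i, fun i j => ?_⟩
  have := congrFun (congrFun hB j) i
  rw [Matrix.mul_apply, Matrix.one_apply] at this
  simp only [dotProduct]
  rw [show (if i = j then (1 : ZMod (p ^ k)) else 0) = if j = i then 1 else 0 by simp [eq_comm],
    ← this]
  rfl

lemma nsm (m : ℕ) {V : Type*} [AddCommGroup V] [Module (ZMod (p ^ k)) V] (x : V) :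
    m • x = (m : ZMod (p ^ k)) • x := (Nat.cast_smul_eq_nsmul _ _ _).symm

lemma psm (a : ℕ) {V : Type*} [AddCommGroup V] [Module (ZMod (p ^ k)) V] (x : V) :
    (p ^ a) • x = (p : ZMod (p ^ k)) ^ a • x := by
  rw [nsm (k := k) (p := p)]; push_cast; rfl

lemma good_iff (hp : p.Prime) (hk : 1 ≤ k) {ι : Type*} {lam : ℕ → ℕ} (hlam : ∀ j, 1 ≤ lam j)
    (hlk : ∀ j, lam j ≤ k) {n : ℕ} (m : Fin n → ι → ZMod (p ^ k)) (v : Fin n → ι → ZMod (p ^ k))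
    (hmv : ∀ j, m j = (p : ZMod (p ^ k)) ^ (k - lam j) • v j) :
    Good p lam n m ↔ Ind (p : ZMod (p ^ k)) v := by
  have : NeZero (p ^ k) := ⟨pow_ne_zero _ hp.ne_zero⟩
  have hsum : ∀ c : Fin n → ℤ, ∑ j, c j • (p ^ (lam j - 1)) • m j
      = (p : ZMod (p ^ k)) ^ (k - 1) • ∑ j, (c j : ZMod (p ^ k)) • v j := by
    intro c
    rw [Finset.smul_sum]
    refine Finset.sum_congr rfl fun j _ => ?_
    rw [psm (k := k), hmv, smul_smul, ← pow_add, smul_comm, Int.cast_smul_eq_zsmul]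
    congr 3
    have := hlam j; have := hlk j; omega
  have hdv : ∀ x : ι → ZMod (p ^ k), (p : ZMod (p ^ k)) ^ (k - 1) • x = 0 ↔
      ∃ y, x = (p : ZMod (p ^ k)) • y := by
    intro x
    rw [zv_mul_zero hp (by omega), Nat.sub_sub_self hk, pow_one]
  constructor
  · rintro ⟨-, h⟩ c hc j
    have h1 := h (fun j => ((c j).val : ℤ)) (by
      rw [hsum, hdv]; simpa using hc) j
    rw [← zm_int_dvd hp hk] at h1
    simpa using h1
  · intro h
    refine ⟨fun j => ?_, fun c hc j => ?_⟩
    · rw [psm (k := k), zv_mul_zero hp (hlk j)]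
      exact ⟨v j, hmv j⟩
    · rw [hsum, hdv] at hc
      exact (zm_int_dvd hp hk _).1 (h (fun j => (c j : ZMod (p ^ k))) hc j)

lemma good_lift (hp : p.Prime) {ι : Type*} {lam : ℕ → ℕ}
    (hlk : ∀ j, lam j ≤ k) {n : ℕ} (m : Fin n → ι → ZMod (p ^ k)) (h : Good p lam n m) :
    ∃ v : Fin n → ι → ZMod (p ^ k), ∀ j, m j = (p : ZMod (p ^ k)) ^ (k - lam j) • v j := by
  have : ∀ j, ∃ v, m j = (p : ZMod (p ^ k)) ^ (k - lam j) • v := fun j => by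
    have := h.1 j
    rw [psm (k := k), zv_mul_zero hp (hlk j)] at this
    exact this
  choose v hv using this
  exact ⟨v, hv⟩

end zm

section orb
variable {p k : ℕ} {ι : Type}

/-- good tuples in the free module -/
def GX (p k : ℕ) (ι : Type) (lam : ℕ → ℕ) (n : ℕ) : Type :=
  {m : Fin n → ι → ZMod (p ^ k) // Good p lam n m}

instance gxAct (p k : ℕ) (ι : Type) (lam : ℕ → ℕ) (n : ℕ)
    (Γ : Subgroup ((ι → ZMod (p ^ k)) ≃ₗ[ZMod (p ^ k)] (ι → ZMod (p ^ k)))) :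
    MulAction Γ (GX p k ι lam n) where
  smul A m := ⟨fun j => A.1 (m.1 j), m.2.map A.1.toLinearMap.toAddMonoidHom A.1.injective⟩
  one_smul _ := rfl
  mul_smul _ _ _ := rfl

lemma gx_smul (lam : ℕ → ℕ) (n : ℕ)
    (Γ : Subgroup ((ι → ZMod (p ^ k)) ≃ₗ[ZMod (p ^ k)] (ι → ZMod (p ^ k))))
    (A : Γ) (m : GX p k ι lam n) (j : Fin n) : (A • m).1 j = A.1 (m.1 j) := rfl

/-- the number of orbits on good tuples -/
noncomputable def orbC (p k r : ℕ) (ι : Type)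
    (ω : (ι → ZMod (p ^ k)) →ₗ[ZMod (p ^ k)] (ι → ZMod (p ^ k)) →ₗ[ZMod (p ^ k)] ZMod (p ^ k))
    (lam : ℕ → ℕ) (n : ℕ) : ℕ :=
  Nat.card (MulAction.orbitRel.Quotient (Gam ω ((p : ZMod (p ^ k)) ^ r)) (GX p k ι lam n))

/-- Gram data -/
def gramMap {r : ℕ} (hrk : r ≤ k)
    (ω : (ι → ZMod (p ^ k)) →ₗ[ZMod (p ^ k)] (ι → ZMod (p ^ k)) →ₗ[ZMod (p ^ k)] ZMod (p ^ k))
    (lam : ℕ → ℕ) (n : ℕ) (v : {v : Fin n → ι → ZMod (p ^ k) // Ind (p : ZMod (p ^ k)) v}) :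
    (j : Fin n) → Fin (j : ℕ) → ZMod (p ^ min (lam j) r) := fun j i =>
  ZMod.castHom (pow_dvd_pow p ((min_le_right (lam j) r).trans hrk)) (ZMod (p ^ min (lam j) r))
    (ω (v.1 ⟨i, i.2.trans j.2⟩) (v.1 j))

lemma card_gram (r : ℕ) (lam : ℕ → ℕ) (n : ℕ) :
    Nat.card ((j : Fin n) → Fin (j : ℕ) → ZMod (p ^ min (lam j) r)) = orbT p r lam n := by
  rw [Nat.card_pi, orbT, Finset.prod_range]
  refine Finset.prod_congr rfl fun j _ => ?_
  rw [Nat.card_pi]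
  simp

lemma orb_range [Fintype ι] (hp : p.Prime) (hk : 1 ≤ k) {r : ℕ} (hr : 1 ≤ r) (hrk : r ≤ k)
    (ω : (ι → ZMod (p ^ k)) →ₗ[ZMod (p ^ k)] (ι → ZMod (p ^ k)) →ₗ[ZMod (p ^ k)] ZMod (p ^ k))
    (hω : ∀ x, ω x x = 0) (hnd : ∀ b, ∃ u, ∀ x, ω x u = x ⬝ᵥ b)
    {lam : ℕ → ℕ} (hanti : Antitone lam) (hlam : ∀ j, 1 ≤ lam j) (hlk : ∀ j, lam j ≤ k) (n : ℕ) :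
    orbC p k r ι ω lam n = Nat.card (Set.range (gramMap hrk ω lam n)) := by
  have := zm_local hp hk
  have hnil : IsNilpotent (p : ZMod (p ^ k)) := ⟨k, by rw [← Nat.cast_pow, ZMod.natCast_self]⟩
  have hdual : ∀ (n : ℕ) (v : Fin n → ι → ZMod (p ^ k)), Ind (p : ZMod (p ^ k)) v →
      ∃ u : Fin n → ι → ZMod (p ^ k), ∀ i j, ω (v j) (u i) = if i = j then 1 else 0 := by
    intro n v hv
    obtain ⟨b, hb⟩ := exists_dot_dual hp hk v hv
    choose u hu using fun i => hnd (b i)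
    exact ⟨u, fun i j => by rw [hu, hb]⟩
  let ψ : {v : Fin n → ι → ZMod (p ^ k) // Ind (p : ZMod (p ^ k)) v} →
      MulAction.orbitRel.Quotient (Gam ω ((p : ZMod (p ^ k)) ^ r)) (GX p k ι lam n) := fun v =>
    Quotient.mk'' ⟨fun j => (p : ZMod (p ^ k)) ^ (k - lam j) • v.1 j,
      (good_iff hp hk hlam hlk _ v.1 fun j => rfl).2 v.2⟩
  have hψ : Function.Surjective ψ := by
    intro q
    induction q using Quotient.inductionOn' with
    | h m =>
      obtain ⟨v, hv⟩ := good_lift hp hlk m.1 m.2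
      refine ⟨⟨v, (good_iff hp hk hlam hlk _ v hv).1 m.2⟩, ?_⟩
      refine congrArg Quotient.mk'' (Subtype.ext (funext fun j => (hv j).symm))
  have hker : Setoid.ker ψ = Setoid.ker (gramMap hrk ω lam n) := by
    ext v v'
    rw [Setoid.ker_def, Setoid.ker_def]
    have h1 : ψ v = ψ v' ↔ ∃ A ∈ Gam ω ((p : ZMod (p ^ k)) ^ r),
        ∀ j : Fin n, ∃ y, A (v'.1 j) = v.1 j + (p : ZMod (p ^ k)) ^ lam j • y := by
      refine Quotient.eq''.trans ?_
      refine MulAction.orbitRel_apply.trans (MulAction.mem_orbit_iff.trans ?_)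
      have key : ∀ (A : (ι → ZMod (p ^ k)) ≃ₗ[ZMod (p ^ k)] (ι → ZMod (p ^ k))) (j : Fin n),
          A ((p : ZMod (p ^ k)) ^ (k - lam j) • v'.1 j) = (p : ZMod (p ^ k)) ^ (k - lam j) • v.1 j ↔
            ∃ y, A (v'.1 j) = v.1 j + (p : ZMod (p ^ k)) ^ lam j • y := by
        intro A j
        rw [map_smul, ← sub_eq_zero, ← smul_sub, zv_mul_zero hp (by omega),
          Nat.sub_sub_self (hlk j)]
        simp only [sub_eq_iff_eq_add, add_comm]
      constructor
      · rintro ⟨A, hA⟩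
        refine ⟨A.1, A.2, fun j => (key A.1 j).1 ?_⟩
        exact congrFun (congrArg Subtype.val hA) j
      · rintro ⟨A, hA, hj⟩
        exact ⟨⟨A, hA⟩, Subtype.ext (funext fun j => (key A j).2 (hj j))⟩
    have h2 : gramMap hrk ω lam n v = gramMap hrk ω lam n v' ↔ ∀ i j : Fin n, i < j →
        (p : ZMod (p ^ k)) ^ min (lam j) r ∣ ω (v'.1 i) (v'.1 j) - ω (v.1 i) (v.1 j) := by
      constructor
      · intro h i j hij
        have := congrFun (congrFun h j) ⟨i, hij⟩
        rw [← zm_cast_eq hp ((min_le_right (lam j) r).trans hrk)]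
        exact this.symm
      · intro h
        funext j i
        have := h ⟨i, i.2.trans j.2⟩ j i.2
        rw [← zm_cast_eq hp ((min_le_right (lam j) r).trans hrk)] at this
        exact this.symm
    rw [h1, h2]
    constructor
    · rintro ⟨A, hA, hj⟩ i j hij
      obtain ⟨y, hy⟩ := hj i
      obtain ⟨z, hz⟩ := hj j
      have e1 := (pow_dvd_pow (p : ZMod (p ^ k)) (min_le_right (lam j) r)).trans
        (hA (v'.1 i) (v'.1 j))
      have e2 : (p : ZMod (p ^ k)) ^ min (lam j) r ∣
          ω (A (v'.1 i)) (A (v'.1 j)) - ω (v.1 i) (v.1 j) := by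
        refine (pow_dvd_pow (p : ZMod (p ^ k)) (min_le_left (lam j) r)).trans ?_
        have hle : lam j ≤ lam i := hanti hij.le
        obtain ⟨s, hs⟩ := Nat.exists_eq_add_of_le hle
        rw [hy, hz, hs, pow_add, mul_smul]
        simp only [map_add, map_smul, LinearMap.add_apply, LinearMap.smul_apply, smul_eq_mul]
        refine ⟨ω (v.1 i) z + (p : ZMod (p ^ k)) ^ s * ω y (v.1 j) +
          (p : ZMod (p ^ k)) ^ s * (p : ZMod (p ^ k)) ^ lam j * ω y z, ?_⟩
        ring
      have := dvd_sub e2 e1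
      simpa using this
    · intro h
      exact witt_main ω hω (p : ZMod (p ^ k)) hnil hdual r hr lam hanti hlam n v'.1 v.1 v'.2 v.2 h
  rw [orbC]
  refine Nat.card_congr ((Setoid.quotientKerEquivOfSurjective ψ hψ).symm.trans ?_)
  rw [hker]
  exact Setoid.quotientKerEquivRange _

lemma orb_le [Fintype ι] (hp : p.Prime) (hk : 1 ≤ k) {r : ℕ} (hr : 1 ≤ r) (hrk : r ≤ k)
    (ω : (ι → ZMod (p ^ k)) →ₗ[ZMod (p ^ k)] (ι → ZMod (p ^ k)) →ₗ[ZMod (p ^ k)] ZMod (p ^ k))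
    (hω : ∀ x, ω x x = 0) (hnd : ∀ b, ∃ u, ∀ x, ω x u = x ⬝ᵥ b)
    {lam : ℕ → ℕ} (hanti : Antitone lam) (hlam : ∀ j, 1 ≤ lam j) (hlk : ∀ j, lam j ≤ k) (n : ℕ) :
    orbC p k r ι ω lam n ≤ orbT p r lam n := by
  have : ∀ a, NeZero (p ^ a) := fun a => ⟨pow_ne_zero _ hp.ne_zero⟩
  rw [orb_range hp hk hr hrk ω hω hnd hanti hlam hlk, ← card_gram r lam n]
  exact Nat.card_le_card_of_injective _ Subtype.val_injective

/-- Burnside. -/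
lemma burnside [Finite ι] (hp : p.Prime)
    (Γ : Subgroup ((ι → ZMod (p ^ k)) ≃ₗ[ZMod (p ^ k)] (ι → ZMod (p ^ k))))
    [Fintype Γ] (lam : ℕ → ℕ) (n : ℕ) :
    ∑ A : Γ, cnt p lam n (LinearMap.ker (A.1.toLinearMap - LinearMap.id))
      = Nat.card (MulAction.orbitRel.Quotient Γ (GX p k ι lam n)) * Nat.card Γ := by
  classical
  have : NeZero (p ^ k) := ⟨pow_ne_zero _ hp.ne_zero⟩
  have : Finite (GX p k ι lam n) := Subtype.finite
  have := Fintype.ofFinite (GX p k ι lam n)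
  have := Fintype.ofFinite (MulAction.orbitRel.Quotient Γ (GX p k ι lam n))
  have hB := MulAction.sum_card_fixedBy_eq_card_orbits_mul_card_group Γ (GX p k ι lam n)
  rw [Nat.card_eq_fintype_card, Nat.card_eq_fintype_card, ← hB]
  refine Finset.sum_congr rfl fun A _ => ?_
  rw [← Nat.card_eq_fintype_card, cnt]
  have hmem : ∀ x, x ∈ LinearMap.ker (A.1.toLinearMap - LinearMap.id) ↔ A.1 x = x := fun x => by
    rw [LinearMap.mem_ker]; simp [sub_eq_zero]
  refine Nat.card_congr
    ⟨fun m => ⟨⟨fun j => (m.1 j).1, m.2.map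
        (LinearMap.ker (A.1.toLinearMap - LinearMap.id)).subtype.toAddMonoidHom
        Subtype.val_injective⟩, ?_⟩,
      fun m => ⟨fun j => ⟨m.1.1 j, ?_⟩, ?_⟩, fun _ => rfl, fun _ => rfl⟩
  · exact Subtype.ext (funext fun j => (hmem _).1 (m.1 j).2)
  · rw [hmem]; exact congrFun (congrArg Subtype.val m.2) j
  · exact good_of_map (LinearMap.ker (A.1.toLinearMap - LinearMap.id)).subtype.toAddMonoidHom
        Subtype.val_injective m.1.2

lemma tor_V [Fintype ι] (hp : p.Prime) (hk : 1 ≤ k) :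
    tor p (ι → ZMod (p ^ k)) = p ^ Fintype.card ι := by
  rw [tor_pi]
  simp [tor_zmod hp hk]

lemma orb_zero [Fintype ι] (hp : p.Prime) (hk : 1 ≤ k) {r : ℕ}
    (ω : (ι → ZMod (p ^ k)) →ₗ[ZMod (p ^ k)] (ι → ZMod (p ^ k)) →ₗ[ZMod (p ^ k)] ZMod (p ^ k))
    {lam : ℕ → ℕ} (hlam : ∀ j, 1 ≤ lam j) (n : ℕ) (hn : Fintype.card ι < n) :
    orbC p k r ι ω lam n = 0 := by
  have : Fact p.Prime := ⟨hp⟩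
  have : NeZero (p ^ k) := ⟨pow_ne_zero _ hp.ne_zero⟩
  rw [orbC, Nat.card_eq_zero]
  left
  constructor
  intro q
  induction q using Quotient.inductionOn' with
  | h m =>
    have := pow_le_tor hlam m.2
    rw [tor_V hp hk] at this
    exact absurd ((Nat.pow_le_pow_iff_right hp.one_lt).1 this) (by omega)

lemma tor_sub [Fintype ι] (hp : p.Prime) (hk : 1 ≤ k)
    (S : Submodule (ZMod (p ^ k)) (ι → ZMod (p ^ k))) :
    ∃ D ≤ Fintype.card ι, tor p S = p ^ D := by
  have : Fact p.Prime := ⟨hp⟩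
  have : NeZero (p ^ k) := ⟨pow_ne_zero _ hp.ne_zero⟩
  obtain ⟨D, hD⟩ := exists_tor (p := p) (K := S)
  refine ⟨D, ?_, hD⟩
  rw [← Nat.pow_le_pow_iff_right hp.one_lt, ← hD, ← tor_V hp hk]
  refine Nat.card_le_card_of_injective
    (fun x => ⟨x.1.1, congrArg Subtype.val x.2⟩) ?_
  intro x y h
  exact Subtype.ext (Subtype.ext (Subtype.mk.inj h))

end orb

section symp
variable {p k : ℕ}

/-- the standard symplectic form -/
noncomputable def spF (R : Type) [CommRing R] (g : ℕ) :
    (Fin g ⊕ Fin g → R) →ₗ[R] (Fin g ⊕ Fin g → R) →ₗ[R] R :=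
  Matrix.toLinearMap₂' R (Matrix.J (Fin g) R)

lemma spF_dot {R : Type} [CommRing R] {g : ℕ} (x y : Fin g ⊕ Fin g → R) :
    spF R g x y = x ⬝ᵥ (Matrix.J (Fin g) R *ᵥ y) := Matrix.toLinearMap₂'_apply' _ _ _

lemma spF_apply {R : Type} [CommRing R] {g : ℕ} (x y : Fin g ⊕ Fin g → R) :
    spF R g x y = ∑ i, (x (Sum.inr i) * y (Sum.inl i) - x (Sum.inl i) * y (Sum.inr i)) := by
  rw [spF_dot, Matrix.J, Matrix.fromBlocks_mulVec]
  simp only [dotProduct, Fintype.sum_sum_type, Sum.elim_inl, Sum.elim_inr, Finset.sum_sub_distrib]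
  simp [Matrix.neg_mulVec]
  ring

lemma spF_alt {R : Type} [CommRing R] {g : ℕ} (x : Fin g ⊕ Fin g → R) : spF R g x x = 0 := by
  rw [spF_apply]
  exact Finset.sum_eq_zero fun i _ => by ring

lemma spF_nd {R : Type} [CommRing R] {g : ℕ} (b : Fin g ⊕ Fin g → R) :
    ∃ u, ∀ x, spF R g x u = x ⬝ᵥ b := by
  refine ⟨-(Matrix.J (Fin g) R *ᵥ b), fun x => ?_⟩
  rw [spF_dot, Matrix.mulVec_neg, Matrix.mulVec_mulVec, Matrix.J_squared]
  simp [Matrix.neg_mulVec]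

lemma orb_eq (hp : p.Prime) (hk : 1 ≤ k) {r : ℕ} (hr : 1 ≤ r) (hrk : r ≤ k) {g : ℕ}
    {lam : ℕ → ℕ} (hanti : Antitone lam) (hlam : ∀ j, 1 ≤ lam j) (hlk : ∀ j, lam j ≤ k) (n : ℕ)
    (hn : n ≤ g) :
    orbC p k r (Fin g ⊕ Fin g) (spF _ g) lam n = orbT p r lam n := by
  rw [orb_range hp hk hr hrk _ spF_alt spF_nd hanti hlam hlk, ← card_gram r lam n]
  suffices h : Function.Surjective (gramMap hrk (spF (ZMod (p ^ k)) g) lam n) by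
    rw [h.range_eq, Nat.card_univ]
  intro t
  choose T hT using fun (j : Fin n) (i : Fin (j : ℕ)) => ZMod.ringHom_surjective
    (ZMod.castHom (pow_dvd_pow p ((min_le_right (lam j) r).trans hrk)) (ZMod (p ^ min (lam j) r)))
    (t j i)
  let v : Fin n → Fin g ⊕ Fin g → ZMod (p ^ k) := fun j => Sum.elim
    (fun a => if (a : ℕ) = j then 1 else 0)
    (fun a => if h : (a : ℕ) < j then - T j ⟨a, h⟩ else 0)
  have hv : Ind (p : ZMod (p ^ k)) v := by
    rintro c ⟨y, hy⟩ j
    refine ⟨y (Sum.inl (Fin.castLE hn j)), ?_⟩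
    have := congrFun hy (Sum.inl (Fin.castLE hn j))
    rw [Finset.sum_apply, Finset.sum_eq_single j] at this
    · simpa [v] using this
    · intro b _ hb
      have : ¬ ((j : ℕ) = b) := fun h => hb (Fin.ext h.symm)
      simp [v, this]
    · simp
  refine ⟨⟨v, hv⟩, ?_⟩
  funext j i
  rw [← hT]
  unfold gramMap
  congr 1
  rw [spF_apply, Finset.sum_sub_distrib, Finset.sum_eq_single (Fin.castLE hn j),
    Finset.sum_eq_single (Fin.castLE hn ⟨i, i.2.trans j.2⟩)]
  · have : ¬ ((j : ℕ) < i) := by have := i.2; omega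
    simp [v, this]
  · intro b _ hb
    have : ¬ ((b : ℕ) = i) := fun h => hb (Fin.ext h)
    simp [v, this]
  · simp
  · intro b _ hb
    have : ¬ ((b : ℕ) = j) := fun h => hb (Fin.ext h)
    simp [v, this]
  · simp

/-- average of the counting function over the group -/
lemma avg_limit (hp : p.Prime) (hk : 1 ≤ k) {r : ℕ} (hr : 1 ≤ r) (hrk : r ≤ k)
    {lam : ℕ → ℕ} (hanti : Antitone lam) (hlam : ∀ j, 1 ≤ lam j) (hlk : ∀ j, lam j ≤ k) (d : ℕ)
    (hd : ∀ j, d ≤ j → lam j = 1)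
    [∀ g : ℕ, Fintype (Gam (spF (ZMod (p ^ k)) g) ((p : ZMod (p ^ k)) ^ r))] :
    ∃ L : ℝ, Filter.Tendsto (fun g : ℕ =>
      (∑ A : Gam (spF (ZMod (p ^ k)) g) ((p : ZMod (p ^ k)) ^ r),
        if tor p (LinearMap.ker (A.1.toLinearMap - LinearMap.id)) = p ^ d then
          (cnt p lam d (LinearMap.ker (A.1.toLinearMap - LinearMap.id)) : ℝ) else 0) /
        (Nat.card (Gam (spF (ZMod (p ^ k)) g) ((p : ZMod (p ^ k)) ^ r)) : ℝ))
      Filter.atTop (nhds L) := by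
  have : Fact p.Prime := ⟨hp⟩
  have : NeZero (p ^ k) := ⟨pow_ne_zero _ hp.ne_zero⟩
  obtain ⟨L, hL⟩ := main_limit p r hp.two_le hr lam d hd
    (fun g n => orbC p k r (Fin g ⊕ Fin g) (spF _ g) lam n)
    (fun g n => orb_le hp hk hr hrk _ spF_alt spF_nd hanti hlam hlk n)
    (fun g n hn => orb_eq hp hk hr hrk hanti hlam hlk n hn)
    (fun g n hn => orb_zero hp hk _ hlam n (by simpa [two_mul] using hn))
  refine ⟨L, hL.congr fun g => ?_⟩
  have hc : (Nat.card (Gam (spF (ZMod (p ^ k)) g) ((p : ZMod (p ^ k)) ^ r)) : ℝ) ≠ 0 := by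
    exact Nat.cast_ne_zero.2 Nat.card_pos.ne'
  rw [eq_div_iff hc, Finset.sum_mul]
  have h1 : ∀ A : Gam (spF (ZMod (p ^ k)) g) ((p : ZMod (p ^ k)) ^ r),
      (if tor p (LinearMap.ker (A.1.toLinearMap - LinearMap.id)) = p ^ d then
          (cnt p lam d (LinearMap.ker (A.1.toLinearMap - LinearMap.id)) : ℝ) else 0) =
      ∑ i ∈ Finset.range (2 * g + 1), svC p i / (p : ℝ) ^ (d * i) *
        cnt p lam (d + i) (LinearMap.ker (A.1.toLinearMap - LinearMap.id)) := by
    intro A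
    obtain ⟨D, hDle, hD⟩ := tor_sub hp hk (LinearMap.ker (A.1.toLinearMap - LinearMap.id))
    exact (sieve_K hlam hd hD (by simpa [two_mul] using hDle)).symm
  rw [Finset.sum_congr rfl fun A _ => h1 A, Finset.sum_comm]
  refine Finset.sum_congr rfl fun i _ => ?_
  rw [← Finset.mul_sum, mul_assoc]
  congr 1
  have := burnside hp (Gam (spF (ZMod (p ^ k)) g) ((p : ZMod (p ^ k)) ^ r)) lam (d + i)
  rw [orbC]
  exact_mod_cast this.symm

end symp

section tri
variable {p k d : ℕ}

lemma hgp_finite (hp : p.Prime) (e : Fin d → Fin k) : Finite (Hgp p e) := by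
  have : ∀ a, NeZero (p ^ a) := fun a => ⟨pow_ne_zero _ hp.ne_zero⟩
  exact Pi.finite

open Classical in
lemma expand_K (hp : p.Prime) (lam : ℕ → ℕ) {K : Type} [AddCommGroup K] [Finite K]
    (hkill : ∀ x : K, p ^ k • x = 0) :
    (if tor p K = p ^ d then (cnt p lam d K : ℝ) else 0) =
      ∑ μ : Fin d → Fin k, ((cnt p lam d (Hgp p μ) : ℝ) /
        ((Finset.univ.filter fun μ' : Fin d → Fin k => Nonempty (Hgp p μ' ≃+ Hgp p μ)).card : ℝ)) *
        (if Nonempty (K ≃+ Hgp p μ) then 1 else 0) := by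
  obtain ⟨d', e', ⟨E⟩⟩ := structure_K hp k hkill
  have ht : tor p K = p ^ d' := by rw [tor_congr E, tor_Hgp hp]
  by_cases hd : d' = d
  · subst hd
    rw [if_pos ht]
    simp only [mul_ite, mul_one, mul_zero]
    rw [← Finset.sum_filter]
    have h1 : ∀ μ ∈ Finset.univ.filter (fun μ : Fin d' → Fin k => Nonempty (K ≃+ Hgp p μ)),
        (cnt p lam d' (Hgp p μ) : ℝ) /
        ((Finset.univ.filter fun μ' : Fin d' → Fin k => Nonempty (Hgp p μ' ≃+ Hgp p μ)).card : ℝ)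
        = (cnt p lam d' K : ℝ) /
        ((Finset.univ.filter (fun μ : Fin d' → Fin k => Nonempty (K ≃+ Hgp p μ))).card : ℝ) := by
      intro μ hμ
      obtain ⟨F⟩ := (Finset.mem_filter.1 hμ).2
      rw [cnt_congr F]
      congr 3
      ext μ'
      simp only [Finset.mem_filter, Finset.mem_univ, true_and]
      exact ⟨fun ⟨f⟩ => ⟨F.trans f.symm⟩, fun ⟨f⟩ => ⟨f.symm.trans F⟩⟩
    rw [Finset.sum_congr rfl h1, Finset.sum_const, nsmul_eq_mul, mul_div_cancel₀]
    have : 0 < (Finset.univ.filter (fun μ : Fin d' → Fin k => Nonempty (K ≃+ Hgp p μ))).card :=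
      Finset.card_pos.2 ⟨e', by simpa using ⟨E⟩⟩
    exact_mod_cast this.ne'
  · rw [if_neg]
    · symm
      refine Finset.sum_eq_zero fun μ _ => ?_
      rw [if_neg, mul_zero]
      rintro ⟨F⟩
      rw [tor_congr F, tor_Hgp hp] at ht
      exact hd (Nat.pow_right_injective hp.two_le ht).symm
    · rw [ht]
      exact fun h => hd (Nat.pow_right_injective hp.two_le h)

lemma card_lt_of_cnt (hp : p.Prime) {lam : ℕ → ℕ} (hlam : ∀ j, 1 ≤ lam j) {H K : Type}
    [AddCommGroup H] [AddCommGroup K] [Finite K]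
    (E : H ≃+ ((j : Fin d) → ZMod (p ^ lam j))) (hc : cnt p lam d K ≠ 0)
    (hne : ¬ Nonempty (K ≃+ H)) : Nat.card H < Nat.card K := by
  have h0 : Nonempty {m : Fin d → K // Good p lam d m} := by
    by_contra h
    rw [not_nonempty_iff] at h
    exact hc (by rw [cnt, Nat.card_of_isEmpty])
  obtain ⟨m, hm⟩ := h0
  obtain ⟨f, hf⟩ := exists_inj_of_good hp hlam hm
  let f' : H →+ K := f.comp E.toAddMonoidHom
  have hf' : Function.Injective f' := hf.comp E.injective
  have := Finite.of_injective f' hf'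
  refine lt_of_le_of_ne (Nat.card_le_card_of_injective f' hf') fun h => hne ?_
  have hb : Function.Bijective f' := (Nat.bijective_iff_injective_and_card f').2 ⟨hf', h⟩
  exact ⟨(AddEquiv.ofBijective f' hb).symm⟩

open Classical in
lemma tri_main (hp : p.Prime) (hk : 1 ≤ k) (Γ : ℕ → Type) [∀ g, Fintype (Γ g)]
    (K : (g : ℕ) → Γ g → Type) [∀ g A, AddCommGroup (K g A)] [∀ g A, Finite (K g A)]
    (hkill : ∀ g A, ∀ x : K g A, p ^ k • x = 0) (N : ℕ → ℝ)
    (h : ∀ lam : ℕ → ℕ, Antitone lam → (∀ j, 1 ≤ lam j) → (∀ j, lam j ≤ k) →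
      (∀ j, d ≤ j → lam j = 1) → ∃ L : ℝ, Filter.Tendsto (fun g => (∑ A : Γ g,
        if tor p (K g A) = p ^ d then (cnt p lam d (K g A) : ℝ) else 0) / N g)
        Filter.atTop (nhds L)) (e : Fin d → Fin k) :
    ∃ L : ℝ, Filter.Tendsto (fun g => (∑ A : Γ g,
        if Nonempty (K g A ≃+ Hgp p e) then (1 : ℝ) else 0) / N g) Filter.atTop (nhds L) := by
  have hfin : ∀ e : Fin d → Fin k, Finite (Hgp p e) := hgp_finite hp
  let B := ∑ e : Fin d → Fin k, Nat.card (Hgp p e)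
  have hB : ∀ e : Fin d → Fin k, Nat.card (Hgp p e) ≤ B := fun e =>
    Finset.single_le_sum (f := fun e : Fin d → Fin k => Nat.card (Hgp p e))
      (fun _ _ => Nat.zero_le _) (Finset.mem_univ e)
  suffices hM : ∀ (M : ℕ) (e : Fin d → Fin k), B - Nat.card (Hgp p e) < M →
      ∃ L : ℝ, Filter.Tendsto (fun g => (∑ A : Γ g,
        if Nonempty (K g A ≃+ Hgp p e) then (1 : ℝ) else 0) / N g) Filter.atTop (nhds L) from
    hM _ e (Nat.lt_succ_self _)
  intro M
  induction M with
  | zero => intro e he; exact absurd he (Nat.not_lt_zero _)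
  | succ M ih =>
    intro e he
    obtain ⟨lam, hanti, hlam, hlk, hd, ⟨E⟩⟩ := sorted_Hgp (p := p) hk e
    obtain ⟨L, hL⟩ := h lam hanti hlam hlk hd
    let P : (Fin d → Fin k) → ℕ → ℝ := fun μ g => (∑ A : Γ g,
        if Nonempty (K g A ≃+ Hgp p μ) then (1 : ℝ) else 0) / N g
    let w : (Fin d → Fin k) → ℝ := fun μ => (cnt p lam d (Hgp p μ) : ℝ) /
        ((Finset.univ.filter fun μ' : Fin d → Fin k => Nonempty (Hgp p μ' ≃+ Hgp p μ)).card : ℝ)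
    have hF : ∀ g, (∑ A : Γ g,
        if tor p (K g A) = p ^ d then (cnt p lam d (K g A) : ℝ) else 0) / N g
        = ∑ μ, w μ * P μ g := by
      intro g
      rw [Finset.sum_congr rfl fun A _ => expand_K hp lam (hkill g A), Finset.sum_comm,
        Finset.sum_div]
      refine Finset.sum_congr rfl fun μ _ => ?_
      rw [← Finset.mul_sum, mul_div_assoc]
    let Q : Finset (Fin d → Fin k) := Finset.univ.filter fun μ => Nonempty (Hgp p μ ≃+ Hgp p e)
    let a : ℝ := ∑ μ ∈ Q, w μ
    have hw : ∀ μ, 0 ≤ w μ := fun μ => div_nonneg (Nat.cast_nonneg _) (Nat.cast_nonneg _)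
    have heQ : e ∈ Q := Finset.mem_filter.2 ⟨Finset.mem_univ _, ⟨AddEquiv.refl _⟩⟩
    have hwe : 0 < w e := by
      refine div_pos ?_ ?_
      · rw [cnt_congr E]
        have : ∀ a, NeZero (p ^ a) := fun a => ⟨pow_ne_zero _ hp.ne_zero⟩
        have : Nonempty {m : Fin d → ((j : Fin d) → ZMod (p ^ lam j)) // Good p lam d m} :=
          ⟨⟨_, good_std hp hlam⟩⟩
        exact_mod_cast (Nat.card_pos : 0 < Nat.card
          {m : Fin d → ((j : Fin d) → ZMod (p ^ lam j)) // Good p lam d m})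
      · exact_mod_cast Finset.card_pos.2 ⟨e, heQ⟩
    have ha : a ≠ 0 := (lt_of_lt_of_le hwe (Finset.single_le_sum (fun μ _ => hw μ) heQ)).ne'
    have hother : ∃ L' : ℝ, Filter.Tendsto (fun g => ∑ μ ∈ Finset.univ.filter
        (fun μ => ¬ Nonempty (Hgp p μ ≃+ Hgp p e)), w μ * P μ g) Filter.atTop (nhds L') := by
      have : ∀ μ ∈ Finset.univ.filter (fun μ => ¬ Nonempty (Hgp p μ ≃+ Hgp p e)),
          ∃ l : ℝ, Filter.Tendsto (fun g => w μ * P μ g) Filter.atTop (nhds l) := by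
        intro μ hμ
        by_cases hc : cnt p lam d (Hgp p μ) = 0
        · refine ⟨0, ?_⟩
          have : w μ = 0 := by simp [w, hc]
          simp [this]
        · have h1 := card_lt_of_cnt hp hlam E hc (Finset.mem_filter.1 hμ).2
          have h2 := hB μ
          obtain ⟨l, hl⟩ := ih μ (by omega)
          exact ⟨w μ * l, hl.const_mul _⟩
      choose! l hl using this
      exact ⟨_, tendsto_finsetSum _ hl⟩
    obtain ⟨L', hL'⟩ := hother
    refine ⟨(L - L') / a, ((hL.sub hL').div_const a).congr fun g => ?_⟩
    rw [hF, div_eq_iff ha, ← Finset.sum_filter_add_sum_filter_not Finset.univ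
      (fun μ => Nonempty (Hgp p μ ≃+ Hgp p e)), add_sub_cancel_right, Finset.mul_sum]
    refine Finset.sum_congr rfl fun μ hμ => ?_
    obtain ⟨F⟩ := (Finset.mem_filter.1 hμ).2
    rw [mul_comm]
    congr 1
    refine congrArg (fun x => x / N g) (Finset.sum_congr rfl fun A _ => ?_)
    exact if_congr ⟨fun ⟨f⟩ => ⟨f.trans F⟩, fun ⟨f⟩ => ⟨f.trans F.symm⟩⟩ rfl rfl

end tri

section fin
variable {p k r : ℕ}

lemma spcong_iff (hp : p.Prime) (hrk : r ≤ k) {g : ℕ}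
    (A : Matrix (Fin g ⊕ Fin g) (Fin g ⊕ Fin g) (ZMod (p ^ k))) :
    (A.map (ZMod.castHom (pow_dvd_pow p hrk) (ZMod (p ^ r))))ᵀ *
        Matrix.J (Fin g) (ZMod (p ^ r)) *
        (A.map (ZMod.castHom (pow_dvd_pow p hrk) (ZMod (p ^ r))))
      = Matrix.J (Fin g) (ZMod (p ^ r)) ↔
    ∀ x y, (p : ZMod (p ^ k)) ^ r ∣ spF _ g (A *ᵥ x) (A *ᵥ y) - spF _ g x y := by
  let c := ZMod.castHom (pow_dvd_pow p hrk) (ZMod (p ^ r))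
  have hJ : (Matrix.J (Fin g) (ZMod (p ^ k))).map c = Matrix.J (Fin g) (ZMod (p ^ r)) := by
    rw [Matrix.J, Matrix.J, Matrix.fromBlocks_map]
    congr 1
    · ext i j; simp
    · ext i j; simp [Matrix.one_apply, apply_ite c]
    · ext i j; simp [Matrix.one_apply, apply_ite c]
    · ext i j; simp
  have h1 : (A.map c)ᵀ * Matrix.J (Fin g) (ZMod (p ^ r)) * (A.map c)
      = (Aᵀ * Matrix.J (Fin g) (ZMod (p ^ k)) * A).map c := by
    rw [Matrix.map_mul, Matrix.map_mul, hJ, Matrix.transpose_map]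
  have h2 : ∀ x y, spF _ g (A *ᵥ x) (A *ᵥ y) - spF _ g x y =
      x ⬝ᵥ ((Aᵀ * Matrix.J (Fin g) (ZMod (p ^ k)) * A - Matrix.J (Fin g) (ZMod (p ^ k))) *ᵥ y) := by
    intro x y
    rw [spF_dot, spF_dot, Matrix.sub_mulVec, dotProduct_sub]
    congr 1
    rw [← Matrix.mulVec_mulVec, ← Matrix.mulVec_mulVec, Matrix.dotProduct_mulVec x,
      Matrix.vecMul_transpose]
  change (A.map c)ᵀ * Matrix.J (Fin g) (ZMod (p ^ r)) * (A.map c) = _ ↔ _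
  rw [h1]
  set D := Aᵀ * Matrix.J (Fin g) (ZMod (p ^ k)) * A with hD
  constructor
  · intro h x y
    rw [h2]
    refine Finset.dvd_sum fun i _ => Dvd.dvd.mul_left ?_ _
    rw [Matrix.mulVec, dotProduct]
    refine Finset.dvd_sum fun j _ => Dvd.dvd.mul_right ?_ _
    rw [Matrix.sub_apply, ← zm_cast_eq hp hrk]
    have := congrFun (congrFun (h.trans hJ.symm) i) j
    exact this
  · intro h
    rw [← hJ]
    ext i j
    have := h (Pi.single i 1) (Pi.single j 1)
    rw [h2, single_one_dotProduct, Matrix.mulVec_single_one] at this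
    exact (zm_cast_eq hp hrk _ _).2 this

lemma card_conv (hp : p.Prime) (hrk : r ≤ k) {g : ℕ}
    (Q : Submodule (ZMod (p ^ k)) ((Fin g ⊕ Fin g) → ZMod (p ^ k)) → Prop) :
    Nat.card {A : Matrix (Fin g ⊕ Fin g) (Fin g ⊕ Fin g) (ZMod (p ^ k)) //
            IsSpCong p r k hrk A ∧ Q (kerAminusI p k A)} =
    Nat.card {A : Gam (spF (ZMod (p ^ k)) g) ((p : ZMod (p ^ k)) ^ r) //
      Q (LinearMap.ker (A.1.toLinearMap - LinearMap.id))} := by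
  symm
  have hsp : ∀ A : Gam (spF (ZMod (p ^ k)) g) ((p : ZMod (p ^ k)) ^ r),
      IsSpCong p r k hrk (LinearMap.toMatrix' A.1.toLinearMap) := by
    intro A
    refine ⟨?_, (spcong_iff hp hrk _).2 fun x y => ?_⟩
    · refine IsUnit.of_mul_eq_one (LinearMap.toMatrix' A.1.symm.toLinearMap) ?_
      rw [← LinearMap.toMatrix'_comp]
      simp
    · simp only [LinearMap.toMatrix'_mulVec]
      exact A.2 x y
  have hker : ∀ A : Gam (spF (ZMod (p ^ k)) g) ((p : ZMod (p ^ k)) ^ r),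
      kerAminusI p k (LinearMap.toMatrix' A.1.toLinearMap) =
        LinearMap.ker (A.1.toLinearMap - LinearMap.id) := by
    intro A
    rw [kerAminusI, ← Matrix.toLin'_apply', Matrix.toLin'_toMatrix']
  refine Nat.card_congr (Equiv.ofBijective (fun A => ⟨LinearMap.toMatrix' A.1.1.toLinearMap,
    hsp A.1, by rw [hker]; exact A.2⟩) ⟨?_, ?_⟩)
  · intro A B h
    have := LinearMap.toMatrix'.injective (Subtype.mk.inj h)
    exact Subtype.ext (Subtype.ext (LinearEquiv.toLinearMap_injective this))
  · rintro ⟨M, hM, hQ⟩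
    obtain ⟨u, hu⟩ := hM.1
    let E := Matrix.toLin'OfInv (M' := M) (M := (u⁻¹).1) (by rw [← hu]; exact u.inv_mul)
      (by rw [← hu]; exact u.mul_inv)
    have hE : E.toLinearMap = Matrix.toLin' M := LinearMap.ext fun x => rfl
    have hEM : LinearMap.toMatrix' E.toLinearMap = M := by rw [hE, LinearMap.toMatrix'_toLin']
    have hEG : E ∈ Gam (spF (ZMod (p ^ k)) g) ((p : ZMod (p ^ k)) ^ r) := by
      intro x y
      exact (spcong_iff hp hrk M).1 hM.2 x y
    refine ⟨⟨⟨E, hEG⟩, ?_⟩, Subtype.ext hEM⟩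
    rw [← hker ⟨E, hEG⟩, hEM]
    exact hQ

end fin

theorem stmt_14 (p : ℕ) (hp : p.Prime) (r k : ℕ) (hr : 1 ≤ r) (hrk : r ≤ k)
    (G : Type) [AddCommGroup G] [Finite G] (hG : ∀ x : G, ((p : ℤ) ^ (k - 1)) • x = 0) :
    ∃ L : ℝ, Filter.Tendsto
      (fun g : ℕ =>
        (Nat.card {A : Matrix (Fin g ⊕ Fin g) (Fin g ⊕ Fin g) (ZMod (p ^ k)) //
            IsSpCong p r k hrk A ∧ Nonempty ((kerAminusI p k A) ≃+ G)} : ℝ) /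
          (Nat.card {A : Matrix (Fin g ⊕ Fin g) (Fin g ⊕ Fin g) (ZMod (p ^ k)) //
            IsSpCong p r k hrk A} : ℝ))
      Filter.atTop (nhds L) := by
  classical
  have hk : 1 ≤ k := hr.trans hrk
  have : NeZero (p ^ k) := ⟨pow_ne_zero _ hp.ne_zero⟩
  have hkG : ∀ x : G, p ^ k • x = 0 := by
    intro x
    have h1 : p ^ (k - 1) • x = 0 := by
      have := hG x
      rw [← natCast_zsmul]
      exact_mod_cast this
    rw [show p ^ k = p * p ^ (k - 1) by rw [← pow_succ', Nat.sub_add_cancel hk], mul_smul, h1,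
      smul_zero]
  obtain ⟨d, e, ⟨E⟩⟩ := structure_K hp k hkG
  have hfin : ∀ g : ℕ, Finite (Gam (spF (ZMod (p ^ k)) g) ((p : ZMod (p ^ k)) ^ r)) := by
    intro g
    have : Finite ((Fin g ⊕ Fin g → ZMod (p ^ k)) ≃ₗ[ZMod (p ^ k)] (Fin g ⊕ Fin g → ZMod (p ^ k))) :=
      Finite.of_injective (fun f => (f : (Fin g ⊕ Fin g → ZMod (p ^ k)) → _)) DFunLike.coe_injective
    exact Subtype.finite
  have hft : ∀ g : ℕ, Fintype (Gam (spF (ZMod (p ^ k)) g) ((p : ZMod (p ^ k)) ^ r)) := fun g =>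
    Fintype.ofFinite _
  obtain ⟨L, hL⟩ := tri_main (d := d) hp hk
    (fun g => Gam (spF (ZMod (p ^ k)) g) ((p : ZMod (p ^ k)) ^ r))
    (fun g A => LinearMap.ker (A.1.toLinearMap - LinearMap.id))
    (fun g A x => by rw [nsm (k := k) (p := p), ZMod.natCast_self, zero_smul])
    (fun g => (Nat.card (Gam (spF (ZMod (p ^ k)) g) ((p : ZMod (p ^ k)) ^ r)) : ℝ))
    (fun lam hanti hlam hlk hd => avg_limit hp hk hr hrk hanti hlam hlk d hd) e
  refine ⟨L, hL.congr fun g => ?_⟩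
  have h1 := card_conv hp hrk (g := g) (r := r) (fun S => Nonempty (S ≃+ G))
  have h2 := card_conv hp hrk (g := g) (r := r) (fun _ => True)
  simp only [and_true] at h2
  have h3 : Nat.card {A : Gam (spF (ZMod (p ^ k)) g) ((p : ZMod (p ^ k)) ^ r) // True} =
      Nat.card (Gam (spF (ZMod (p ^ k)) g) ((p : ZMod (p ^ k)) ^ r)) :=
    Nat.card_congr (Equiv.subtypeUnivEquiv fun _ => trivial)
  rw [h1, h2, h3]
  congr 1
  rw [Nat.card_eq_fintype_card, Fintype.card_subtype, Finset.sum_boole]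
  congr 2
  ext A
  simp only [Finset.mem_filter, Finset.mem_univ, true_and]
  exact ⟨fun ⟨f⟩ => ⟨f.trans E.symm⟩, fun ⟨f⟩ => ⟨f.trans E⟩⟩
end

section
/- Let p be a prime, r ≥ 1 an integer, and H a finite abelian p-group, viewed as a ℤ_p-module. For g ≥ 1 let x₁, …, x_{2g} be the standard basis of ℤ_p^{2g}, and for a surjective ℤ_p-linear map φ : ℤ_p^{2g} → H define F(φ) = ∑_{i=1}^{g} φ(x_i) ∧ φ(x_{g+i}) ∈ ⋀²H (the second exterior power of H over ℤ). Then there exists g₀ (depending on H and r) such that for all g ≥ g₀ and all surjective ℤ_p-linear maps φ_a, φ_b : ℤ_p^{2g} → H with F(φ_a) − F(φ_b) ∈ p^r·(⋀²H), there exists M ∈ Sp^{(r)}_{2g}(ℤ_p) such that φ_b = φ_a ∘ M. -/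
open scoped BigOperators
open Matrix

variable (p : ℕ) [Fact p.Prime]

/-- `F(φ) = ∑_{i=1}^{g} φ(x_i) ∧ φ(x_{g+i})`, an element of the exterior square `⋀²H ⊆ ⋀H`
(over `ℤ`); here the standard basis of `ℤ_p^{2g}` is indexed by `Fin g ⊕ Fin g`. -/
noncomputable def Fsymp {g : ℕ} (H : Type) [AddCommGroup H] [Module ℤ_[p] H]
    (φ : ((Fin g ⊕ Fin g) → ℤ_[p]) →ₗ[ℤ_[p]] H) : ExteriorAlgebra ℤ H :=
  ∑ i : Fin g,
    ExteriorAlgebra.ι ℤ (φ (Pi.single (Sum.inl i) 1)) *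
      ExteriorAlgebra.ι ℤ (φ (Pi.single (Sum.inr i) 1))

set_option linter.unusedSectionVars false

section Helpers

/-- Matrices acting on vectors with entries in a module. -/
def actM {R H α β : Type*} [CommRing R] [AddCommGroup H] [Module R H] [Fintype β]
    (A : Matrix α β R) (a : β → H) : α → H := fun i => ∑ j, A i j • a j

variable {R R' H Q : Type*} [CommRing R] [CommRing R'] [AddCommGroup H] [Module R H]
  [AddCommGroup Q] [Module R Q]
variable {α β γ ι : Type*} [Fintype β] [Fintype γ] [Fintype ι] [DecidableEq ι]

lemma actM_mul (A : Matrix α β R) (B : Matrix β γ R) (a : γ → H) :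
    actM (A * B) a = actM A (actM B a) := by
  funext i
  simp only [actM, Matrix.mul_apply, Finset.sum_smul, Finset.smul_sum, mul_smul]
  rw [Finset.sum_comm]

lemma actM_one (a : ι → H) : actM (1 : Matrix ι ι R) a = a := by
  funext i
  simp [actM, Matrix.one_apply, ite_smul]

lemma actM_add (A B : Matrix α β R) (a : β → H) : actM (A + B) a = actM A a + actM B a := by
  funext i
  simp [actM, add_smul, Finset.sum_add_distrib]

lemma actM_neg (A : Matrix α β R) (a : β → H) : actM (-A) a = - actM A a := by
  funext i
  simp [actM]

lemma actM_fromBlocks (A B C D : Matrix ι ι R) (a b : ι → H) :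
    actM (fromBlocks A B C D) (Sum.elim a b)
      = Sum.elim (actM A a + actM B b) (actM C a + actM D b) := by
  funext i
  cases i <;> simp [actM]

/-- The pairing `∑ B(a_i, b_i)`. -/
def pairB (B : H →ₗ[R] H →ₗ[R] Q) (a b : ι → H) : Q := ∑ i, B (a i) (b i)

lemma pairB_act (B : H →ₗ[R] H →ₗ[R] Q) (A : Matrix ι ι R) (a b : ι → H) :
    pairB B (actM A a) b = pairB B a (actM Aᵀ b) := by
  simp only [pairB, actM, map_sum, LinearMap.sum_apply, map_smul, LinearMap.smul_apply,
    transpose_apply]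
  rw [Finset.sum_comm]

lemma pairB_add_left (B : H →ₗ[R] H →ₗ[R] Q) (a a' b : ι → H) :
    pairB B (a + a') b = pairB B a b + pairB B a' b := by
  simp [pairB, Finset.sum_add_distrib]

lemma pairB_add_right (B : H →ₗ[R] H →ₗ[R] Q) (a b b' : ι → H) :
    pairB B a (b + b') = pairB B a b + pairB B a b' := by
  simp [pairB, Finset.sum_add_distrib]

lemma alt_neg (B : H →ₗ[R] H →ₗ[R] Q) (hB : ∀ x, B x x = 0) (x y : H) :
    B x y = - B y x := by
  have h := hB (x + y)
  simp only [map_add, LinearMap.add_apply, hB, zero_add, add_zero] at h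
  exact eq_neg_of_add_eq_zero_right h

/-- Symmetric matrices contribute nothing against an alternating form. -/
lemma pairB_symm (B : H →ₗ[R] H →ₗ[R] Q) (hB : ∀ x, B x x = 0) (S : Matrix ι ι R)
    (hS : Sᵀ = S) (b : ι → H) : pairB B (actM S b) b = 0 := by
  have e : pairB B (actM S b) b = ∑ x : ι × ι, S x.1 x.2 • B (b x.2) (b x.1) := by
    simp only [pairB, actM, map_sum, LinearMap.sum_apply, map_smul, LinearMap.smul_apply]
    rw [Fintype.sum_prod_type]
  rw [e]
  refine Finset.sum_involution (fun x _ => (x.2, x.1)) ?_ ?_ ?_ ?_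
  · rintro ⟨i, j⟩ -
    have : S j i = S i j := by
      conv_lhs => rw [← hS]
      rfl
    simp only [this]
    rw [alt_neg B hB (b j) (b i)]
    simp
  · rintro ⟨i, j⟩ - h h'
    apply h
    have : j = i := by simpa using congrArg Prod.fst h'
    subst this
    simp [hB]
  · simp
  · simp

/-- Equivalence of pairs of vectors. -/
def RelS (f : R →+* R') (B : H →ₗ[R] H →ₗ[R] Q) (a b a' b' : ι → H) : Prop :=
  (∃ N : Matrix (ι ⊕ ι) (ι ⊕ ι) R, IsUnit N ∧ N.map f ∈ symplecticGroup ι R' ∧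
    actM N (Sum.elim a b) = Sum.elim a' b') ∧ pairB B a b = pairB B a' b'

lemma RelS.trans {f : R →+* R'} {B : H →ₗ[R] H →ₗ[R] Q} {a b a' b' a'' b'' : ι → H}
    (h : RelS f B a b a' b') (h' : RelS f B a' b' a'' b'') : RelS f B a b a'' b'' := by
  obtain ⟨⟨N, hN, hN', e⟩, e'⟩ := h
  obtain ⟨⟨M, hM, hM', d⟩, d'⟩ := h'
  refine ⟨⟨M * N, hM.mul hN, ?_, ?_⟩, e'.trans d'⟩
  · rw [Matrix.map_mul]; exact mul_mem hM' hN'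
  · rw [actM_mul, e, d]

lemma RelS.symm {f : R →+* R'} {B : H →ₗ[R] H →ₗ[R] Q} {a b a' b' : ι → H}
    (h : RelS f B a b a' b') : RelS f B a' b' a b := by
  obtain ⟨⟨N, hN, hN', e⟩, e'⟩ := h
  obtain ⟨u, rfl⟩ := hN
  refine ⟨⟨(u⁻¹ : (Matrix (ι ⊕ ι) (ι ⊕ ι) R)ˣ), Units.isUnit _, ?_, ?_⟩, e'.symm⟩
  · have h1 : (u.1.map f) * ((u⁻¹).1.map f) = 1 := by
      rw [← Matrix.map_mul, Units.mul_inv]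
      simp
    have h2 : ((⟨_, hN'⟩ : symplecticGroup ι R')⁻¹).1 * (u.1.map f) = 1 := by
      have := inv_mul_cancel (⟨_, hN'⟩ : symplecticGroup ι R')
      exact congrArg Subtype.val this
    have h3 := left_inv_eq_right_inv h2 h1
    rw [← h3]
    exact Subtype.property _
  · rw [← e, ← actM_mul, Units.inv_mul, actM_one]

lemma upper_mem (S : Matrix ι ι R') (hS : Sᵀ = S) :
    fromBlocks 1 S 0 1 ∈ symplecticGroup ι R' := by
  rw [SymplecticGroup.mem_iff]
  simp [J, fromBlocks_transpose, fromBlocks_multiply, hS]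

lemma lower_mem (S : Matrix ι ι R') (hS : Sᵀ = S) :
    fromBlocks 1 0 S 1 ∈ symplecticGroup ι R' := by
  rw [SymplecticGroup.mem_iff]
  simp [J, fromBlocks_transpose, fromBlocks_multiply, hS]

lemma diag_mem (A D : Matrix ι ι R') (h : A * Dᵀ = 1) (h' : D * Aᵀ = 1) :
    fromBlocks A 0 0 D ∈ symplecticGroup ι R' := by
  rw [SymplecticGroup.mem_iff]
  simp [J, fromBlocks_transpose, fromBlocks_multiply, h, h']

lemma upper_unit (S : Matrix ι ι R) : IsUnit (fromBlocks (1 : Matrix ι ι R) S 0 (1 : Matrix ι ι R)) := by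
  rw [Matrix.isUnit_fromBlocks_zero₂₁]; simp

lemma RelS.upper (f : R →+* R') (B : H →ₗ[R] H →ₗ[R] Q) (hB : ∀ x, B x x = 0)
    (a b : ι → H) (S : Matrix ι ι R) (hS : Sᵀ = S) :
    RelS f B a b (a + actM S b) b := by
  refine ⟨⟨fromBlocks 1 S 0 1, upper_unit S, ?_, ?_⟩, ?_⟩
  · rw [Matrix.fromBlocks_map]
    have := upper_mem (S.map f) (by rw [← Matrix.transpose_map, hS])
    simpa using this
  · rw [actM_fromBlocks, actM_one, actM_one]
    congr 1
    funext i
    simp [actM]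
  · rw [pairB_add_left, pairB_symm B hB S hS, add_zero]

lemma RelS.lower (f : R →+* R') (B : H →ₗ[R] H →ₗ[R] Q) (hB : ∀ x, B x x = 0)
    (a b : ι → H) (S : Matrix ι ι R) (hS : Sᵀ = S) :
    RelS f B a b a (b + actM S a) := by
  refine ⟨⟨fromBlocks 1 0 S 1, ?_, ?_, ?_⟩, ?_⟩
  · rw [Matrix.isUnit_fromBlocks_zero₁₂]; simp
  · rw [Matrix.fromBlocks_map]
    have := lower_mem (S.map f) (by rw [← Matrix.transpose_map, hS])
    simpa using this
  · rw [actM_fromBlocks, actM_one, actM_one, add_comm b]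
    congr 1
    funext i
    simp [actM]
  · have := pairB_symm B hB S hS a
    rw [pairB_act, hS] at this
    rw [pairB_add_right, this, add_zero]

lemma RelS.gl (f : R →+* R') (B : H →ₗ[R] H →ₗ[R] Q)
    (a b : ι → H) (N : Matrix ι ι R) (hN : N * N = 0) :
    RelS f B a b (a - actM Nᵀ a) (b + actM N b) := by
  have h1 : (1 - Nᵀ) * (1 + N)ᵀ = 1 := by
    have : Nᵀ * Nᵀ = 0 := by rw [← transpose_mul, hN, transpose_zero]
    simp [sub_mul, mul_add, this]
  have h2 : (1 + N) * (1 - Nᵀ)ᵀ = 1 := by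
    simp [mul_sub, add_mul, hN]
  refine ⟨⟨fromBlocks (1 - Nᵀ) 0 0 (1 + N), ?_, ?_, ?_⟩, ?_⟩
  · rw [Matrix.isUnit_fromBlocks_zero₂₁]
    exact ⟨IsUnit.of_mul_eq_one _ h1, IsUnit.of_mul_eq_one _ h2⟩
  · rw [Matrix.fromBlocks_map]
    have := diag_mem ((1 - Nᵀ).map f) ((1 + N).map f)
      (by rw [← Matrix.transpose_map, ← Matrix.map_mul, h1]; simp)
      (by rw [← Matrix.transpose_map, ← Matrix.map_mul, h2]; simp)
    simpa using this
  · have z : ∀ c : ι → H, actM (0 : Matrix ι ι R) c = 0 := by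
      intro c; funext i; simp [actM]
    rw [actM_fromBlocks, z, z, sub_eq_add_neg, actM_add, actM_neg, actM_add, actM_one, actM_one]
    simp [sub_eq_add_neg]
  · have e : a - actM Nᵀ a = actM (1 - Nᵀ) a := by
      rw [sub_eq_add_neg, sub_eq_add_neg, actM_add, actM_neg, actM_one]
    have e' : b + actM N b = actM (1 + N) b := by rw [actM_add, actM_one]
    rw [e, e', pairB_act, ← actM_mul]
    have : (1 - Nᵀ)ᵀ * (1 + N) = 1 := by
      simp [sub_mul, mul_add, hN]
    rw [this, actM_one]

lemma RelS.gl' (f : R →+* R') (B : H →ₗ[R] H →ₗ[R] Q)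
    (a b : ι → H) (N : Matrix ι ι R) (hN : N * N = 0) :
    RelS f B a b (a + actM N a) (b - actM Nᵀ b) := by
  have h : (-Nᵀ) * (-Nᵀ) = 0 := by
    rw [neg_mul_neg, ← transpose_mul, hN, transpose_zero]
  have := RelS.gl f B a b (-Nᵀ) h
  simpa [actM_neg, sub_eq_add_neg] using this

lemma exists_rep [Fintype H] (S : Finset ι) (c : ι → H) :
    ∃ T : Finset ι, T ⊆ S ∧ T.card ≤ Fintype.card H ∧
      ∃ ρ : ι → ι, ∀ i ∈ S, ρ i ∈ T ∧ c (ρ i) = c i := by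
  classical
  have key2 : ∀ x : S.image c, ∃ j, j ∈ S ∧ c j = x := fun x => by
    exact Finset.mem_image.1 x.2
  choose j hj hj' using key2
  refine ⟨Finset.univ.image j, ?_, ?_, fun i => if h : i ∈ S then
    j ⟨c i, Finset.mem_image_of_mem c h⟩ else i, ?_⟩
  · intro i hi
    simp only [Finset.mem_image, Finset.mem_univ, true_and] at hi
    obtain ⟨x, rfl⟩ := hi
    exact hj x
  · refine Finset.card_image_le.trans ?_
    rw [Finset.card_univ, Fintype.card_coe]
    exact Finset.card_le_univ _
  · intro i hi
    simp only [hi, dif_pos]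
    exact ⟨Finset.mem_image_of_mem _ (Finset.mem_univ _), hj' _⟩

/-- The matrix with rows `i ∈ Z` equal to `c • e_{ρ i}`. -/
def rowM (R : Type*) [CommRing R] (Z : Finset ι) (ρ : ι → ι) : Matrix ι ι R :=
  fun i j => if i ∈ Z ∧ j = ρ i then -1 else 0

lemma rowM_sq (Z : Finset ι) (ρ : ι → ι) (h : ∀ i ∈ Z, ρ i ∉ Z) :
    rowM R Z ρ * rowM R Z ρ = 0 := by
  ext i k
  simp only [Matrix.mul_apply, rowM, Matrix.zero_apply]
  refine Finset.sum_eq_zero fun j _ => ?_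
  by_cases h1 : i ∈ Z ∧ j = ρ i
  · have : j ∉ Z := h1.2 ▸ h i h1.1
    simp [this]
  · simp [h1]

lemma actM_rowM (Z : Finset ι) (ρ : ι → ι) (c : ι → H) (i : ι) :
    actM (rowM R Z ρ) c i = if i ∈ Z then - c (ρ i) else 0 := by
  simp only [actM, rowM]
  by_cases h : i ∈ Z <;> simp [h, ite_smul]

lemma actM_eq_zero (A : Matrix α β R) (c : β → H) (i : α) (h : ∀ j, A i j = 0 ∨ c j = 0) :
    actM A c i = 0 := by
  refine Finset.sum_eq_zero fun j _ => ?_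
  rcases h j with h | h <;> simp [h]

/-- Every pair of vectors is equivalent to one with small support. -/
lemma exists_small [Fintype H] (f : R →+* R') (B : H →ₗ[R] H →ₗ[R] Q) (a b : ι → H) :
    ∃ T : Finset ι, T.card ≤ 2 * Fintype.card H ∧ ∃ a' b' : ι → H, RelS f B a b a' b' ∧
      ∀ i ∉ T, a' i = 0 ∧ b' i = 0 := by
  obtain ⟨T, -, hT, ρ, hρ⟩ := exists_rep Finset.univ b
  have h1 : ∀ i ∈ Tᶜ, ρ i ∉ Tᶜ := fun i _ => by simpa using (hρ i (Finset.mem_univ _)).1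
  have r1 := RelS.gl f B a b (rowM R Tᶜ ρ) (rowM_sq _ _ h1)
  generalize ha1 : a - actM (rowM R Tᶜ ρ)ᵀ a = a1 at r1
  generalize hb1 : b + actM (rowM R Tᶜ ρ) b = b1 at r1
  have hb : ∀ i ∉ T, b1 i = 0 := by
    intro i hi
    rw [← hb1, Pi.add_apply, actM_rowM]
    simp [hi, (hρ i (Finset.mem_univ _)).2]
  obtain ⟨T', hT', hc, τ, hτ⟩ := exists_rep Tᶜ a1
  have h2 : ∀ i ∈ (T ∪ T')ᶜ, τ i ∉ (T ∪ T')ᶜ := fun i hi => by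
    have := (hτ i (by simp at hi ⊢; tauto)).1
    simp [this]
  have r2 := RelS.gl' f B a1 b1 (rowM R (T ∪ T')ᶜ τ) (rowM_sq _ _ h2)
  refine ⟨T ∪ T', ?_, _, _, r1.trans r2, ?_⟩
  · refine (Finset.card_union_le _ _).trans ?_
    omega
  · intro i hi
    have hi' : i ∉ T := fun h => hi (Finset.mem_union_left _ h)
    constructor
    · rw [Pi.add_apply, actM_rowM]
      simp only [Finset.mem_compl, hi, not_false_eq_true, if_true]
      rw [(hτ i (by simpa using hi')).2]
      simp
    · rw [Pi.sub_apply, hb i hi', zero_sub, neg_eq_zero]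
      apply actM_eq_zero
      intro j
      by_cases hj : j ∈ T
      · left; simp [rowM, hj]
      · right; exact hb j hj

/-- Spanning is preserved. -/
lemma RelS.span {f : R →+* R'} {B : H →ₗ[R] H →ₗ[R] Q} {a b a' b' : ι → H}
    (h : RelS f B a b a' b')
    (hs : ∀ x : H, ∃ v w : ι → R, x = ∑ i, v i • a i + ∑ i, w i • b i) :
    ∀ x : H, ∃ v w : ι → R, x = ∑ i, v i • a' i + ∑ i, w i • b' i := by
  obtain ⟨⟨N, -, -, e⟩, -⟩ := h.symm
  intro x
  obtain ⟨v, w, hx⟩ := hs x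
  have h1 : x = ∑ i, (Sum.elim v w) i • (Sum.elim a b) i := by
    rw [hx, Fintype.sum_sum_type]; simp
  rw [← e] at h1
  have h2 : x = ∑ j, (Matrix.vecMul (Sum.elim v w) N) j • (Sum.elim a' b') j := by
    rw [h1]
    simp only [actM, Finset.smul_sum, vecMul, dotProduct, Finset.sum_smul, mul_smul]
    rw [Finset.sum_comm]
  rw [Fintype.sum_sum_type] at h2
  exact ⟨_, _, h2⟩

/-- Normal form. -/
lemma exists_normal [Fintype H] [DecidableEq H] (f : R →+* R') (B : H →ₗ[R] H →ₗ[R] Q)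
    (hB : ∀ x, B x x = 0) (a b : ι → H) (σ : H → ι) (hσ : Function.Injective σ)
    (h0 : ∀ x, a (σ x) = 0 ∧ b (σ x) = 0)
    (hs : ∀ x : H, ∃ v w : ι → R, x = ∑ i, v i • a i + ∑ i, w i • b i) :
    ∃ a' b' : ι → H, RelS f B a b a' b' ∧ (∀ x, b' (σ x) = x) ∧
      ∀ i, (∀ x, i ≠ σ x) → a' i = 0 ∧ b' i = 0 := by
  classical
  choose v w hvw using hs
  set U : Finset ι := Finset.univ.image σ with hU
  have mU : ∀ x, σ x ∈ U := fun x => by simp [hU]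
  have aU : ∀ i ∈ U, a i = 0 := by
    intro i hi
    simp only [hU, Finset.mem_image, Finset.mem_univ, true_and] at hi
    obtain ⟨x, rfl⟩ := hi
    exact (h0 x).1
  have bU : ∀ i ∈ U, b i = 0 := by
    intro i hi
    simp only [hU, Finset.mem_image, Finset.mem_univ, true_and] at hi
    obtain ⟨x, rfl⟩ := hi
    exact (h0 x).2
  -- left inverse of `σ`
  obtain ⟨θ, hθ⟩ : ∃ θ : ι → H, ∀ x, θ (σ x) = x :=
    ⟨Function.invFun σ, Function.leftInverse_invFun hσ⟩
  let N : Matrix ι ι R := fun i j => if i ∈ U ∧ j ∉ U then w (θ i) j else 0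
  have hN : N * N = 0 := by
    ext i k
    simp only [Matrix.mul_apply, N, Matrix.zero_apply]
    refine Finset.sum_eq_zero fun j _ => ?_
    by_cases hj : j ∈ U <;> simp [hj]
  let S₀ : Matrix ι ι R := fun i j => if i ∈ U ∧ j ∉ U then v (θ i) j else 0
  have r1 := RelS.gl f B a b N hN
  have e1 : a - actM Nᵀ a = a := by
    funext i
    rw [Pi.sub_apply, actM_eq_zero, sub_zero]
    intro j
    by_cases hj : j ∈ U
    · right; exact aU j hj
    · left; rw [transpose_apply]; simp [N, hj]
  rw [e1] at r1
  have r2 := RelS.lower f B hB a (b + actM N b) (S₀ + S₀ᵀ)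
    (by rw [transpose_add, transpose_transpose, add_comm])
  have e2 : actM S₀ᵀ a = 0 := by
    funext i
    apply actM_eq_zero
    intro j
    by_cases hj : j ∈ U
    · right; exact aU j hj
    · left; rw [transpose_apply]; simp [S₀, hj]
  rw [actM_add, e2, add_zero] at r2
  have r12 := r1.trans r2
  generalize hb1 : b + actM N b + actM S₀ a = b1 at r12
  have hb : ∀ x, b1 (σ x) = x := by
    intro x
    rw [← hb1, Pi.add_apply, Pi.add_apply, (h0 x).2, zero_add]
    conv_rhs => rw [hvw x]
    rw [add_comm]
    congr 1
    · refine Finset.sum_congr rfl fun j _ => ?_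
      by_cases hj : j ∈ U
      · simp [aU j hj]
      · simp [S₀, hj, mU, hθ]
    · refine Finset.sum_congr rfl fun j _ => ?_
      by_cases hj : j ∈ U
      · simp [bU j hj]
      · simp [N, hj, mU, hθ]
  have r3 := RelS.gl f B a b1 (rowM R Uᶜ (fun i => σ (b1 i)))
    (rowM_sq _ _ (fun i _ => by simp [mU]))
  generalize ha2 : a - actM (rowM R Uᶜ (fun i => σ (b1 i)))ᵀ a = a2 at r3
  generalize hb2 : b1 + actM (rowM R Uᶜ (fun i => σ (b1 i))) b1 = b2 at r3
  have hb2U : ∀ x, b2 (σ x) = x := by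
    intro x
    rw [← hb2, Pi.add_apply, actM_rowM]
    simp [mU, hb]
  have hb20 : ∀ i ∉ U, b2 i = 0 := by
    intro i hi
    rw [← hb2, Pi.add_apply, actM_rowM]
    simp [hi, hb]
  set K : Matrix ι ι R := rowM R Uᶜ (fun i => σ (a2 i)) with hK
  have r4 := RelS.upper f B hB a2 b2 (K + Kᵀ)
    (by rw [transpose_add, transpose_transpose, add_comm])
  refine ⟨_, _, r12.trans (r3.trans r4), hb2U, ?_⟩
  intro i hi
  have hi' : i ∉ U := by
    simp only [hU, Finset.mem_image, Finset.mem_univ, true_and, not_exists]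
    exact fun x h => hi x h.symm
  refine ⟨?_, hb20 i hi'⟩
  have z : actM Kᵀ b2 i = 0 := by
    apply actM_eq_zero
    intro j
    by_cases hj : j ∈ U
    · left; simp [hK, rowM, hj]
    · right; exact hb20 j hj
  rw [actM_add, Pi.add_apply, Pi.add_apply, z, add_zero, hK, actM_rowM]
  simp [hi', hb2U]

/-- The submodule of relations. -/
def relW (R H : Type*) [CommRing R] [AddCommGroup H] [Module R H] [Fintype H] (q : R) :
    Submodule R (Matrix H H R) where
  carrier := {K | ∃ S Z : Matrix H H R, Sᵀ = S ∧ ∀ h, ∑ x, K h x • x = ∑ x, (S + q • Z) h x • x}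
  zero_mem' := ⟨0, 0, by simp, by simp⟩
  add_mem' := by
    rintro K K' ⟨S, Z, hS, h⟩ ⟨S', Z', hS', h'⟩
    refine ⟨S + S', Z + Z', by rw [transpose_add, hS, hS'], fun x => ?_⟩
    have := congrArg₂ (· + ·) (h x) (h' x)
    simp only [← Finset.sum_add_distrib, ← add_smul] at this
    simp only [Matrix.add_apply] at this ⊢
    rw [this]
    refine Finset.sum_congr rfl fun y _ => ?_
    congr 1
    simp; ring
  smul_mem' := by
    rintro c K ⟨S, Z, hS, h⟩
    refine ⟨c • S, c • Z, by rw [transpose_smul, hS], fun x => ?_⟩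
    have := congrArg (c • ·) (h x)
    simp only [Finset.smul_sum, smul_smul] at this
    simp only [Matrix.smul_apply, smul_eq_mul] at this ⊢
    rw [this]
    refine Finset.sum_congr rfl fun y _ => ?_
    congr 1
    simp; ring

section form
variable [Fintype H] [DecidableEq H] (q : R)

/-- class of an elementary matrix -/
def bq (x y : H) : Matrix H H R ⧸ relW R H q :=
  (relW R H q).mkQ (Matrix.single y x 1)

lemma row_mem (K : Matrix H H R) (h : ∀ h, ∑ x, K h x • x = 0) : K ∈ relW R H q :=
  ⟨0, 0, by simp, fun x => by simp [h x]⟩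

lemma symm_mem (K : Matrix H H R) (h : Kᵀ = K) : K ∈ relW R H q :=
  ⟨K, 0, h, fun x => by simp⟩

lemma single_sum (y x : H) (h : H) :
    ∑ z, (Matrix.single y x (1 : R)) h z • z = if y = h then x else 0 := by
  simp only [Matrix.single_apply]
  by_cases hy : y = h <;> simp [hy, ite_smul]

lemma bq_anti (x y : H) : bq (R := R) q x y = - bq q y x := by
  rw [eq_neg_iff_add_eq_zero, bq, bq, ← map_add, Submodule.mkQ_apply,
    Submodule.Quotient.mk_eq_zero]
  apply symm_mem
  simp [transpose_add, Matrix.transpose_single, add_comm]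

lemma bq_self (x : H) : bq (R := R) q x x = 0 := by
  rw [bq, Submodule.mkQ_apply, Submodule.Quotient.mk_eq_zero]
  apply symm_mem
  simp [Matrix.transpose_single]

lemma bq_add (x x' y : H) : bq (R := R) q (x + x') y = bq q x y + bq q x' y := by
  rw [← sub_eq_zero, bq, bq, bq, ← map_add, ← map_sub, Submodule.mkQ_apply,
    Submodule.Quotient.mk_eq_zero]
  apply row_mem
  intro h
  simp only [Matrix.sub_apply, Matrix.add_apply, sub_smul, add_smul, Finset.sum_sub_distrib,
    Finset.sum_add_distrib, single_sum]
  split_ifs <;> simp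

lemma bq_smul (c : R) (x y : H) : bq (R := R) q (c • x) y = c • bq q x y := by
  rw [← sub_eq_zero, bq, bq, ← map_smul, ← map_sub, Submodule.mkQ_apply,
    Submodule.Quotient.mk_eq_zero]
  apply row_mem
  intro h
  simp only [Matrix.sub_apply, Matrix.smul_apply, sub_smul, smul_assoc, Finset.sum_sub_distrib,
    ← Finset.smul_sum, single_sum]
  split_ifs <;> simp

/-- The universal alternating form. -/
def BQ : H →ₗ[R] H →ₗ[R] (Matrix H H R ⧸ relW R H q) :=
  LinearMap.mk₂ R (bq q) (bq_add q) (bq_smul q)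
    (fun x y y' => by
      rw [bq_anti, bq_add, bq_anti q x y, bq_anti q x y']; abel)
    (fun c x y => by rw [bq_anti, bq_smul, bq_anti q x y, smul_neg])

lemma BQ_apply (x y : H) : BQ (R := R) q x y = (relW R H q).mkQ (Matrix.single y x 1) := rfl

lemma BQ_self (x : H) : BQ (R := R) q x x = 0 := bq_self q x

lemma q_kill (z : Matrix H H R ⧸ relW R H q) : q • z = 0 := by
  obtain ⟨K, rfl⟩ := Submodule.mkQ_surjective _ z
  rw [← map_smul, Submodule.mkQ_apply, Submodule.Quotient.mk_eq_zero]
  exact ⟨0, K, by simp, fun x => by simp⟩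

/-- Comparison of two normal forms. -/
lemma final_move (f : R →+* R') (hf : f q = 0) (a a' b : ι → H) (σ : H → ι)
    (hσ : Function.Injective σ) (hb : ∀ x, b (σ x) = x)
    (h0 : ∀ i, (∀ x, i ≠ σ x) → a i = 0 ∧ a' i = 0 ∧ b i = 0)
    (hp : pairB (BQ (R := R) q) a b = pairB (BQ q) a' b) :
    ∃ N : Matrix (ι ⊕ ι) (ι ⊕ ι) R, IsUnit N ∧ N.map f ∈ symplecticGroup ι R' ∧
      actM N (Sum.elim a b) = Sum.elim a' b := by
  have hsum : ∀ {M : Type _} [AddCommMonoid M] (F : ι → M), (∀ i, (∀ x, i ≠ σ x) → F i = 0) →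
      ∑ i, F i = ∑ x, F (σ x) := by
    intro M _ F hF
    rw [← Finset.sum_image (s := Finset.univ) (g := σ) (f := F) (fun x _ y _ h => hσ h)]
    symm
    apply Finset.sum_subset (Finset.subset_univ _)
    intro i _ hi
    apply hF
    intro x hx
    exact hi (by simp [hx])
  have e : ∀ c : ι → H, pairB (BQ (R := R) q) c b =
      (relW R H q).mkQ (∑ x, Matrix.single x (c (σ x)) 1) := by
    intro c
    rw [pairB, hsum]
    · simp only [hb, BQ_apply, map_sum]
    · intro i hi
      rw [(h0 i hi).2.2, map_zero]
  rw [e, e, ← sub_eq_zero, ← map_sub, Submodule.mkQ_apply, Submodule.Quotient.mk_eq_zero] at hp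
  obtain ⟨S, Z, hS, h⟩ := hp
  have h' : ∀ y, a (σ y) - a' (σ y) = ∑ x, (S + q • Z) y x • x := by
    intro y
    rw [← h y]
    simp only [Matrix.sub_apply, sub_smul, Finset.sum_sub_distrib, Matrix.sum_apply,
      Finset.sum_smul]
    rw [Finset.sum_comm, Finset.sum_comm (f := fun x z => Matrix.single z (a' (σ z)) (1 : R) y x • x)]
    simp [single_sum]
  let P : Matrix ι H R := fun i x => if i = σ x then 1 else 0
  have hP : ∀ (c : ι → H), actM Pᵀ c = fun x => c (σ x) := by
    intro c; funext x
    simp only [actM, transpose_apply]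
    simp [P, ite_smul]
  have hP1 : ∀ (c : H → H) y, actM P c (σ y) = c y := by
    intro c y
    simp [actM, P, ite_smul, hσ.eq_iff]
  have hP0 : ∀ (c : H → H) i, (∀ x, i ≠ σ x) → actM P c i = 0 := by
    intro c i hi
    simp [actM, P, hi]
  refine ⟨fromBlocks 1 (-(P * (S + q • Z) * Pᵀ)) 0 1, upper_unit _, ?_, ?_⟩
  · have hz : (S + q • Z).map f = S.map f := by
      ext i j; simp [hf]
    have := upper_mem ((-(P * (S + q • Z) * Pᵀ)).map f) (by
      have e : (-(P * (S + q • Z) * Pᵀ)).map f = -(P.map f * S.map f * (P.map f)ᵀ) := by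
        rw [← hz, ← Matrix.transpose_map, ← Matrix.map_mul, ← Matrix.map_mul]
        ext i j; simp only [Matrix.map_apply, Matrix.neg_apply, map_neg]
      rw [e, transpose_neg, transpose_mul, transpose_mul, transpose_transpose,
        ← Matrix.transpose_map, hS, Matrix.mul_assoc])
    rw [Matrix.fromBlocks_map]
    simpa using this
  · rw [actM_fromBlocks, actM_one, actM_one]
    congr 1
    · funext i
      rw [actM_neg, actM_mul, actM_mul, hP, Pi.add_apply, Pi.neg_apply]
      by_cases hi : ∃ x, i = σ x
      · obtain ⟨x, rfl⟩ := hi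
        rw [hP1]
        simp only [actM, hb]
        rw [← h']
        abel
      · push Not at hi
        rw [hP0 _ _ hi, (h0 i hi).1, (h0 i hi).2.1]; simp
    · funext i
      simp [actM]

end form

/-- Evaluate an alternating form on the exterior algebra. -/
lemma exists_ext {Q' : Type*} [AddCommGroup Q'] (B : H →ₗ[ℤ] H →ₗ[ℤ] Q')
    (hB : ∀ x, B x x = 0) :
    ∃ L : ExteriorAlgebra ℤ H →ₗ[ℤ] Q', ∀ x y,
      L (ExteriorAlgebra.ι ℤ x * ExteriorAlgebra.ι ℤ y) = B x y := by
  let A : H [⋀^Fin 2]→ₗ[ℤ] Q' :=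
    { toFun := fun v => B (v 0) (v 1)
      map_update_add' := by
        intro _ v i x y
        fin_cases i <;> simp [Function.update]
      map_update_smul' := by
        intro _ v i x y
        fin_cases i <;> simp [Function.update]
      map_eq_zero_of_eq' := by
        intro v i j h hij
        fin_cases i <;> fin_cases j <;> simp_all }
  let AA : ∀ n, H [⋀^Fin n]→ₗ[ℤ] Q' := fun n =>
    match n with
    | 2 => A
    | _ => 0
  refine ⟨ExteriorAlgebra.liftAlternating AA, fun x y => ?_⟩
  have : ExteriorAlgebra.ι ℤ x * ExteriorAlgebra.ι ℤ y = ExteriorAlgebra.ιMulti ℤ 2 ![x, y] := by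
    simp [ExteriorAlgebra.ιMulti_apply]
  rw [this, ExteriorAlgebra.liftAlternating_apply_ιMulti]
  rfl

end Helpers

/-- Let `p` be a prime, `r ≥ 1`, and `H` a finite abelian `p`-group viewed as a
`ℤ_p`-module.  There is a `g₀` (depending on `H` and `r`) such that for all `g ≥ g₀` and all
surjective `ℤ_p`-linear maps `φ_a, φ_b : ℤ_p^{2g} → H` with `F(φ_a) - F(φ_b) ∈ p^r ⋀²H`,
there is `M ∈ Sp^{(r)}_{2g}(ℤ_p)` with `φ_b = φ_a ∘ M`. -/
theorem stmt_15 (r : ℕ) (hr : 1 ≤ r)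
    (H : Type) [AddCommGroup H] [Finite H] [Module ℤ_[p] H] :
    ∃ g₀ : ℕ, ∀ g : ℕ, g₀ ≤ g →
      ∀ φa φb : ((Fin g ⊕ Fin g) → ℤ_[p]) →ₗ[ℤ_[p]] H,
        Function.Surjective φa → Function.Surjective φb →
        (∃ z ∈ ⋀[ℤ]^2 H, Fsymp p H φa - Fsymp p H φb = ((p : ℤ) ^ r) • z) →
        ∃ M : Matrix (Fin g ⊕ Fin g) (Fin g ⊕ Fin g) ℤ_[p],
          IsUnit M ∧
          (M.map (PadicInt.toZModPow r))ᵀ * Matrix.J (Fin g) (ZMod (p ^ r)) *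
              (M.map (PadicInt.toZModPow r))
            = Matrix.J (Fin g) (ZMod (p ^ r)) ∧
          ∀ v : (Fin g ⊕ Fin g) → ℤ_[p], φb v = φa (M.mulVec v) := by
  classical
  haveI := Fintype.ofFinite H
  refine ⟨5 * Fintype.card H, fun g hg φa φb ha hb hz => ?_⟩
  let f : ℤ_[p] →+* ZMod (p ^ r) := PadicInt.toZModPow r
  let q : ℤ_[p] := (p : ℤ_[p]) ^ r
  have hf : f q = 0 := by
    have : f q = ((p ^ r : ℕ) : ZMod (p ^ r)) := by
      simp only [q, map_pow, map_natCast, Nat.cast_pow]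
    rw [this, ZMod.natCast_self]
  let B := BQ (R := ℤ_[p]) (H := H) q
  have hB : ∀ x, B x x = 0 := BQ_self q
  have hφ : ∀ (φ : ((Fin g ⊕ Fin g) → ℤ_[p]) →ₗ[ℤ_[p]] H) v,
      φ v = ∑ i, v i • φ (Pi.single i 1) := by
    intro φ v
    conv_lhs => rw [pi_eq_sum_univ' v]
    simp only [map_sum, map_smul]
  have hspan : ∀ (φ : ((Fin g ⊕ Fin g) → ℤ_[p]) →ₗ[ℤ_[p]] H), Function.Surjective φ →
      ∀ x : H, ∃ v w : Fin g → ℤ_[p], x = ∑ i, v i • φ (Pi.single (Sum.inl i) 1)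
        + ∑ i, w i • φ (Pi.single (Sum.inr i) 1) := by
    intro φ hs x
    obtain ⟨v, rfl⟩ := hs x
    refine ⟨fun i => v (Sum.inl i), fun i => v (Sum.inr i), ?_⟩
    rw [hφ φ v, Fintype.sum_sum_type]
  have hpair : pairB B (fun i => φa (Pi.single (Sum.inl i) 1)) (fun i => φa (Pi.single (Sum.inr i) 1))
      = pairB B (fun i => φb (Pi.single (Sum.inl i) 1))
        (fun i => φb (Pi.single (Sum.inr i) 1)) := by
    obtain ⟨z, -, hz⟩ := hz
    let B' : H →ₗ[ℤ] H →ₗ[ℤ] _ := LinearMap.mk₂ ℤ (fun x y => B x y) (by simp) (by simp)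
      (by simp) (by simp)
    obtain ⟨L, hL⟩ := exists_ext B' hB
    have h1 := congrArg L hz
    have h2 : L (((p : ℤ) ^ r) • z) = 0 := by
      rw [map_smul]
      have := q_kill q (L z)
      rw [← this, ← Int.cast_smul_eq_zsmul ℤ_[p]]
      simp [q]
    rw [h2, map_sub, sub_eq_zero] at h1
    simp only [Fsymp, map_sum, hL] at h1
    exact h1
  obtain ⟨Ta, hTa, a1, b1, ra, za⟩ := exists_small f B (fun i => φa (Pi.single (Sum.inl i) 1))
    (fun i => φa (Pi.single (Sum.inr i) 1))
  obtain ⟨Tb, hTb, a2, b2, rb, zb⟩ := exists_small f B (fun i => φb (Pi.single (Sum.inl i) 1))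
    (fun i => φb (Pi.single (Sum.inr i) 1))
  have hcard : Fintype.card H ≤ Fintype.card ((Ta ∪ Tb)ᶜ : Finset (Fin g)) := by
    rw [Fintype.card_coe, Finset.card_compl, Fintype.card_fin]
    have := Finset.card_union_le Ta Tb
    omega
  obtain ⟨σ⟩ := Function.Embedding.nonempty_of_card_le hcard
  have hσ : Function.Injective (fun x => (σ x : Fin g)) :=
    Subtype.val_injective.comp σ.injective
  have hσa : ∀ x, (σ x : Fin g) ∉ Ta := fun x h => by
    have := (σ x).2
    simp [h] at this
  have hσb : ∀ x, (σ x : Fin g) ∉ Tb := fun x h => by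
    have := (σ x).2
    simp [h] at this
  obtain ⟨a3, b3, ra', hb3, z3⟩ := exists_normal f B hB a1 b1 (fun x => (σ x : Fin g)) hσ
    (fun x => za _ (hσa x)) (ra.span (hspan φa ha))
  obtain ⟨a4, b4, rb', hb4, z4⟩ := exists_normal f B hB a2 b2 (fun x => (σ x : Fin g)) hσ
    (fun x => zb _ (hσb x)) (rb.span (hspan φb hb))
  have hbb : b4 = b3 := by
    funext i
    by_cases hi : ∃ x, i = (σ x : Fin g)
    · obtain ⟨x, rfl⟩ := hi
      rw [hb3, hb4]
    · push Not at hi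
      rw [(z3 i hi).2, (z4 i hi).2]
  subst hbb
  have r1 := ra.trans ra'
  have r2 := rb.trans rb'
  have hp : pairB B a3 b4 = pairB B a4 b4 := by
    rw [← r1.2, ← r2.2, hpair]
  have fm := final_move q f hf a3 a4 b4 (fun x => (σ x : Fin g)) hσ hb4
    (fun i hi => ⟨(z3 i hi).1, (z4 i hi).1, (z4 i hi).2⟩) hp
  have r3 : RelS f B a3 b4 a4 b4 := ⟨fm, hp⟩
  obtain ⟨⟨N, hN, hN', e⟩, -⟩ := (r1.trans r3).trans r2.symm
  refine ⟨Nᵀ, ?_, ?_, ?_⟩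
  · exact (Matrix.isUnit_transpose N).2 hN
  · rw [SymplecticGroup.mem_iff] at hN'
    rw [Matrix.transpose_map, Matrix.transpose_transpose]
    exact hN'
  · intro v
    have e' : ∀ i, φb (Pi.single i 1) = ∑ j, N i j • φa (Pi.single j 1) := by
      intro i
      have h1 : Sum.elim (fun i => φb (Pi.single (Sum.inl i) 1))
        (fun i => φb (Pi.single (Sum.inr i) 1)) i = φb (Pi.single i 1) := by
        cases i <;> rfl
      rw [← h1, ← e]
      refine Finset.sum_congr rfl fun j _ => ?_
      cases j <;> rfl
    rw [hφ φb, hφ φa]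
    simp only [e', mulVec, dotProduct, transpose_apply, Finset.smul_sum, Finset.sum_smul,
      smul_smul]
    rw [Finset.sum_comm]
    simp only [mul_comm]
end
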